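/- For any partition λ = [λ1,…,λs], one has the commutation relation ∏_{1≤i≤s} (C_{λ_i}^{(α)}(−t,q) + C_{λ_i}^{(α)}(−t,r)) · 𝒢^{(α)}(t,p,q,r) = 𝒢^{(α)}(t,p,q,r) · ∏_{1≤i≤s} C_{λ_i}^{(α)}(−t,p), as operators from ℚ(α)[p] to ℚ(α)[q,r]⟦t⟧. -/

import Mathlib

open scoped Classical

noncomputable section

/-- The base field `ℚ(α)` of rational functions in the Jack parameter `α`. -/
abbrev F : Type := RatFunc ℚ

/-- The Jack deformation parameter `α`. -/
def alpha : F := RatFunc.X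

/-- An integer partition, encoded as a multiset of positive integers (its parts). -/
abbrev JPartition : Type := Multiset ℕ+

/-- The size `|λ|` of a partition. -/
def psize (l : JPartition) : ℕ := (l.map fun i => (i : ℕ)).sum

/-- The length `ℓ(λ)` of a partition. -/
def plen (l : JPartition) : ℕ := Multiset.card l

/-- `m_i(λ)`, the number of parts of `λ` equal to `i`. -/
def pmult (l : JPartition) (i : ℕ+) : ℕ := Multiset.count i l

/-- `λ ∪ 1^k`, adjoining `k` parts equal to `1`. -/
def addOnes (l : JPartition) (k : ℕ) : JPartition := l + Multiset.replicate k 1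

/-- `λ̃`, the partition obtained by deleting all parts equal to `1`. -/
def removeOnes (l : JPartition) : JPartition := Multiset.filter (fun i => i ≠ 1) l

/-- Exponent vectors of monomials in the power-sum generators `p₁, p₂, …`. -/
abbrev Exp : Type := ℕ+ →₀ ℕ

/-- The exponent vector of the monomial `p_λ`. -/
def toExp (l : JPartition) : Exp := l.toFinset.sum fun i => Finsupp.single i (Multiset.count i l)

/-- The partition corresponding to an exponent vector. -/
def toPart (m : Exp) : JPartition := m.sum fun i k => Multiset.replicate k i

/-- The weighted degree (`deg p_i = i`) of an exponent vector; this is the size of the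
corresponding partition. -/
def wt (m : Exp) : ℕ := m.sum fun i k => k * (i : ℕ)

/-- The algebra `ℚ(α)[p₁, p₂, …]` of symmetric functions written in the power-sum basis. -/
abbrev SymA : Type := MvPolynomial ℕ+ F

/-- The power-sum monomial `p_λ`. -/
def pPow (l : JPartition) : SymA := (l.map fun i => MvPolynomial.X i).prod

/-- `z_λ α^{ℓ(λ)}`, attached to the exponent vector of `p_λ`. -/
def zalpha (m : Exp) : F :=
  algebraMap ℚ F (m.prod fun i k => (Nat.factorial k : ℚ) * ((i : ℕ) : ℚ) ^ k) *
    alpha ^ (m.sum fun _ k => k)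

/-- The `α`-deformed Hall scalar product: `⟨p_λ, p_μ⟩ = δ_{λμ} z_λ α^{ℓ(λ)}`. -/
def hall (f g : SymA) : F :=
  ∑ m ∈ f.support, MvPolynomial.coeff m f * MvPolynomial.coeff m g * zalpha m

/-- The parts of a partition, sorted in weakly decreasing order. -/
def sortedParts (l : JPartition) : List ℕ := ((l.map fun i => (i : ℕ)).sort (· ≤ ·)).reverse

/-- The sum of the `k` largest parts of a partition. -/
def topSum (l : JPartition) (k : ℕ) : ℕ := ((sortedParts l).take k).sum

/-- The dominance order on partitions: `μ ⊴ λ`. -/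
def dominates (mu lam : JPartition) : Prop :=
  psize mu = psize lam ∧ ∀ k, topSum mu k ≤ topSum lam k

/-- Evaluation of a symmetric function (in power-sum coordinates) in `N` variables
`x₁, …, x_N`: it sends `p_i ↦ x₁^i + ⋯ + x_N^i`. -/
def evalN (N : ℕ) : SymA →ₐ[F] MvPolynomial (Fin N) F :=
  MvPolynomial.aeval fun i : ℕ+ => ∑ j : Fin N, MvPolynomial.X j ^ (i : ℕ)

/-- The exponent of the monomial `x₁^{μ₁} ⋯ x_s^{μ_s}` in `N` variables, for `μ` a
partition; its coefficient in a symmetric polynomial is the coefficient of the monomial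
symmetric function `m_μ` (provided `N ≥ ℓ(μ)`). -/
def xexp (mu : JPartition) (N : ℕ) : Fin N →₀ ℕ :=
  Finsupp.equivFunOnFinite.symm fun j => (sortedParts mu).getD (j : ℕ) 0

/-- The defining properties of the family of Jack polynomials `J_λ^{(α)}` (Macdonald's
characterization): orthogonality for the `α`-deformed Hall product, triangularity with
respect to monomial symmetric functions in dominance order, and normalization
`[p_{1^n}] J_λ^{(α)} = 1`. -/
structure IsJackFamily (J : JPartition → SymA) : Prop where
  orthogonal : ∀ l m : JPartition, l ≠ m → hall (J l) (J m) = 0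
  triangular : ∀ l m : JPartition, ¬ dominates m l →
    MvPolynomial.coeff (xexp m (psize l + psize m + plen m))
      (evalN (psize l + psize m + plen m) (J l)) = 0
  normalized : ∀ l : JPartition, MvPolynomial.coeff (Finsupp.single 1 (psize l)) (J l) = 1

/-- The Jack character `θ_μ^{(α)}(λ)`. -/
def theta (J : JPartition → SymA) (mu lam : JPartition) : F :=
  if psize lam < psize mu then 0
  else (Nat.choose (psize lam - psize mu + pmult mu 1) (pmult mu 1) : F) *
    MvPolynomial.coeff (toExp (addOnes mu (psize lam - psize mu))) (J lam)

/-- `g` is the family of structure coefficients of Jack characters: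
`θ_μ^{(α)} θ_ν^{(α)} = ∑_π g^π_{μ,ν}(α) θ_π^{(α)}` (as functions on Young diagrams,
with finitely many nonzero terms). -/
def IsStructCoeffs (J : JPartition → SymA) (g : JPartition → JPartition → JPartition → F) :
    Prop :=
  (∀ mu nu : JPartition, {pi : JPartition | g pi mu nu ≠ 0}.Finite) ∧
  ∀ mu nu lam : JPartition,
    theta J mu lam * theta J nu lam = ∑ᶠ pi : JPartition, g pi mu nu * theta J pi lam


/-- The polynomial algebra `ℚ(α)[p₁,p₂,…][y₀,y₁,…]` containing the catalytic variables. -/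
abbrev PY : Type := MvPolynomial (ℕ+ ⊕ ℕ) F

/-- The variable `p_i` inside `PY`. -/
def pv (i : ℕ+) : PY := MvPolynomial.X (Sum.inl i)

/-- The catalytic variable `y_j` inside `PY`. -/
def yv (j : ℕ) : PY := MvPolynomial.X (Sum.inr j)

/-- The operator `Y₊ = ∑_{i≥0} y_{i+1} ∂/∂y_i`. -/
def Yplus (f : PY) : PY := ∑ᶠ j : ℕ, yv (j + 1) * MvPolynomial.pderiv (Sum.inr j) f

/-- The operator
`Γ_Y = (1+b) ∑_{i,j≥1} y_{i+j} j ∂²/(∂y_{i-1}∂p_j) + ∑_{i,j≥1} y_i p_j ∂/∂y_{i+j-1}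
      + b ∑_{i≥1} y_{i+1} i ∂/∂y_i`, with `b = α - 1`. -/
def GammaY (f : PY) : PY :=
  alpha • (∑ᶠ i : ℕ+, ∑ᶠ j : ℕ+, ((j : ℕ) : F) •
      (yv ((i : ℕ) + (j : ℕ)) *
        MvPolynomial.pderiv (Sum.inl j) (MvPolynomial.pderiv (Sum.inr ((i : ℕ) - 1)) f)))
  + (∑ᶠ i : ℕ+, ∑ᶠ j : ℕ+,
      yv (i : ℕ) * pv j * MvPolynomial.pderiv (Sum.inr ((i : ℕ) + (j : ℕ) - 1)) f)
  + (alpha - 1) • (∑ᶠ i : ℕ+, ((i : ℕ) : F) •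
      (yv ((i : ℕ) + 1) * MvPolynomial.pderiv (Sum.inr (i : ℕ)) f))

/-- The operator `Θ_Y = ∑_{i≥1} p_i ∂/∂y_i`. -/
def ThetaY (f : PY) : PY := ∑ᶠ i : ℕ+, pv i * MvPolynomial.pderiv (Sum.inr (i : ℕ)) f

/-- Ordered composite of the operators `Y₊` (for `true`) and `Γ_Y` (for `false`). -/
def wordOp : List Bool → PY → PY
  | [], f => f
  | b :: w, f => (if b then Yplus else GammaY) (wordOp w f)

/-- Projection `PY → SymA` killing the catalytic variables. -/
def dropY : PY →ₐ[F] SymA :=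
  MvPolynomial.aeval fun v => match v with
    | Sum.inl i => MvPolynomial.X i
    | Sum.inr _ => 0

/-- `Bc n ℓ` is the coefficient of `u^ℓ` in the operator
`B_n^{(α)}(p, u) = Θ_Y (Γ_Y + u Y₊)^n (y₀ / (1+b))`, viewed as an operator on `ℚ(α)[p]`. -/
def Bc (n ℓ : ℕ) (f : SymA) : SymA :=
  dropY (ThetaY (∑ s ∈ Finset.univ.filter
      (fun s : Fin n → Bool => (Finset.univ.filter fun i => s i = true).card = ℓ),
    wordOp (List.ofFn s) (alpha⁻¹ • (yv 0 * MvPolynomial.rename Sum.inl f))))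

/-- Matrix entries of `Bc n ℓ` in the basis of power-sum monomials. -/
def Bmat (n ℓ : ℕ) (m m' : Exp) : F :=
  MvPolynomial.coeff m (Bc n ℓ (MvPolynomial.monomial m' 1))

/-- The adjoint of `Bc n ℓ` with respect to the `α`-deformed Hall scalar product
(`⟨Bperp f, g⟩ = ⟨f, Bc g⟩`), given by its matrix in the power-sum basis. -/
def Bperp (n ℓ : ℕ) (f : SymA) : SymA :=
  ∑ m' ∈ f.support, MvPolynomial.coeff m' f •
    ∑ᶠ m : Exp, (Bmat n ℓ m' m * zalpha m' / zalpha m) • (MvPolynomial.monomial m (1 : F))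



/-- The coefficient of `q_μ r_ν t^k` in `𝒢^{(α)}(t,p,q,r) ⬝ f`, where
`𝒢^{(α)}(t,p,q,r) : ℚ(α)[p] → ℚ(α)[q,r]⟦t⟧` is the linear operator
`p_π ↦ ∑_{μ,ν} t^{|μ|+|ν|-|π|} g^π_{μ,ν}(α) q_μ r_ν`. -/
def GopCoef (g : JPartition → JPartition → JPartition → F) (f : SymA)
    (mu nu : JPartition) (k : ℕ) : F :=
  ∑ᶠ pi : JPartition, if psize pi + k = psize mu + psize nu
    then g pi mu nu * MvPolynomial.coeff (toExp pi) f else 0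

/-- Coefficient functions of elements of `ℚ(α)[q,r]`: the value at `(μ, ν)` is the
coefficient of `q_μ r_ν`. -/
abbrev QRc : Type := JPartition → JPartition → F

/-- The action of `Bc n ℓq` on the alphabet `q` plus its action on the alphabet `r`,
on coefficient functions. -/
def CqrStep (ℓq n : ℕ) (h : QRc) : QRc := fun mu nu =>
  (∑ᶠ mu' : JPartition, Bmat n ℓq (toExp mu) (toExp mu') * h mu' nu)
  + ∑ᶠ nu' : JPartition, Bmat n ℓq (toExp nu) (toExp nu') * h mu nu'

/-- Application of `C_ℓ^{(α)}(-t, q) + C_ℓ^{(α)}(-t, r)` to a `t`-indexed family of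
coefficient functions, where `C_ℓ^{(α)}(t, ·) = [u^ℓ] B_∞^{(α)}(t, ·, u)`, whose
`t^n`-coefficient is `(1/n) Bc n ℓ`. -/
def applyCqr (ℓq : ℕ) (h : ℕ → QRc) : ℕ → QRc := fun k mu nu =>
  ∑ n ∈ Finset.Icc 1 k, ((-1 : F) ^ n / (n : F)) * CqrStep ℓq n (h (k - n)) mu nu

/-- Iterated application of `∏ᵢ (C_{λᵢ}^{(α)}(-t,q) + C_{λᵢ}^{(α)}(-t,r))` along a list
of parts. -/
def applyCqrList : List ℕ+ → (ℕ → QRc) → ℕ → QRc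
  | [], h => h
  | x :: L, h => applyCqr (x : ℕ) (applyCqrList L h)

/-- Application of `C_ℓ^{(α)}(-t, p)` to a `t`-indexed family of elements of `ℚ(α)[p]`. -/
def applyCp (ℓq : ℕ) (h : ℕ → SymA) : ℕ → SymA := fun k =>
  ∑ n ∈ Finset.Icc 1 k, ((-1 : F) ^ n / (n : F)) • Bc n ℓq (h (k - n))

/-- Iterated application of `∏ᵢ C_{λᵢ}^{(α)}(-t, p)` along a list of parts. -/
def applyCpList : List ℕ+ → (ℕ → SymA) → ℕ → SymA
  | [], h => h
  | x :: L, h => applyCp (x : ℕ) (applyCpList L h)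

noncomputable section
namespace JK
open Polynomial

abbrev S (K : Type) [Field K] : Type := MvPolynomial ℕ+ K
abbrev Y (K : Type) [Field K] : Type := Polynomial (S K)

variable {K : Type} [Field K] [CharZero K] (al : K)

def pn (n : ℕ) : (S K) := if h : 0 < n then MvPolynomial.X ⟨n, h⟩ else 0

lemma pn_zero : (pn 0 : S K) = 0 := by simp [pn]

lemma pn_coe (n : ℕ+) : (pn n : S K) = MvPolynomial.X n := by
  simp only [pn, n.pos, dif_pos]; rfl


theorem S_ind {V : Type*} [AddCommGroup V] [Module K V] (L L' : (S K) →ₗ[K] V)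
    (h1 : L 1 = L' 1)
    (hs : ∀ (n : ℕ+) (f : (S K)), L f = L' f → L (pn n * f) = L' (pn n * f)) (f : (S K)) :
    L f = L' f := by
  induction f using MvPolynomial.induction_on with
  | C a =>
    have : (MvPolynomial.C a : (S K)) = a • 1 := by
      rw [MvPolynomial.smul_eq_C_mul, mul_one]
    rw [this, map_smul, map_smul, h1]
  | add p q hp hq => rw [map_add, map_add, hp, hq]
  | mul_X p n h => rw [mul_comm, ← pn_coe]; exact hs n p h

theorem Y_ind {V : Type*} [AddCommGroup V] [Module K V] (L L' : (Y K) →ₗ[K] V)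
    (hC : ∀ a, L (C a) = L' (C a))
    (hX : ∀ f : (Y K), L f = L' f → L (X * f) = L' (X * f)) (f : (Y K)) :
    L f = L' f := by
  induction f using Polynomial.induction_on with
  | C a => exact hC a
  | add p q hp hq => rw [map_add, map_add, hp, hq]
  | monomial n a h =>
    have : (C a * X ^ (n + 1) : (Y K)) = X * (C a * X ^ n) := by ring
    rw [this]; exact hX _ h

theorem Y_mon {V : Type*} [AddCommGroup V] [Module K V] (L L' : (Y K) →ₗ[K] V)
    (h : ∀ (m : ℕ) a, L (X ^ m * C a) = L' (X ^ m * C a)) (f : (Y K)) :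
    L f = L' f := by
  induction f using Polynomial.induction_on' with
  | add p q hp hq => rw [map_add, map_add, hp, hq]
  | monomial n a =>
    rw [← C_mul_X_pow_eq_monomial, mul_comm]; exact h n a

/-- constants -/
def CL : (S K) →ₗ[K] (Y K) := (Algebra.linearMap (S K) (Y K)).restrictScalars K
lemma CL_apply (a : (S K)) : CL a = C a := rfl

def mk {V : Type*} [AddCommGroup V] [Module K V] (f : ℕ → (S K) →ₗ[K] V) : (Y K) →ₗ[K] V :=
  Polynomial.lsum f

lemma mk_XC {V : Type*} [AddCommGroup V] [Module K V] (f : ℕ → (S K) →ₗ[K] V) (m : ℕ) (a : (S K)) :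
    mk f (X ^ m * C a) = f m a := by
  rw [mk, mul_comm, C_mul_X_pow_eq_monomial, Polynomial.lsum_apply, Polynomial.sum_monomial_index]
  simp

lemma mk_C {V : Type*} [AddCommGroup V] [Module K V] (f : ℕ → (S K) →ₗ[K] V) (a : (S K)) :
    mk f (C a) = f 0 a := by
  have := mk_XC f 0 a
  rwa [pow_zero, one_mul] at this

/-- y-linear extension -/
def ext (L : (S K) →ₗ[K] (Y K)) : (Y K) →ₗ[K] (Y K) := mk fun m => LinearMap.mulLeft K (X ^ m : (Y K)) ∘ₗ L

lemma ext_C (L : (S K) →ₗ[K] (Y K)) (a : (S K)) : ext L (C a) = L a := by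
  simp [ext, mk_C]

lemma ext_XC (L : (S K) →ₗ[K] (Y K)) (m : ℕ) (a : (S K)) : ext L (X ^ m * C a) = X ^ m * L a := by
  rw [ext, mk_XC]; rfl

lemma ext_X (L : (S K) →ₗ[K] (Y K)) (f : (Y K)) : ext L (X * f) = X * ext L f := by
  refine Y_mon (ext L ∘ₗ LinearMap.mulLeft K X) (LinearMap.mulLeft K X ∘ₗ ext L) ?_ f
  intro m a
  simp only [LinearMap.comp_apply, LinearMap.mulLeft_apply, ext_XC]
  rw [← mul_assoc, ← pow_succ', ext_XC]; ring

lemma ext_Xp (L : (S K) →ₗ[K] (Y K)) (n : ℕ) (f : (Y K)) : ext L (X ^ n * f) = X ^ n * ext L f := by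
  induction n with
  | zero => simp
  | succ n ih => rw [pow_succ', mul_assoc, ext_X, ih]; ring

def hat (L : (S K) →ₗ[K] (S K)) : (Y K) →ₗ[K] (Y K) := ext (CL ∘ₗ L)
lemma hat_C (L : (S K) →ₗ[K] (S K)) (a : (S K)) : hat L (C a) = C (L a) := by
  simp [hat, ext_C, CL_apply]
lemma hat_X (L : (S K) →ₗ[K] (S K)) (f : (Y K)) : hat L (X * f) = X * hat L f := ext_X _ _
lemma hat_Xp (L : (S K) →ₗ[K] (S K)) (n : ℕ) (f : (Y K)) : hat L (X ^ n * f) = X ^ n * hat L f :=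
  ext_Xp _ _ _

/-- θ = y d/dy -/
def th : (Y K) →ₗ[K] (Y K) := LinearMap.mulLeft K X ∘ₗ (Polynomial.derivative.restrictScalars K)
lemma th_apply (f : (Y K)) : th f = X * derivative f := rfl
lemma th_C (a : (S K)) : th (C a) = 0 := by simp [th_apply]
lemma th_X (f : (Y K)) : th (X * f) = X * th f + X * f := by simp [th_apply]; ring
lemma th_mul (f g : (Y K)) : th (f * g) = f * th g + th f * g := by simp [th_apply]; ring
lemma th_Cm (a : (S K)) (f : (Y K)) : th (C a * f) = C a * th f := by simp [th_apply]; ring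
lemma th_Xpow (n : ℕ) : th (X ^ n : Y K) = (n : K) • X ^ n := by
  induction n with
  | zero => simp [th_apply]
  | succ n ih => rw [pow_succ', th_X, ih]; push_cast; algebra
lemma th_Xp (n : ℕ) (f : (Y K)) : th (X ^ n * f) = X ^ n * th f + (n : K) • (X ^ n * f) := by
  rw [th_mul, th_Xpow]; algebra

/-- Δ₀ -/
def Dl0d : Derivation K (S K) (Y K) := MvPolynomial.mkDerivation K fun i : ℕ+ => ((i : ℕ) : K) • (X ^ (i : ℕ) : (Y K))
def Dl0 : (S K) →ₗ[K] (Y K) := Dl0d.toLinearMap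
lemma Dl0_mul (a b : (S K)) : Dl0 (a * b) = C a * Dl0 b + C b * Dl0 a := by
  have := Dl0d.leibniz a b
  rwa [smul_eq_C_mul, smul_eq_C_mul] at this
lemma Dl0_one : Dl0 (1 : S K) = 0 := Dl0d.map_one_eq_zero
lemma Dl0_pn (n : ℕ) : Dl0 (pn n : S K) = (n : K) • (X ^ n : (Y K)) := by
  rcases Nat.eq_zero_or_pos n with h | h
  · subst h; simp [pn_zero]
  · have := MvPolynomial.mkDerivation_X K (fun i : ℕ+ => ((i : ℕ) : K) • (X ^ (i : ℕ) : (Y K))) ⟨n, h⟩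
    simp only [pn, h, dif_pos]; exact this
def Dl : (Y K) →ₗ[K] (Y K) := ext Dl0
lemma Dl_C (a : (S K)) : Dl (C a) = Dl0 a := ext_C _ _
lemma Dl_X (f : (Y K)) : Dl (X * f) = X * Dl f := ext_X _ _
lemma Dl_Xp (n : ℕ) (f : (Y K)) : Dl (X ^ n * f) = X ^ n * Dl f := ext_Xp _ _ _
lemma Dl_Cm (a : (S K)) (f : (Y K)) : Dl (C a * f) = C a * Dl f + Dl0 a * f := by
  refine Y_mon (Dl ∘ₗ LinearMap.mulLeft K (C a)) (LinearMap.mulLeft K (C a) ∘ₗ Dl + LinearMap.mulLeft K (Dl0 a)) ?_ f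
  intro m c
  simp only [LinearMap.comp_apply, LinearMap.mulLeft_apply, LinearMap.add_apply]
  rw [show (C a * (X ^ m * C c) : (Y K)) = X ^ m * C (a * c) by rw [C_mul]; ring, Dl_Xp, Dl_C, Dl0_mul,
    Dl_Xp, Dl_C]
  ring

/-- Θ -/
def Th0 : (Y K) →ₗ[K] (S K) := mk fun m => LinearMap.mulLeft K (pn m)
lemma Th0_XC (m : ℕ) (a : (S K)) : Th0 (X ^ m * C a) = pn m * a := by rw [Th0, mk_XC]; rfl
lemma Th0_C (a : (S K)) : Th0 (C a) = 0 := by simp [Th0, mk_C, pn_zero]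
lemma Th0_X (m : ℕ) : Th0 (X ^ m : Y K) = pn m := by have := Th0_XC (K := K) m 1; simpa using this
lemma Th0_Cm (a : (S K)) (f : (Y K)) : Th0 (C a * f) = a * Th0 f := by
  refine Y_mon (Th0 ∘ₗ LinearMap.mulLeft K (C a)) (LinearMap.mulLeft K a ∘ₗ Th0) ?_ f
  intro m c
  simp only [LinearMap.comp_apply, LinearMap.mulLeft_apply]
  rw [show (C a * (X ^ m * C c) : (Y K)) = X ^ m * C (a * c) by rw [C_mul]; ring, Th0_XC, Th0_XC]; ring

/-- T -/
def Tc (m : ℕ) : (Y K) := ∑ ij ∈ Finset.HasAntidiagonal.antidiagonal m, C (pn ij.1) * X ^ ij.2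
lemma Tc_zero : (Tc 0 : Y K) = 0 := by simp [Tc, pn_zero]
lemma Tc_succ (m : ℕ) : (Tc (m + 1) : Y K) = X * Tc m + C (pn (m + 1)) := by
  rw [Tc, Finset.Nat.antidiagonal_succ', Finset.sum_cons, Finset.sum_map, Tc, Finset.mul_sum]
  simp only [pow_zero, mul_one, Function.Embedding.prodMap, Function.Embedding.coeFn_mk, Prod.map,
    Function.Embedding.refl_apply, Nat.succ_eq_add_one]
  rw [add_comm]; refine congrArg₂ _ (Finset.sum_congr rfl ?_) rfl
  intros; ring
def TT : (Y K) →ₗ[K] (Y K) := mk fun m => LinearMap.mulLeft K (Tc m) ∘ₗ CL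
lemma TT_XC (m : ℕ) (a : (S K)) : TT (X ^ m * C a) = Tc m * C a := by rw [TT, mk_XC]; rfl
lemma TT_C (a : (S K)) : TT (C a) = 0 := by simp [TT, mk_C, Tc_zero]
lemma TT_X (f : (Y K)) : TT (X * f) = X * TT f + C (Th0 (X * f)) := by
  refine Y_mon (TT ∘ₗ LinearMap.mulLeft K X) (LinearMap.mulLeft K X ∘ₗ TT +
    CL ∘ₗ Th0 ∘ₗ LinearMap.mulLeft K X) ?_ f
  intro m c
  simp only [LinearMap.comp_apply, LinearMap.mulLeft_apply, LinearMap.add_apply, CL_apply]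
  rw [← mul_assoc, ← pow_succ', TT_XC, TT_XC, Tc_succ, Th0_XC, C_mul]; ring
lemma TT_Cm (a : (S K)) (f : (Y K)) : TT (C a * f) = C a * TT f := by
  refine Y_mon (TT ∘ₗ LinearMap.mulLeft K (C a)) (LinearMap.mulLeft K (C a) ∘ₗ TT) ?_ f
  intro m c
  simp only [LinearMap.comp_apply, LinearMap.mulLeft_apply]
  rw [show (C a * (X ^ m * C c) : (Y K)) = X ^ m * C (a * c) by rw [C_mul]; ring, TT_XC, TT_XC, C_mul]; ring

/-- E n -/
def Ed (n : ℕ) : Derivation K (S K) (S K) :=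
  MvPolynomial.mkDerivation K fun i : ℕ+ => ((i : ℕ) : K) • pn (i + n)
def EE (n : ℕ) : (S K) →ₗ[K] (S K) := (Ed n).toLinearMap
lemma EE_mul (n : ℕ) (a b : (S K)) : EE n (a * b) = a * EE n b + b * EE n a := by
  exact (Ed n).leibniz a b
lemma EE_one (n : ℕ) : EE n (1 : S K) = 0 := (Ed n).map_one_eq_zero
lemma EE_pn (n m : ℕ) : EE n (pn m : S K) = (m : K) • pn (m + n) := by
  rcases Nat.eq_zero_or_pos m with h | h
  · subst h; simp [pn_zero]
  · have := MvPolynomial.mkDerivation_X K (fun i : ℕ+ => ((i : ℕ) : K) • (pn (i + n) : S K)) ⟨m, h⟩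
    conv_lhs => rw [pn, dif_pos h]
    exact this

lemma Th0_Dl0 (n : ℕ) (f : (S K)) : Th0 (X ^ n * Dl0 f) = EE n f := by
  refine S_ind (Th0 ∘ₗ LinearMap.mulLeft K (X ^ n) ∘ₗ Dl0) (EE n) ?_ ?_ f
  · simp [Dl0_one, EE_one]
  · intro k f h
    simp only [LinearMap.comp_apply, LinearMap.mulLeft_apply] at h ⊢
    rw [Dl0_mul, Dl0_pn, EE_mul, EE_pn, ← h,
      show (X ^ n * (C (pn k) * Dl0 f + C f * ((k : ℕ) : K) • X ^ (k:ℕ)) : (Y K)) =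
        C (pn k) * (X ^ n * Dl0 f) + ((k : ℕ) : K) • (C f * X ^ (k + n)) by algebra,
      map_add, map_smul, Th0_Cm, Th0_Cm, Th0_X]
    algebra

/-- Λ -/
def Lam (f : (Y K)) : (Y K) := (al - 1) • th f + al • Dl f + TT f
def D : (S K) →ₗ[K] (S K) :=
  (2⁻¹ : K) • (Th0 ∘ₗ ((al - 1) • th + al • Dl + TT - (al - 1) • LinearMap.id) ∘ₗ Dl0)
lemma D_apply (f : (S K)) : D al f = (2⁻¹ : K) • Th0 ((al - 1) • th (Dl0 f) + al • Dl (Dl0 f) + TT (Dl0 f)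
    - (al - 1) • Dl0 f) := by
  simp [D]
def sn (n : ℕ) : (S K) := ∑ ij ∈ Finset.HasAntidiagonal.antidiagonal n, pn ij.1 * pn ij.2
lemma Th0_Tc (n : ℕ) (f : (S K)) : Th0 (Tc n * C f) = sn n * f := by
  rw [mul_comm, Th0_Cm, Tc, map_sum, sn, mul_comm]
  congr 1
  apply Finset.sum_congr rfl; intros; rw [Th0_Cm, Th0_X]
lemma D_one : D al 1 = 0 := by simp [D_apply, Dl0_one]
lemma D_pn (n : ℕ) (f : (S K)) : D al (pn n * f) = pn n * D al f + (al * n) • EE n f +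
    (n / 2 : K) • (sn n * f) + ((al - 1) * n * (n - 1) / 2) • (pn n * f) := by
  have h1 : Dl0 (pn n * f) = C (pn n) * Dl0 f + (n : K) • (X ^ n * C f) := by
    rw [Dl0_mul, Dl0_pn]; algebra
  simp only [D_apply, h1, map_add, map_sub, map_smul, th_Cm, Dl_Cm, TT_Cm, Th0_Cm, Dl0_pn, th_Xp,
    Dl_Xp, th_C, Dl_C, TT_XC, Th0_XC, Th0_Tc, mul_zero, zero_add, smul_mul_assoc, Th0_Dl0]
  simp only [smul_sub, smul_add, smul_smul, mul_sub, mul_add, mul_smul_comm]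
  module
end JK
end

noncomputable section
namespace JK
open Polynomial
variable {K : Type} [Field K] [CharZero K] (al : K)

lemma Y_eq {V : Type*} [AddCommGroup V] [Module K V] {L L' : Y K →ₗ[K] V} (h : L = L') (f : Y K) :
  L f = L' f := by rw [h]

lemma hat_Cm_pn (n : ℕ) (f : Y K) : hat (D al) (C (pn n) * f) = C (pn n) * hat (D al) f +
    (al * n) • hat (EE n) f + (n / 2 : K) • (C (sn n) * f) +
    ((al - 1) * n * (n - 1) / 2) • (C (pn n) * f) := by
  refine Y_mon (hat (D al) ∘ₗ LinearMap.mulLeft K (C (pn n))) (LinearMap.mulLeft K (C (pn n)) ∘ₗ hat (D al) +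
    (al * n) • hat (EE n) + (n / 2 : K) • LinearMap.mulLeft K (C (sn n)) +
    ((al - 1) * n * (n - 1) / 2) • LinearMap.mulLeft K (C (pn n))) ?_ f
  intro m c
  simp only [LinearMap.comp_apply, LinearMap.mulLeft_apply, LinearMap.add_apply, LinearMap.smul_apply]
  rw [show (C (pn n) * (X ^ m * C c) : Y K) = X ^ m * C (pn n * c) by rw [C_mul]; ring, hat_Xp,
    hat_C, D_pn, hat_Xp, hat_Xp, hat_C, hat_C]
  simp only [← CL_apply, map_add, map_smul]
  simp only [CL_apply, C_mul, mul_add, mul_smul_comm]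
  have h1 : (C (pn n) * (X ^ m * C (D al c)) : Y K) = X ^ m * (C (pn n) * C (D al c)) := by ring
  have h2 : (C (sn n) * (X ^ m * C c) : Y K) = X ^ m * (C (sn n) * C c) := by ring
  rw [h1, h2]

lemma Csm (c : K) (a : S K) : (C (c • a) : Y K) = c • C a := (smul_C c a).symm
lemma th_XC (n : ℕ) (a : S K) : th (X ^ n * C a) = (n : K) • (X ^ n * C a) := by
  rw [th_Xp, th_C]; simp
lemma Dl0_EE (n : ℕ) (f : S K) : Dl0 (EE n f) = hat (EE n) (Dl0 f) + X ^ n * th (Dl0 f) +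
    (n : K) • (X ^ n * Dl0 f) := by
  refine S_ind (Dl0 ∘ₗ EE n) (hat (EE n) ∘ₗ Dl0 + LinearMap.mulLeft K (X ^ n) ∘ₗ th ∘ₗ Dl0 +
    (n : K) • LinearMap.mulLeft K (X ^ n) ∘ₗ Dl0) ?_ ?_ f
  · simp [Dl0_one, EE_one]
  · intro k f h
    simp only [LinearMap.comp_apply, LinearMap.mulLeft_apply, LinearMap.add_apply,
      LinearMap.smul_apply] at h ⊢
    have h2 : ∀ g : Y K, hat (EE n) (C (pn k) * g) = C (pn k) * hat (EE n) g + C (EE n (pn k)) * g := by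
      intro g
      refine Y_mon (hat (EE n) ∘ₗ LinearMap.mulLeft K (C (pn k))) (LinearMap.mulLeft K (C (pn k)) ∘ₗ hat (EE n) +
        LinearMap.mulLeft K (C (EE n (pn k)))) ?_ g
      intro m c
      simp only [LinearMap.comp_apply, LinearMap.mulLeft_apply, LinearMap.add_apply]
      rw [show (C (pn k) * (X ^ m * C c) : Y K) = X ^ m * C (pn k * c) by rw [C_mul]; ring, hat_Xp,
        hat_C, EE_mul, hat_Xp, hat_C, C_add, C_mul, C_mul]
      ring
    have h1 : Dl0 (pn k * f) = C (pn k) * Dl0 f + ((k : ℕ) : K) • (X ^ (k : ℕ) * C f) := by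
      rw [Dl0_mul, Dl0_pn]; algebra
    rw [EE_mul, map_add, Dl0_mul, Dl0_mul, h, h1, EE_pn]
    simp only [map_add, map_smul, h2, Dl0_pn, th_Cm, th_Xp, th_C, hat_Xp, hat_C, EE_pn, mul_zero,
      Csm]
    push_cast
    simp only [Algebra.smul_def, map_add, map_mul, map_natCast]
    ring

def DY : Y K →ₗ[K] Y K := hat (D al) + al • (Dl ∘ₗ th) + ((al - 1) / 2) • (th ∘ₗ th - th) + th ∘ₗ TT
lemma DY_apply (f : Y K) : DY al f = hat (D al) f + al • Dl (th f) +
    ((al - 1) / 2) • (th (th f) - th f) + th (TT f) := rfl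
lemma DY_C (a : S K) : DY al (C a) = C (D al a) := by
  simp [DY_apply, th_C, hat_C, TT_C]

lemma th_mC (g : Y K) (a : S K) : th (g * C a) = th g * C a := by
  rw [mul_comm, th_Cm, mul_comm]
lemma Th0_mC (g : Y K) (a : S K) : Th0 (g * C a) = Th0 g * a := by
  rw [mul_comm, Th0_Cm, mul_comm]
lemma th_Tc (n : ℕ) : (n : K) • th (Tc n : Y K) = (n / 2 : K) • Dl0 (sn n) := by
  have h : Dl0 (sn n) = (2 : K) • th (Tc n : Y K) := by
    rw [two_smul]
    have h1 : th (Tc n : Y K) = ∑ ij ∈ Finset.HasAntidiagonal.antidiagonal n,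
      C (pn ij.1) * ((ij.2 : K) • X ^ ij.2) := by
      rw [Tc, map_sum]
      refine Finset.sum_congr rfl fun ij _ => ?_
      rw [th_Cm, th_Xpow]
    conv_rhs => enter [2]; rw [h1, ← Finset.Nat.sum_antidiagonal_swap]
    rw [h1, ← Finset.sum_add_distrib, sn, map_sum]
    refine Finset.sum_congr rfl fun ij _ => ?_
    rw [Dl0_mul, Dl0_pn, Dl0_pn]; rfl
  rw [h, smul_smul]; congr 1; field_simp

lemma DY_pn (n : ℕ) (f : Y K) : DY al (C (pn n) * f) = C (pn n) * DY al f +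
    (al * n) • (hat (EE n) f + X ^ n * th f) + (n / 2 : K) • (C (sn n) * f) +
    ((al - 1) * n * (n - 1) / 2) • (C (pn n) * f) := by
  simp only [DY_apply, hat_Cm_pn, th_Cm, Dl_Cm, Dl0_pn, TT_Cm]
  simp only [smul_sub, smul_add, smul_smul, mul_sub, mul_add, mul_smul_comm, smul_mul_assoc]
  module

lemma DY_Dl0 (f : S K) : DY al (Dl0 f) = Dl0 (D al f) := by
  refine S_ind (DY al ∘ₗ Dl0) (Dl0 ∘ₗ D al) ?_ ?_ f
  · simp [Dl0_one, D_one]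
  · intro n f h
    simp only [LinearMap.comp_apply] at h ⊢
    have h1 : Dl0 (pn n * f) = C (pn n) * Dl0 f + ((n : ℕ) : K) • (X ^ (n : ℕ) * C f) := by
      rw [Dl0_mul, Dl0_pn]; algebra
    have h3 : DY al (X ^ (n : ℕ) * C f) = X ^ (n : ℕ) * C (D al f) + (al * ((n : ℕ) : K)) • (X ^ (n : ℕ) * Dl0 f)
      + ((al - 1) * (n : ℕ) * ((n : ℕ) - 1) / 2) • (X ^ (n : ℕ) * C f) + th (Tc n) * C f := by
      rw [DY_apply, hat_Xp, hat_C]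
      rw [TT_XC]
      simp only [th_XC, map_smul, Dl_Xp, Dl_C]
      rw [th_mC]
      simp only [smul_sub, smul_add, smul_smul]
      module
    rw [D_pn, h1, map_add, map_smul, DY_pn, h3, h]
    simp only [map_add, map_smul]
    rw [h1, Dl0_EE, Dl0_mul (sn n), Dl0_mul]
    have h4 := th_Tc (K := K) n
    have h5 : ((n : ℕ) : K) • (th (Tc n) * C f) = ((n : ℕ) / 2 : K) • (C f * Dl0 (sn n)) := by
      rw [← smul_mul_assoc, h4, smul_mul_assoc, mul_comm]
    simp only [smul_sub, smul_add, smul_smul]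
    rw [h5, Dl0_pn, mul_smul_comm, mul_comm (C (D al f))]
    module

lemma DY_X (f : Y K) : DY al (X * f) = X * DY al f + X * ((al - 1) • th f + al • Dl f + TT f) := by
  simp only [DY_apply, hat_X, th_X, map_add, Dl_X, TT_X, th_C, add_zero]
  simp only [smul_sub, smul_add, smul_smul, mul_sub, mul_add, mul_smul_comm, smul_mul_assoc]
  module

lemma sn_Tc (n : ℕ) : Th0 (th (Tc n : Y K)) = (n / 2 : K) • sn n := by
  have h1 : Th0 (th (Tc n : Y K)) = ∑ ij ∈ Finset.HasAntidiagonal.antidiagonal n,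
      (ij.2 : K) • (pn ij.1 * pn ij.2) := by
    rw [Tc, map_sum, map_sum]
    refine Finset.sum_congr rfl fun ij _ => ?_
    rw [th_Cm, th_Xpow, Th0_Cm, map_smul, Th0_X, mul_smul_comm]
  have h2 : (2 : K) • Th0 (th (Tc n : Y K)) = (n : K) • sn n := by
    rw [two_smul]
    conv_lhs => enter [2]; rw [h1, ← Finset.Nat.sum_antidiagonal_swap]
    rw [h1, ← Finset.sum_add_distrib, sn, Finset.smul_sum]
    refine Finset.sum_congr rfl fun ij h => ?_
    rw [Finset.HasAntidiagonal.mem_antidiagonal] at h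
    rw [← h]; push_cast; simp only [Prod.fst_swap, Prod.snd_swap]
    rw [mul_comm (pn ij.2), ← add_smul, add_comm]
  rw [div_eq_inv_mul, mul_smul, ← h2, smul_smul, inv_mul_cancel₀ two_ne_zero, one_smul]

lemma Th0_DY (f : Y K) : Th0 (DY al f) = D al (Th0 f) := by
  refine Y_mon (Th0 ∘ₗ DY al) (D al ∘ₗ Th0) ?_ f
  intro n f
  simp only [LinearMap.comp_apply]
  rw [Th0_XC, D_pn, DY_apply, hat_Xp, hat_C]
  rw [TT_XC]
  simp only [th_XC, map_smul, Dl_Xp, Dl_C]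
  rw [th_mC]
  simp only [map_add, map_smul, map_sub, Th0_mC, Th0_Dl0, Th0_X, sn_Tc]
  simp only [smul_sub, smul_add, smul_smul, mul_sub, mul_add, mul_smul_comm, smul_mul_assoc]
  module

def EY : Y K →ₗ[K] Y K := hat (EE 1) + LinearMap.mulLeft K X ∘ₗ th
lemma EY_apply (f : Y K) : EY f = hat (EE 1) f + X * th f := rfl
lemma EY_C (a : S K) : EY (C a) = C (EE 1 a) := by simp [EY_apply, hat_C, th_C]
lemma Th0_EY (f : Y K) : Th0 (EY f) = EE 1 (Th0 f) := by
  refine Y_mon (Th0 ∘ₗ EY) (EE 1 ∘ₗ Th0) ?_ f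
  intro n f
  simp only [LinearMap.comp_apply]
  rw [Th0_XC, EE_mul, EY_apply, hat_Xp, hat_C, th_Xp, th_C, mul_zero, zero_add, EE_pn, map_add,
    Th0_XC, mul_smul_comm, ← mul_assoc, ← pow_succ', map_smul, Th0_XC]
  algebra

def LamL : Y K →ₗ[K] Y K := (al - 1) • th + al • Dl + TT
lemma LamL_apply (f : Y K) : LamL al f = (al - 1) • th f + al • Dl f + TT f := rfl
lemma LamL_X (f : Y K) : LamL al (X * f) = X * LamL al f + (al - 1) • (X * f) + C (Th0 (X * f)) := by
  simp only [LamL_apply, th_X, Dl_X, TT_X]; algebra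
lemma LamL_C (a : S K) : LamL al (C a) = al • Dl0 a := by simp [LamL_apply, th_C, Dl_C, TT_C]
lemma DY_X' (f : Y K) : DY al (X * f) = X * DY al f + X * LamL al f := DY_X al f

lemma DY_Lam (f : Y K) : DY al (LamL al f) = LamL al (DY al f) := by
  refine Y_ind (DY al ∘ₗ LamL al) (LamL al ∘ₗ DY al) ?_ ?_ f
  · intro a; simp only [LinearMap.comp_apply]
    rw [LamL_C, DY_C, LamL_C, map_smul, DY_Dl0]
  · intro f h
    simp only [LinearMap.comp_apply] at h ⊢
    have h2 := Th0_DY al (X * f)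
    rw [DY_X', map_add] at h2
    have h3 := congrArg C h2
    simp only [LamL_X, map_add, map_smul, DY_X', DY_C] at h3 ⊢
    rw [h, ← h3, smul_add]; abel

/-- P = p₁/α -/
def PP : Y K →ₗ[K] Y K := al⁻¹ • LinearMap.mulLeft K (C (pn 1))
lemma PP_apply (f : Y K) : PP al f = al⁻¹ • (C (pn 1) * f) := rfl
variable {al}
lemma sn_one : (sn 1 : S K) = 0 := by
  simp [sn, Finset.Nat.antidiagonal_succ, pn_zero]
lemma DY_PP (hal : al ≠ 0) (f : Y K) : DY al (PP al f) = PP al (DY al f) + EY f := by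
  rw [PP_apply, map_smul, DY_pn, PP_apply, EY_apply, sn_one]
  simp only [Nat.cast_one, mul_one, sub_self, mul_zero, zero_div, zero_smul, map_zero, zero_mul,
    smul_zero, add_zero, smul_add, smul_smul, inv_mul_cancel₀ hal, one_smul, pow_one]
lemma LamL_PP (hal : al ≠ 0) (f : Y K) : LamL al (PP al f) = PP al (LamL al f) + X * f := by
  rw [PP_apply, map_smul, LamL_apply, th_Cm, Dl_Cm, TT_Cm, PP_apply, LamL_apply, Dl0_pn]
  simp only [Nat.cast_one, one_smul, pow_one, smul_add, smul_smul, inv_mul_cancel₀ hal, mul_add,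
    mul_smul_comm]
  try module
lemma PP_X (f : Y K) : PP al (X * f) = X * PP al f := by
  rw [PP_apply, PP_apply, mul_smul_comm]; congr 1; ring
lemma EY_X (f : Y K) : EY (X * f) = X * EY f + X * (X * f) := by
  rw [EY_apply, EY_apply, hat_X, th_X]; ring
lemma EY_Lam (hal : al ≠ 0) (f : Y K) : EY (LamL al f) = LamL al (EY f) - X * LamL al f := by
  have h1 := DY_PP hal (LamL al f)
  have h2 := congrArg (LamL al) (DY_PP hal f)
  have h3 := congrArg (DY al) (LamL_PP hal f)
  have h4 := LamL_PP hal (DY al f)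
  have h5 := DY_X' al f
  simp only [map_add, ← DY_Lam] at h1 h2 h3 h4
  rw [h3, h4, h5] at h2
  rw [eq_sub_iff_add_eq]
  have h6 : EY (LamL al f) = DY al (PP al (LamL al f)) - PP al (DY al (LamL al f)) := by rw [h1]; abel
  have h7 : LamL al (EY f) = DY al (PP al (LamL al f)) + (X * DY al f + X * LamL al f) -
    (PP al (DY al (LamL al f)) + X * DY al f) := by rw [h2]; abel
  rw [h6, h7]; abel

variable (al)
/-- Z = y(Λ+u) -/
def ZZ (u : K) : Y K →ₗ[K] Y K := LinearMap.mulLeft K X ∘ₗ (LamL al + u • LinearMap.id)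
lemma ZZ_apply (u : K) (f : Y K) : ZZ al u f = X * (LamL al f + u • f) := rfl
def QQ (u : K) : Y K →ₗ[K] Y K := u • PP al + EY
lemma QQ_apply (u : K) (f : Y K) : QQ al u f = u • PP al f + EY f := rfl
/-- Ê -/
def EH (u : K) : Y K →ₗ[K] Y K := DY al ∘ₗ QQ al u - QQ al u ∘ₗ DY al
lemma EH_apply (u : K) (f : Y K) : EH al u f = DY al (QQ al u f) - QQ al u (DY al f) := rfl
variable {al}
lemma QQ_X (u : K) (f : Y K) : QQ al u (X * f) = X * QQ al u f + X * (X * f) := by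
  rw [QQ_apply, QQ_apply, PP_X, EY_X]; algebra
lemma QQ_Lam (hal : al ≠ 0) (u : K) (f : Y K) :
    QQ al u (LamL al f) = LamL al (QQ al u f) - ZZ al u f := by
  have h := LamL_PP hal f
  rw [QQ_apply, QQ_apply, ZZ_apply, EY_Lam hal, map_add, map_smul, h]
  simp only [Algebra.smul_def]; ring
lemma QQ_ZZ (hal : al ≠ 0) (u : K) (f : Y K) : QQ al u (ZZ al u f) = ZZ al u (QQ al u f) := by
  rw [ZZ_apply, QQ_X, map_add, QQ_Lam hal, map_smul, ZZ_apply, ZZ_apply]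
  simp only [Algebra.smul_def]; ring
lemma DY_ZZ (u : K) (f : Y K) : DY al (ZZ al u f) = ZZ al u (DY al f) + X * LamL al (LamL al f + u • f) := by
  rw [ZZ_apply, DY_X', map_add, DY_Lam, map_smul, ZZ_apply]
lemma EH_ZZ (hal : al ≠ 0) (u : K) (f : Y K) :
    EH al u (ZZ al u f) = ZZ al u (EH al u f) + ZZ al u (ZZ al u f) := by
  rw [EH_apply, EH_apply, map_sub, QQ_ZZ hal, DY_ZZ, DY_ZZ, map_add (QQ al u), QQ_ZZ hal]
  have h1 : LamL al f + u • f = LamL al f + u • f := rfl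
  set G := LamL al f + u • f with hG
  have hZ : ZZ al u f = X * G := rfl
  have h2 : LamL al (QQ al u f) + u • QQ al u f = QQ al u G + ZZ al u f := by
    rw [hG, map_add, map_smul, QQ_Lam hal]; abel
  rw [h2, QQ_X, QQ_Lam hal, map_add, hZ, ZZ_apply, ZZ_apply, ZZ_apply al u G, ZZ_apply al u (X * G)]
  simp only [Algebra.smul_def]; ring
end JK
end

noncomputable section
namespace JK
open Polynomial
variable {K : Type} [Field K] [CharZero K] (al : K)

def Bn (u : K) (n : ℕ) : S K →ₗ[K] S K := al⁻¹ • (Th0 ∘ₗ ((ZZ al u) ^ n : Module.End K (Y K)) ∘ₗ CL)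
lemma Bn_apply (u : K) (n : ℕ) (f : S K) : Bn al u n f = al⁻¹ • Th0 (((ZZ al u) ^ n : Module.End K (Y K)) (C f)) := rfl
def B1 (u : K) : S K →ₗ[K] S K := (u * al⁻¹) • LinearMap.mulLeft K (pn 1) + EE 1
lemma B1_apply (u : K) (f : S K) : B1 al u f = (u * al⁻¹) • (pn 1 * f) + EE 1 f := rfl
def EH0 (u : K) : S K →ₗ[K] S K := D al ∘ₗ B1 al u - B1 al u ∘ₗ D al
lemma EH0_apply (u : K) (f : S K) : EH0 al u f = D al (B1 al u f) - B1 al u (D al f) := rfl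
lemma Th0_QQ (u : K) (f : Y K) : Th0 (QQ al u f) = B1 al u (Th0 f) := by
  rw [QQ_apply, PP_apply, map_add, map_smul, map_smul, Th0_Cm, Th0_EY, B1_apply, smul_smul]
lemma QQ_C (u : K) (f : S K) : QQ al u (C f) = C (B1 al u f) := by
  rw [QQ_apply, PP_apply, EY_C, B1_apply, C_add, Csm, C_mul, smul_smul]
lemma Th0_EH (u : K) (f : Y K) : Th0 (EH al u f) = EH0 al u (Th0 f) := by
  rw [EH_apply, EH0_apply, map_sub, Th0_DY, Th0_QQ, Th0_QQ, Th0_DY]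
lemma EH_C (u : K) (f : S K) : EH al u (C f) = C (EH0 al u f) := by
  rw [EH_apply, EH0_apply, C_sub, QQ_C, DY_C, DY_C, QQ_C]
variable {al}
lemma EH_ZZpow (hal : al ≠ 0) (u : K) (n : ℕ) (f : Y K) :
    EH al u (((ZZ al u) ^ n : Module.End K (Y K)) f) = ((ZZ al u) ^ n : Module.End K (Y K)) (EH al u f)
      + (n : K) • ((ZZ al u) ^ (n + 1) : Module.End K (Y K)) f := by
  induction n with
  | zero => simp
  | succ n ih =>
    rw [pow_succ', Module.End.mul_apply, EH_ZZ hal, ih, map_add, map_smul, pow_succ' _ (n + 1),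
      Module.End.mul_apply, Module.End.mul_apply, pow_succ' _ n, Module.End.mul_apply]
    push_cast; module
lemma EH0_Bn (hal : al ≠ 0) (u : K) (n : ℕ) (f : S K) :
    EH0 al u (Bn al u n f) = Bn al u n (EH0 al u f) + (n : K) • Bn al u (n + 1) f := by
  rw [Bn_apply, Bn_apply, Bn_apply, map_smul, ← Th0_EH, EH_ZZpow hal, EH_C, map_add, map_smul]
  module
lemma Bn_one (hal : al ≠ 0) (u : K) (f : S K) : Bn al u 1 f = B1 al u f := by
  rw [Bn_apply, pow_one, ZZ_apply, LamL_C, B1_apply]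
  have h := Th0_Dl0 1 f
  have h2 := Th0_XC 1 f
  rw [pow_one] at h h2
  rw [mul_add, mul_smul_comm, mul_smul_comm, map_add, map_smul, map_smul, h, h2, smul_add, smul_smul,
    smul_smul, inv_mul_cancel₀ hal, one_smul, mul_comm al⁻¹, add_comm]

/-- words -/
def wY (al : K) : List Bool → Y K →ₗ[K] Y K
  | [] => LinearMap.id
  | b :: w => (if b then LinearMap.mulLeft K X else LinearMap.mulLeft K X ∘ₗ LamL al) ∘ₗ wY al w

/-- coefficient operators -/
def wB (al : K) (n l : ℕ) : S K →ₗ[K] S K := al⁻¹ • (Th0 ∘ₗ (∑ s ∈ Finset.univ.filter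
      (fun s : Fin n → Bool => (Finset.univ.filter fun i => s i = true).card = l), wY al (List.ofFn s)) ∘ₗ CL)

lemma ZZ_pow_words (u : K) (n : ℕ) : ((ZZ al u) ^ n : Module.End K (Y K)) =
    ∑ s : Fin n → Bool, u ^ (Finset.univ.filter fun i => s i = true).card • wY al (List.ofFn s) := by
  induction n with
  | zero => simp [wY]; rfl
  | succ n ih =>
    rw [pow_succ', ih, ← (Fin.consEquiv (fun _ => Bool)).sum_comp, Fintype.sum_prod_type]
    simp only [Fin.consEquiv_apply, Fintype.sum_bool, List.ofFn_cons, Fin.cons_zero, Fin.cons_succ]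
    rw [← Finset.sum_add_distrib, Finset.mul_sum]
    refine Finset.sum_congr rfl fun s _ => ?_
    have h1 : (Finset.univ.filter fun i => (Fin.cons true s : Fin (n+1) → Bool) i = true).card =
        (Finset.univ.filter fun i => s i = true).card + 1 := by
      simp only [Finset.card_filter, Fin.sum_univ_succ, Fin.cons_zero, Fin.cons_succ]; simp [add_comm]
    have h2 : (Finset.univ.filter fun i => (Fin.cons false s : Fin (n+1) → Bool) i = true).card =
        (Finset.univ.filter fun i => s i = true).card := by
      simp only [Finset.card_filter, Fin.sum_univ_succ, Fin.cons_zero, Fin.cons_succ]; simp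
    have h3 : ∀ b, List.ofFn ((Fin.consEquiv fun _ : Fin (n+1) => Bool) (b, s)) = b :: List.ofFn s :=
      fun b => List.ofFn_cons b s
    rw [h1, h2, h3, h3]
    apply LinearMap.ext; intro f
    simp only [Module.End.mul_apply, LinearMap.smul_apply, map_smul, LinearMap.add_apply, wY,
      LinearMap.comp_apply, ZZ_apply, if_true, LinearMap.mulLeft_apply, Bool.false_eq_true, if_false]
    rw [mul_add, mul_smul_comm, pow_succ]; module

lemma card_le (n : ℕ) (s : Fin n → Bool) : (Finset.univ.filter fun i => s i = true).card ≤ n := by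
  simpa using Finset.card_filter_le (Finset.univ : Finset (Fin n)) (fun i => s i = true)

lemma Bn_wB (u : K) (n : ℕ) (f : S K) : Bn al u n f = ∑ l ∈ Finset.range (n + 1), u ^ l • wB al n l f := by
  rw [Bn_apply, ZZ_pow_words]
  have : ∀ s ∈ (Finset.univ : Finset (Fin n → Bool)), (Finset.univ.filter fun i => s i = true).card ∈ Finset.range (n+1) := by
    intro s _; have := card_le n s; simp; omega
  rw [← Finset.sum_fiberwise_of_maps_to this]
  simp only [wB, LinearMap.smul_apply, LinearMap.comp_apply, LinearMap.sum_apply, map_sum, Finset.smul_sum, CL_apply, map_smul]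
  refine Finset.sum_congr rfl fun l _ => ?_
  refine Finset.sum_congr rfl fun s hs => ?_
  rw [(Finset.mem_filter.mp hs).2, smul_comm]

lemma wB_gt {n l : ℕ} (h : n < l) (f : S K) : wB al n l f = 0 := by
  rw [wB, Finset.filter_false_of_mem]
  · simp
  · intro s _ h2; have := card_le n s; omega

lemma wY_all (n : ℕ) (s : Fin n → Bool) (h : (Finset.univ.filter fun i => s i = true).card = n) (f : Y K):
    wY al (List.ofFn s) f = X ^ n * f := by
  have hs : s = fun _ => true := by
    have : (Finset.univ.filter fun i => s i = true) = Finset.univ := by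
      apply Finset.eq_univ_of_card; simpa using h
    funext i
    have := Finset.mem_univ i
    rw [← ‹(Finset.univ.filter fun i => s i = true) = Finset.univ›] at this
    simpa using this
  subst hs
  clear h
  rw [List.ofFn_const]
  induction n with
  | zero => simp [wY]
  | succ n ih => rw [List.replicate_succ, wY]; simp [ih]; ring
lemma wB_self (l : ℕ) (f : S K) : wB al l l f = al⁻¹ • (pn l * f) := by
  have : (Finset.univ.filter fun s : Fin l → Bool => (Finset.univ.filter fun i => s i = true).card = l) =
      {fun _ => true} := by
    ext s
    simp only [Finset.mem_filter, Finset.mem_univ, true_and, Finset.mem_singleton]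
    constructor
    · intro h
      have h2 : (Finset.univ.filter fun i => s i = true) = Finset.univ := by
        apply Finset.eq_univ_of_card; simpa using h
      funext i
      have := Finset.mem_univ i
      rw [← h2] at this
      simpa using this
    · rintro rfl; simp
  rw [wB, this, Finset.sum_singleton]
  simp only [LinearMap.smul_apply, LinearMap.comp_apply, CL_apply]
  rw [wY_all, Th0_XC]; simp
end JK
end

noncomputable section
namespace JK
open Polynomial

def iota : Y F →ₗ[F] PY := mk fun m => LinearMap.mulLeft F (yv m) ∘ₗ (MvPolynomial.rename Sum.inl : SymA →ₐ[F] PY).toLinearMap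

def rn : SymA →ₐ[F] PY := MvPolynomial.rename Sum.inl

lemma iota_XC (m : ℕ) (a : SymA) : iota (X ^ m * C a) = yv m * rn a := by rw [iota, mk_XC]; rfl
lemma iota_C (a : SymA) : iota (C a) = yv 0 * rn a := by have := iota_XC 0 a; rwa [pow_zero, one_mul] at this

lemma pd_r (j : ℕ) (a : SymA) : MvPolynomial.pderiv (Sum.inr j) (rn a) = 0 := by
  apply MvPolynomial.pderiv_eq_zero_of_notMem_vars
  intro h
  have := MvPolynomial.vars_rename Sum.inl a h
  simp at this
lemma pd_ry (j m : ℕ) (a : SymA) : MvPolynomial.pderiv (Sum.inr j) (yv m * rn a) =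
    if j = m then rn a else 0 := by
  rw [Derivation.leibniz, pd_r, smul_zero, zero_add, yv, MvPolynomial.pderiv_X]
  by_cases h : j = m
  · subst h; simp
  · simp [h, Pi.single_apply, Ne.symm h]
lemma pd_l (j : ℕ+) (a : SymA) : MvPolynomial.pderiv (Sum.inl j) (rn a) = rn (MvPolynomial.pderiv j a) := by
  exact MvPolynomial.pderiv_rename Sum.inl_injective j a

lemma fin_r (f : PY) : {j : ℕ | MvPolynomial.pderiv (Sum.inr j) f ≠ 0}.Finite := by
  refine Set.Finite.subset (Set.Finite.preimage (f := Sum.inr) Sum.inr_injective.injOn f.vars.finite_toSet) ?_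
  intro j hj
  by_contra h
  exact hj (MvPolynomial.pderiv_eq_zero_of_notMem_vars h)
lemma fin_l (f : PY) : {j : ℕ+ | MvPolynomial.pderiv (Sum.inl j) f ≠ 0}.Finite := by
  refine Set.Finite.subset (Set.Finite.preimage (f := Sum.inl) Sum.inl_injective.injOn f.vars.finite_toSet) ?_
  intro j hj
  by_contra h
  exact hj (MvPolynomial.pderiv_eq_zero_of_notMem_vars h)
lemma fin_rp (f : PY) (c : ℕ+ → ℕ) (hc : Function.Injective c) :
    {j : ℕ+ | MvPolynomial.pderiv (Sum.inr (c j)) f ≠ 0}.Finite :=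
  Set.Finite.preimage (f := c) hc.injOn (fin_r f)

lemma sup_fin {ι : Type*} (g h : ι → PY) (hh : {j | h j ≠ 0}.Finite) (H : ∀ j, h j = 0 → g j = 0) :
    (Function.support g).Finite :=
  hh.subset fun j hj hj2 => hj (H j hj2)

lemma Yplus_add (f g : PY) : Yplus (f + g) = Yplus f + Yplus g := by
  rw [Yplus, Yplus, Yplus, ← finsum_add_distrib]
  · simp [mul_add]
  · exact sup_fin _ _ (fin_r f) (by intro j h; rw [h, mul_zero])
  · exact sup_fin _ _ (fin_r g) (by intro j h; rw [h, mul_zero])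

lemma ThetaY_add (f g : PY) : ThetaY (f + g) = ThetaY f + ThetaY g := by
  rw [ThetaY, ThetaY, ThetaY, ← finsum_add_distrib]
  · simp [mul_add]
  · exact sup_fin _ _ (fin_rp f _ PNat.coe_injective) (by intro j h; rw [h, mul_zero])
  · exact sup_fin _ _ (fin_rp g _ PNat.coe_injective) (by intro j h; rw [h, mul_zero])

lemma c1_inj : Function.Injective (fun i : ℕ+ => (i : ℕ) - 1) := by
  intro i j h
  have := i.pos; have := j.pos
  apply PNat.coe_injective; simp only at h; omega
lemma c2_inj (i : ℕ+) : Function.Injective (fun j : ℕ+ => (i : ℕ) + (j : ℕ) - 1) := by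
  intro k j h
  have := i.pos; have := j.pos
  apply PNat.coe_injective; simp only at h; omega

def G1 (f : PY) : PY := ∑ᶠ i : ℕ+, ∑ᶠ j : ℕ+, ((j : ℕ) : F) •
      (yv ((i : ℕ) + (j : ℕ)) *
        MvPolynomial.pderiv (Sum.inl j) (MvPolynomial.pderiv (Sum.inr ((i : ℕ) - 1)) f))
def G2 (f : PY) : PY := ∑ᶠ i : ℕ+, ∑ᶠ j : ℕ+,
      yv (i : ℕ) * pv j * MvPolynomial.pderiv (Sum.inr ((i : ℕ) + (j : ℕ) - 1)) f
def G3 (f : PY) : PY := ∑ᶠ i : ℕ+, ((i : ℕ) : F) •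
      (yv ((i : ℕ) + 1) * MvPolynomial.pderiv (Sum.inr (i : ℕ)) f)
lemma GammaY_eq (f : PY) : GammaY f = alpha • G1 f + G2 f + (alpha - 1) • G3 f := rfl

lemma G3_add (f g : PY) : G3 (f + g) = G3 f + G3 g := by
  rw [G3, G3, G3, ← finsum_add_distrib]
  · simp [mul_add]
  · exact sup_fin _ _ (fin_rp f _ PNat.coe_injective) (by intro j h; rw [h, mul_zero, smul_zero])
  · exact sup_fin _ _ (fin_rp g _ PNat.coe_injective) (by intro j h; rw [h, mul_zero, smul_zero])
lemma G1_add (f g : PY) : G1 (f + g) = G1 f + G1 g := by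
  rw [G1, G1, G1, ← finsum_add_distrib]
  · refine finsum_congr fun i => ?_
    rw [← finsum_add_distrib]
    · simp [mul_add]
    · exact sup_fin _ _ (fin_l (MvPolynomial.pderiv (Sum.inr ((i : ℕ) - 1)) f)) (by intro j h; rw [h, mul_zero, smul_zero])
    · exact sup_fin _ _ (fin_l (MvPolynomial.pderiv (Sum.inr ((i : ℕ) - 1)) g)) (by intro j h; rw [h, mul_zero, smul_zero])
  · exact sup_fin _ _ (fin_rp f _ c1_inj) (by intro j h; rw [h]; simp)
  · exact sup_fin _ _ (fin_rp g _ c1_inj) (by intro j h; rw [h]; simp)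
lemma fin_G2 (f : PY) : (Function.support fun i : ℕ+ => ∑ᶠ j : ℕ+,
      yv (i : ℕ) * pv j * MvPolynomial.pderiv (Sum.inr ((i : ℕ) + (j : ℕ) - 1)) f).Finite := by
  obtain ⟨N, hN⟩ := (fin_r f).bddAbove
  refine Set.Finite.subset (Set.Finite.preimage (f := ((↑) : ℕ+ → ℕ)) PNat.coe_injective.injOn (Set.finite_Iic N)) ?_
  intro i hi
  by_contra hlt
  apply hi
  simp only [Set.mem_preimage, Set.mem_Iic, not_le] at hlt
  rw [← finsum_zero (α := ℕ+)]
  refine finsum_congr fun j => ?_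
  have : MvPolynomial.pderiv (Sum.inr ((i : ℕ) + (j : ℕ) - 1)) f = 0 := by
    by_contra h
    have := hN h
    have := j.pos
    omega
  rw [this, mul_zero]
lemma G2_add (f g : PY) : G2 (f + g) = G2 f + G2 g := by
  rw [G2, G2, G2, ← finsum_add_distrib (fin_G2 f) (fin_G2 g)]
  refine finsum_congr fun i => ?_
  rw [← finsum_add_distrib]
  · simp [mul_add]
  · exact sup_fin _ _ (fin_rp f _ (c2_inj i)) (by intro j h; rw [h, mul_zero])
  · exact sup_fin _ _ (fin_rp g _ (c2_inj i)) (by intro j h; rw [h, mul_zero])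

lemma Dl0_sum (a : SymA) : Dl0 a = ∑ j ∈ a.vars, ((j : ℕ) : F) • (X ^ (j : ℕ) * C (MvPolynomial.pderiv j a)) := by
  have hc : ∀ (j : ℕ+) (x : SymA), ((LinearMap.toSpanSingleton SymA (Y F) (((j : ℕ) : F) • (X ^ (j : ℕ) : Y F))).compDer (MvPolynomial.pderiv j)) x
      = (MvPolynomial.pderiv j x) • (((j : ℕ) : F) • (X ^ (j : ℕ) : Y F)) := fun j x => rfl
  have h := MvPolynomial.derivation_eq_of_forall_mem_vars (D₁ := Dl0d) (D₂ := ∑ j ∈ a.vars,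
    (LinearMap.toSpanSingleton SymA (Y F) (((j : ℕ) : F) • (X ^ (j : ℕ) : Y F))).compDer (MvPolynomial.pderiv j)) (f := a) ?_
  · refine Eq.trans h ?_
    rw [← Derivation.coeFnAddMonoidHom_apply, map_sum, Finset.sum_apply]
    refine Finset.sum_congr rfl fun j _ => ?_
    rw [Derivation.coeFnAddMonoidHom_apply, hc, smul_eq_C_mul]
    rw [mul_smul_comm, mul_comm]
  · intro i hi
    rw [← Derivation.coeFnAddMonoidHom_apply (∑ j ∈ a.vars, _), map_sum, Finset.sum_apply, Finset.sum_eq_single i]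
    · rw [Derivation.coeFnAddMonoidHom_apply, hc,
        MvPolynomial.pderiv_X_self, one_smul]
      exact MvPolynomial.mkDerivation_X _ _ _
    · intro j _ hj
      rw [Derivation.coeFnAddMonoidHom_apply, hc,
        MvPolynomial.pderiv_X_of_ne (Ne.symm hj), zero_smul]
    · intro h; exact absurd hi h

lemma Yplus_iota (f : Y F) : Yplus (iota f) = iota (X * f) := by
  induction f using Polynomial.induction_on' with
  | add p q hp hq => rw [map_add, Yplus_add, hp, hq, mul_add, map_add]
  | monomial m a =>
    rw [← C_mul_X_pow_eq_monomial, mul_comm (C a), ← mul_assoc, ← pow_succ', iota_XC, iota_XC, Yplus,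
      finsum_eq_single _ m]
    · rw [pd_ry, if_pos rfl]
    · intro j hj; rw [pd_ry, if_neg hj, mul_zero]

lemma G3_iota (f : Y F) : G3 (iota f) = iota (X * th f) := by
  induction f using Polynomial.induction_on' with
  | add p q hp hq => rw [map_add, G3_add, hp, hq, map_add, mul_add, map_add]
  | monomial m a =>
    rw [← C_mul_X_pow_eq_monomial, mul_comm (C a), th_XC, mul_smul_comm, ← mul_assoc, ← pow_succ', map_smul, iota_XC, iota_XC, G3]
    rcases Nat.eq_zero_or_pos m with h | h
    · subst h
      simp only [Nat.cast_zero, zero_smul]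
      refine (finsum_congr fun j => ?_).trans finsum_zero
      rw [pd_ry, if_neg j.pos.ne', mul_zero, smul_zero]
    · obtain ⟨i, rfl⟩ : ∃ i : ℕ+, (i : ℕ) = m := ⟨⟨m, h⟩, rfl⟩
      rw [finsum_eq_single _ i]
      · rw [pd_ry, if_pos rfl]
      · intro j hj; rw [pd_ry, if_neg, mul_zero, smul_zero]
        intro hh; exact hj (PNat.coe_injective hh)

lemma G1_iota (f : Y F) : G1 (iota f) = iota (X * Dl f) := by
  induction f using Polynomial.induction_on' with
  | add p q hp hq => rw [map_add, G1_add, hp, hq, map_add, mul_add, map_add]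
  | monomial m a =>
    rw [← C_mul_X_pow_eq_monomial, mul_comm (C a), Dl_Xp, Dl_C, iota_XC, G1, finsum_eq_single _ ⟨m + 1, Nat.succ_pos m⟩]
    · simp only [PNat.mk_coe, Nat.add_sub_cancel, pd_ry, if_true, pd_l]
      rw [finsum_eq_sum_of_support_subset (s := a.vars)]
      · rw [Dl0_sum, Finset.mul_sum, Finset.mul_sum, map_sum]
        refine Finset.sum_congr rfl fun j _ => ?_
        rw [mul_smul_comm, mul_smul_comm, map_smul, ← mul_assoc, ← mul_assoc, ← pow_succ', ← pow_add, iota_XC]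
      · intro j hj
        by_contra h
        apply hj
        have : MvPolynomial.pderiv j a = 0 := MvPolynomial.pderiv_eq_zero_of_notMem_vars h
        simp only [this, map_zero, mul_zero, smul_zero]
    · intro i hi
      have : (i : ℕ) - 1 ≠ m := by
        intro h; apply hi; apply PNat.coe_injective; have := i.pos; simp only [PNat.mk_coe]; omega
      simp only [pd_ry, if_neg this, map_zero, mul_zero, smul_zero, finsum_zero]

lemma rn_pn (j : ℕ+) : rn (pn j) = pv j := by
  rw [pn_coe]; exact MvPolynomial.rename_X _ _
lemma G2_iota (f : Y F) : G2 (iota f) = iota (X * TT f) := by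
  induction f using Polynomial.induction_on' with
  | add p q hp hq => rw [map_add, G2_add, hp, hq, map_add, mul_add, map_add]
  | monomial m a =>
    rw [← C_mul_X_pow_eq_monomial, mul_comm (C a), iota_XC, G2, TT_XC, Tc]
    have h1 : ∀ i : ℕ+, (∑ᶠ j : ℕ+, yv (i : ℕ) * pv j * MvPolynomial.pderiv (Sum.inr ((i : ℕ) + (j : ℕ) - 1)) (yv m * rn a)) =
        if (i : ℕ) ≤ m + 1 then yv i * (rn (pn (m + 1 - i)) * rn a) else 0 := by
      intro i
      by_cases h : (i : ℕ) ≤ m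
      · obtain ⟨i', hi'⟩ : ∃ i' : ℕ+, (i' : ℕ) = m + 1 - i := by
          have h9 : 0 < m + 1 - (i : ℕ) := by omega
          exact ⟨⟨_, h9⟩, rfl⟩
        rw [if_pos (by omega), finsum_eq_single _ i']
        · rw [pd_ry, if_pos (by omega), mul_assoc, ← rn_pn, hi']
        · intro j hj
          rw [pd_ry, if_neg, mul_zero]
          intro h2
          have h6 : (j : ℕ) = (i' : ℕ) := by have := j.pos; omega
          exact hj (PNat.coe_injective h6)
      · have : (∑ᶠ j : ℕ+, yv (i : ℕ) * pv j * MvPolynomial.pderiv (Sum.inr ((i : ℕ) + (j : ℕ) - 1)) (yv m * rn a)) = 0 := by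
          rw [← finsum_zero (α := ℕ+)]
          refine finsum_congr fun j => ?_
          have := j.pos
          rw [pd_ry, if_neg (by omega), mul_zero]
        rw [this]
        split_ifs with h3
        · have : m + 1 - i = 0 := by omega
          rw [this, pn_zero]; simp
        · rfl
    simp only [h1]
    rw [finsum_eq_sum_of_support_subset (s := (Finset.range (m + 1)).image Nat.succPNat)]
    · rw [Finset.sum_image (by intro x _ y _ h; exact Nat.succPNat_injective h)]
      rw [← Finset.Nat.sum_antidiagonal_swap, Finset.Nat.sum_antidiagonal_eq_sum_range_succ_mk, Finset.sum_mul, Finset.mul_sum, map_sum]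
      refine Finset.sum_congr rfl fun l hl => ?_
      rw [Finset.mem_range] at hl
      have h2 : (X * (C (pn (m - l)) * X ^ l * C a) : Y F) = X ^ (l + 1) * C (pn (m - l) * a) := by
        rw [C_mul]; ring
      simp only [Nat.succPNat_coe, Prod.swap, Nat.succ_eq_add_one, Nat.add_sub_add_right]
      rw [if_pos (by omega), h2, iota_XC, map_mul]
    · intro i hi
      simp only [Function.mem_support, ne_eq, ite_eq_right_iff, not_forall] at hi
      obtain ⟨h, _⟩ := hi
      simp only [Finset.coe_image, Finset.coe_range, Set.mem_image, Set.mem_Iio]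
      exact ⟨i.natPred, by have := i.natPred_add_one; omega, PNat.succPNat_natPred i⟩

lemma GammaY_iota (f : Y F) : GammaY (iota f) = iota (X * LamL alpha f) := by
  rw [GammaY_eq, G1_iota, G2_iota, G3_iota, LamL_apply, mul_add, mul_add, mul_smul_comm, mul_smul_comm,
    map_add, map_add, map_smul, map_smul]
  abel

lemma drop_rn (a : SymA) : dropY (rn a) = a := by
  rw [dropY, rn, MvPolynomial.aeval_rename]
  exact MvPolynomial.aeval_X_left_apply a
lemma ThetaY_iota (f : Y F) : dropY (ThetaY (iota f)) = Th0 f := by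
  induction f using Polynomial.induction_on' with
  | add p q hp hq => rw [map_add, ThetaY_add, map_add, hp, hq, map_add]
  | monomial m a =>
    rw [← C_mul_X_pow_eq_monomial, mul_comm (C a), iota_XC, ThetaY, Th0_XC]
    rcases Nat.eq_zero_or_pos m with h | h
    · subst h
      rw [pn_zero, zero_mul, ← map_zero dropY]
      congr 1
      refine (finsum_congr fun j => ?_).trans finsum_zero
      rw [pd_ry, if_neg j.pos.ne', mul_zero]
    · obtain ⟨i, rfl⟩ : ∃ i : ℕ+, (i : ℕ) = m := ⟨⟨m, h⟩, rfl⟩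
      rw [finsum_eq_single _ i]
      · rw [pd_ry, if_pos rfl, ← rn_pn, ← map_mul, drop_rn]
      · intro j hj; rw [pd_ry, if_neg, mul_zero]
        intro hh; exact hj (PNat.coe_injective hh)

lemma wordOp_iota (w : List Bool) (f : Y F) : wordOp w (iota f) = iota (wY alpha w f) := by
  induction w with
  | nil => rfl
  | cons b w ih =>
    cases b
    · simp only [wordOp, ih, wY, Bool.false_eq_true, ↓reduceIte, LinearMap.comp_apply, LinearMap.mulLeft_apply, GammaY_iota]
    · simp only [wordOp, ih, wY, ↓reduceIte, LinearMap.comp_apply, LinearMap.mulLeft_apply, Yplus_iota]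

lemma Bc_eq (n l : ℕ) (f : SymA) : Bc n l f = wB alpha n l f := by
  have h : alpha⁻¹ • (yv 0 * MvPolynomial.rename Sum.inl f) = iota (alpha⁻¹ • C f) := by
    rw [map_smul, iota_C]; rfl
  rw [Bc, h]
  simp only [wordOp_iota]
  rw [← map_sum, ThetaY_iota]
  simp only [wB, LinearMap.smul_apply, LinearMap.comp_apply, CL_apply, map_smul, LinearMap.sum_apply, map_sum, Finset.smul_sum]

end JK
end

noncomputable section
namespace JK
open Polynomial
variable {K : Type} [Field K] [CharZero K] (al : K)

def Phi : S K →ₐ[K] Y K := MvPolynomial.aeval fun i : ℕ+ => C (MvPolynomial.X i) + X ^ (i : ℕ)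
lemma Phi_pn (n : ℕ+) : Phi (pn n : S K) = C (pn n) + X ^ (n : ℕ) := by
  rw [pn_coe, Phi, MvPolynomial.aeval_X]
lemma Phi_step (n : ℕ+) (f : S K) : Phi (pn n * f) = C (pn n) * Phi f + X ^ (n : ℕ) * Phi f := by
  rw [map_mul, Phi_pn, add_mul]
def gp (k : ℕ) : S K →ₗ[K] S K := ((Polynomial.lcoeff (S K) k).restrictScalars K) ∘ₗ Phi.toLinearMap
lemma gp_apply (k : ℕ) (f : S K) : gp k f = (Phi f).coeff k := rfl
lemma gp_pn (k : ℕ) (n : ℕ+) (f : S K) : gp k (pn n * f) = pn n * gp k f + (if (n : ℕ) ≤ k then gp (k - n) f else 0) := by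
  rw [gp_apply, Phi_step, coeff_add, coeff_C_mul, coeff_X_pow_mul']; rfl
lemma gp_one (k : ℕ) : gp k (1 : S K) = if k = 0 then 1 else 0 := by
  rw [gp_apply, map_one, coeff_one]
lemma gp_zero (f : S K) : gp 0 f = f := by
  refine S_ind (gp 0) LinearMap.id ?_ ?_ f
  · simp [gp_one]
  · intro n f h
    rw [gp_pn, h, if_neg (by have := n.pos; omega)]; simp
lemma gp_comm (k l : ℕ) (f : S K) : gp k (gp l f) = gp l (gp k f) := by
  have := S_ind (LinearMap.pi fun kl : ℕ × ℕ => gp kl.1 ∘ₗ gp kl.2)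
    (LinearMap.pi fun kl : ℕ × ℕ => gp kl.2 ∘ₗ gp kl.1) (K := K) ?_ ?_ f
  · exact congrFun this (k, l)
  · ext1 ⟨k, l⟩
    simp only [LinearMap.pi_apply, LinearMap.comp_apply, gp_one]
    split_ifs <;> simp [gp_one, *]
  · intro n f h
    ext1 ⟨k, l⟩
    have h' : ∀ k l, gp k (gp l f) = gp l (gp k f) := fun k l => congrFun h (k, l)
    simp only [LinearMap.pi_apply, LinearMap.comp_apply, gp_pn, map_add]
    rw [h' k l]
    split_ifs <;> simp only [map_zero, h', add_zero] <;> abel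

lemma th_CX (n : ℕ) (a : S K) (F : Y K) : th ((C a + X ^ n) * F) = C a * th F + X ^ n * th F + (n : K) • (X ^ n * F) := by
  rw [add_mul, map_add, th_Cm, th_Xp]; abel

lemma Dl_Phi (f : S K) : Dl (Phi f) = th (Phi f) := by
  refine S_ind (Dl ∘ₗ Phi.toLinearMap) (th ∘ₗ Phi.toLinearMap) ?_ ?_ f
  · simp only [LinearMap.comp_apply, AlgHom.toLinearMap_apply, map_one]
    have := Dl_C (K := K) 1; have h2 := th_C (K := K) 1
    rw [C_1] at this h2; rw [this, h2, Dl0_one]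
  · intro n f h
    simp only [LinearMap.comp_apply, AlgHom.toLinearMap_apply] at h ⊢
    rw [Phi_step, map_add, map_add, th_Cm, th_Xp, Dl_Cm, Dl_Xp, h, Dl0_pn, smul_mul_assoc]; abel

lemma hat_Cm_der (E : S K →ₗ[K] S K) (hE : ∀ a b, E (a * b) = a * E b + b * E a) (a : S K) (F : Y K) :
    hat E (C a * F) = C a * hat E F + C (E a) * F := by
  refine Y_mon (hat E ∘ₗ LinearMap.mulLeft K (C a)) (LinearMap.mulLeft K (C a) ∘ₗ hat E + LinearMap.mulLeft K (C (E a))) ?_ F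
  intro m b
  simp only [LinearMap.comp_apply, LinearMap.add_apply, LinearMap.mulLeft_apply]
  rw [mul_left_comm, ← C_mul, hat_Xp, hat_Xp, hat_C, hat_C, hE, C_add, C_mul, C_mul]; ring

lemma Phi_EE (n : ℕ) (f : S K) : Phi (EE n f) = hat (EE n) (Phi f) + X ^ n * th (Phi f) := by
  refine S_ind (Phi.toLinearMap ∘ₗ EE n) (hat (EE n) ∘ₗ Phi.toLinearMap + LinearMap.mulLeft K (X ^ n) ∘ₗ th ∘ₗ Phi.toLinearMap) ?_ ?_ f
  · simp only [LinearMap.comp_apply, LinearMap.add_apply, AlgHom.toLinearMap_apply, map_one, LinearMap.mulLeft_apply]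
    have := hat_C (K := K) (EE n) 1; have h2 := th_C (K := K) 1
    rw [C_1] at this h2; rw [this, h2, EE_one]; simp
  · intro m f h
    simp only [LinearMap.comp_apply, LinearMap.add_apply, AlgHom.toLinearMap_apply, LinearMap.mulLeft_apply] at h ⊢
    obtain ⟨mn, hmn⟩ : ∃ k : ℕ+, (k : ℕ) = m + n := ⟨⟨m + n, by have := m.pos; omega⟩, rfl⟩
    rw [EE_mul, map_add, map_mul, map_mul, h, EE_pn, map_smul, ← hmn, Phi_pn, Phi_pn, Phi_step, map_add,
      hat_Cm_der _ (EE_mul n), hat_Xp, EE_pn, map_add, th_Cm, th_Xp, Csm, hmn, pow_add]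
    simp only [Algebra.smul_def, map_add, map_mul, map_natCast]; ring

/-- R0 -/
def R0 : S K →ₗ[K] Y K := TT ∘ₗ Dl0 - CL ∘ₗ EE 0
lemma R0_apply (f : S K) : R0 f = TT (Dl0 f) - C (EE 0 f) := rfl
lemma R0_pn (n : ℕ) (f : S K) : R0 (pn n * f) = C (pn n) * R0 f + (n : K) • ((Tc n - C (pn n)) * C f) := by
  rw [R0_apply, R0_apply, Dl0_mul, map_add, TT_Cm, Dl0_pn, EE_mul, EE_pn, mul_smul_comm, map_smul, mul_comm (C f), TT_XC,
    C_add, C_mul, mul_smul_comm, Csm, C_mul, add_zero]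
  simp only [Algebra.smul_def, map_add, map_mul, map_natCast]; ring
lemma extR0_Cm (n : ℕ) (F : Y K) : ext R0 (C (pn n) * F) = C (pn n) * ext R0 F + (n : K) • ((Tc n - C (pn n)) * F) := by
  refine Y_mon (ext R0 ∘ₗ LinearMap.mulLeft K (C (pn n))) (LinearMap.mulLeft K (C (pn n)) ∘ₗ ext R0 + (n : K) • LinearMap.mulLeft K (Tc n - C (pn n))) ?_ F
  intro m b
  simp only [LinearMap.comp_apply, LinearMap.add_apply, LinearMap.mulLeft_apply, LinearMap.smul_apply]
  rw [mul_left_comm, ← C_mul, ext_XC, ext_XC, R0_pn]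
  simp only [Algebra.smul_def, map_add, map_mul, map_natCast]; ring

lemma Phi_pn0 (n : ℕ) : Phi (pn n : S K) = C (pn n) + X ^ n - (if n = 0 then 1 else 0) := by
  rcases Nat.eq_zero_or_pos n with h | h
  · subst h; simp [pn_zero]
  · obtain ⟨i, rfl⟩ : ∃ i : ℕ+, (i : ℕ) = n := ⟨⟨n, h⟩, rfl⟩
    rw [Phi_pn, if_neg h.ne', sub_zero]
lemma anti_ite (n : ℕ) (a : ℕ → Y K) : ∑ ij ∈ Finset.HasAntidiagonal.antidiagonal n, (if ij.1 = 0 then (1 : Y K) else 0) * a ij.2 = a n := by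
  rw [Finset.sum_eq_single (0, n)]
  · simp
  · rintro ⟨i, j⟩ h1 h2
    rw [Finset.HasAntidiagonal.mem_antidiagonal] at h1
    simp only at h1 ⊢
    rw [if_neg, zero_mul]
    rintro rfl; apply h2; simp at h1; simp [h1]
  · intro h; exfalso; apply h; simp
lemma Phi_sn (n : ℕ+) : Phi (sn n : S K) = C (sn n) + (2 : K) • (Tc n - C (pn n)) + ((n : K) - 1) • X ^ (n : ℕ) := by
  have hn : (n : ℕ) ≠ 0 := n.pos.ne'
  have h1 : ∑ ij ∈ Finset.HasAntidiagonal.antidiagonal (n : ℕ), (X ^ ij.1 * X ^ ij.2 : Y K) = ((n : K) + 1) • X ^ (n : ℕ) := by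
    rw [Finset.sum_congr rfl (g := fun _ => (X ^ (n : ℕ) : Y K))]
    · rw [Finset.sum_const, Finset.Nat.card_antidiagonal, nsmul_eq_mul]
      simp only [Algebra.smul_def, map_add, map_natCast, map_one, nsmul_eq_mul, Nat.cast_add, Nat.cast_one]
    · rintro ⟨i, j⟩ h
      rw [Finset.HasAntidiagonal.mem_antidiagonal] at h
      rw [← pow_add, h]
  have h2 : ∑ ij ∈ Finset.HasAntidiagonal.antidiagonal (n : ℕ), (C (pn ij.2) * X ^ ij.1 : Y K) = Tc n := by
    rw [Tc, ← Finset.Nat.sum_antidiagonal_swap]; rfl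
  have h3 := anti_ite (K := K) n fun j => C (pn j) + X ^ j - (if j = 0 then 1 else 0)
  have h4 : ∑ ij ∈ Finset.HasAntidiagonal.antidiagonal (n : ℕ), (if ij.2 = 0 then (1 : Y K) else 0) * (C (pn ij.1) + X ^ ij.1) = C (pn n) + X ^ (n : ℕ) := by
    have := anti_ite (K := K) n fun j => C (pn j) + X ^ j
    rw [← Finset.Nat.sum_antidiagonal_swap] at this
    exact this
  simp only [if_neg hn, sub_zero] at h3
  rw [sn, map_sum, map_sum, Finset.sum_congr rfl (g := fun ij : ℕ × ℕ => C (pn ij.1 * pn ij.2) + C (pn ij.1) * X ^ ij.2 +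
    C (pn ij.2) * X ^ ij.1 + X ^ ij.1 * X ^ ij.2 - (if ij.1 = 0 then (1 : Y K) else 0) * (C (pn ij.2) + X ^ ij.2 - (if ij.2 = 0 then 1 else 0))
    - (if ij.2 = 0 then (1 : Y K) else 0) * (C (pn ij.1) + X ^ ij.1))]
  · rw [Finset.sum_sub_distrib, Finset.sum_sub_distrib, Finset.sum_add_distrib, Finset.sum_add_distrib, Finset.sum_add_distrib, h1, h2, h3, h4, ← Tc]
    simp only [Algebra.smul_def, map_add, map_sub, map_natCast, map_one, map_ofNat]; ring
  · rintro ⟨i, j⟩ _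
    simp only [map_mul, Phi_pn0]; ring

def QD : Y K →ₗ[K] Y K := hat (D al) + (al / 2) • (th ∘ₗ th - th) + ext R0
lemma QD_apply (F : Y K) : QD al F = hat (D al) F + (al / 2) • (th (th F) - th F) + ext R0 F := rfl
lemma Phi_D (f : S K) : Phi (D al f) = QD al (Phi f) := by
  refine S_ind (Phi.toLinearMap ∘ₗ D al) (QD al ∘ₗ Phi.toLinearMap) ?_ ?_ f
  · simp only [LinearMap.comp_apply, AlgHom.toLinearMap_apply, map_one, D_one, map_zero]
    have h1 := hat_C (K := K) (D al) 1; have h2 := th_C (K := K) 1; have h3 := ext_C (K := K) R0 1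
    rw [C_1] at h1 h2 h3; rw [QD_apply, h1, h2, h3, R0_apply, EE_one, Dl0_one, D_one]; simp
  · intro n f h
    simp only [LinearMap.comp_apply, AlgHom.toLinearMap_apply] at h ⊢
    rw [D_pn, map_add, map_add, map_add, map_mul, map_smul, map_smul, map_smul, map_mul, map_mul, h, Phi_pn, Phi_sn, Phi_EE]
    rw [add_mul (C _) _ (Phi f), map_add (QD al)]
    generalize Phi f = G
    rw [QD_apply, QD_apply, QD_apply, hat_Cm_pn, hat_Xp, th_Cm, th_Cm, th_Xp, map_add, map_smul, th_Xp, th_Xp, extR0_Cm, ext_Xp]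
    simp only [smul_sub, smul_add, smul_smul, mul_sub, mul_add, add_mul, sub_mul, mul_smul_comm, smul_mul_assoc]
    module
end JK
end

noncomputable section
namespace JK
open Polynomial
variable {K : Type} [Field K] [CharZero K] (al : K)

def Ec (m : ℕ) : S K →ₗ[K] Y K := ∑ ij ∈ Finset.HasAntidiagonal.antidiagonal m, LinearMap.mulLeft K (X ^ ij.2) ∘ₗ CL ∘ₗ EE ij.1
lemma Ec_apply (m : ℕ) (a : S K) : Ec m a = ∑ ij ∈ Finset.HasAntidiagonal.antidiagonal m, X ^ ij.2 * C (EE ij.1 a) := by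
  simp [Ec, LinearMap.sum_apply, CL_apply]
lemma Ec_succ (m : ℕ) (a : S K) : Ec (m + 1) a = X * Ec m a + C (EE (m + 1) a) := by
  rw [Ec_apply, Finset.Nat.antidiagonal_succ', Finset.sum_cons, Finset.sum_map, Ec_apply, Finset.mul_sum]
  simp only [pow_zero, one_mul, Function.Embedding.prodMap, Function.Embedding.coeFn_mk, Prod.map,
    Function.Embedding.refl_apply, Nat.succ_eq_add_one, pow_succ']
  rw [add_comm]
  refine congrArg₂ (· + ·) (Finset.sum_congr rfl fun x _ => ?_) rfl
  rw [← mul_assoc]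
def EP : Y K →ₗ[K] Y K := mk fun m => Ec m
lemma EP_XC (m : ℕ) (a : S K) : EP (X ^ m * C a) = Ec m a := by rw [EP, mk_XC]
lemma EP_X (F : Y K) : EP (X * F) = X * EP F + C (Th0 (X * Dl F)) := by
  refine Y_mon (EP ∘ₗ LinearMap.mulLeft K X) (LinearMap.mulLeft K X ∘ₗ EP +
    CL ∘ₗ Th0 ∘ₗ LinearMap.mulLeft K X ∘ₗ Dl) ?_ F
  intro m a
  simp only [LinearMap.comp_apply, LinearMap.add_apply, LinearMap.mulLeft_apply, CL_apply]
  rw [Dl_Xp, Dl_C, ← mul_assoc, ← pow_succ', ← mul_assoc, ← pow_succ', Th0_Dl0, EP_XC, EP_XC, Ec_succ]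
lemma EP_C (a : S K) : EP (C a) = C (EE 0 a) := by
  have := EP_XC 0 a; rw [pow_zero, one_mul] at this; rw [this, Ec_apply]; simp
lemma extR0_eq (F : Y K) : ext R0 F = TT (Dl F) - EP F := by
  refine Y_ind (ext R0) (TT ∘ₗ Dl - EP) ?_ ?_ F
  · intro a; simp only [LinearMap.sub_apply, LinearMap.comp_apply]; rw [ext_C, R0_apply, Dl_C, EP_C]
  · intro F h
    simp only [LinearMap.sub_apply, LinearMap.comp_apply] at h ⊢
    rw [ext_X, h, Dl_X, TT_X, EP_X, mul_sub]; abel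

lemma Tc_coeff (m k : ℕ) : (Tc m : Y K).coeff k = if k ≤ m then pn (m - k) else 0 := by
  rw [Tc, finset_sum_coeff]
  split_ifs with h
  · rw [Finset.sum_eq_single (m - k, k)]
    · simp
    · rintro ⟨i, j⟩ h1 h2
      rw [coeff_C_mul, coeff_X_pow, if_neg, mul_zero]
      rintro rfl; apply h2; rw [Finset.HasAntidiagonal.mem_antidiagonal] at h1; simp only at h1 ⊢; congr 1; omega
    · intro h2; exfalso; apply h2; simp [h]
  · refine Finset.sum_eq_zero ?_
    rintro ⟨i, j⟩ h1
    rw [Finset.HasAntidiagonal.mem_antidiagonal] at h1; simp only at h1 ⊢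
    rw [coeff_C_mul, coeff_X_pow, if_neg (by omega), mul_zero]
lemma Ec_coeff (m k : ℕ) (a : S K) : (Ec m a).coeff k = if k ≤ m then EE (m - k) a else 0 := by
  rw [Ec_apply, finset_sum_coeff]
  split_ifs with h
  · rw [Finset.sum_eq_single (m - k, k)]
    · simp
    · rintro ⟨i, j⟩ h1 h2
      rw [mul_comm, coeff_C_mul, coeff_X_pow, if_neg, mul_zero]
      rintro rfl; apply h2; rw [Finset.HasAntidiagonal.mem_antidiagonal] at h1; simp only at h1 ⊢; congr 1; omega
    · intro h2; exfalso; apply h2; simp [h]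
  · refine Finset.sum_eq_zero ?_
    rintro ⟨i, j⟩ h1
    rw [Finset.HasAntidiagonal.mem_antidiagonal] at h1; simp only at h1 ⊢
    rw [mul_comm, coeff_C_mul, coeff_X_pow, if_neg (by omega), mul_zero]

lemma as_sum (F : Y K) : F = ∑ m ∈ F.support, X ^ m * C (F.coeff m) := by
  conv_lhs => rw [F.as_sum_support_C_mul_X_pow]
  exact Finset.sum_congr rfl fun m _ => mul_comm _ _

lemma phi_TT (ph : S K →ₗ[K] K) (G : Y K) (k : ℕ) (h : ∀ j, 1 ≤ j → ph (pn j * G.coeff (k + j)) = 0) :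
    ph ((TT G).coeff k) = 0 := by
  rw [as_sum G, map_sum, finset_sum_coeff, map_sum]
  refine Finset.sum_eq_zero fun m _ => ?_
  rw [TT_XC, coeff_mul_C, Tc_coeff]
  split_ifs with h1
  · rcases Nat.lt_or_ge k m with h2 | h2
    · have := h (m - k) (by omega)
      rwa [show k + (m - k) = m by omega] at this
    · rw [show m - k = 0 by omega, pn_zero, zero_mul, map_zero]
  · rw [zero_mul, map_zero]
lemma phi_EP (ph : S K →ₗ[K] K) (G : Y K) (k : ℕ) (h : ∀ j, 1 ≤ j → ph (EE j (G.coeff (k + j))) = 0) :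
    ph ((EP G).coeff k) = ph (EE 0 (G.coeff k)) := by
  conv_lhs => rw [as_sum G]
  rw [map_sum, finset_sum_coeff, map_sum, Finset.sum_eq_single k]
  · rw [EP_XC, Ec_coeff, if_pos le_rfl, Nat.sub_self]
  · intro m _ hm
    rw [EP_XC, Ec_coeff]
    split_ifs with h1
    · have := h (m - k) (by omega)
      rwa [show k + (m - k) = m by omega] at this
    · rw [map_zero]
  · intro h2
    rw [EP_XC, Ec_coeff, if_pos le_rfl, Nat.sub_self, notMem_support_iff.mp h2, map_zero, map_zero]

lemma hat_coeff (L : S K →ₗ[K] S K) (F : Y K) (k : ℕ) : (hat L F).coeff k = L (F.coeff k) := by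
  refine Y_mon (((Polynomial.lcoeff (S K) k).restrictScalars K) ∘ₗ hat L) (L ∘ₗ ((Polynomial.lcoeff (S K) k).restrictScalars K)) ?_ F
  intro m a
  simp only [LinearMap.comp_apply, LinearMap.restrictScalars_apply, lcoeff_apply]
  rw [hat_Xp, hat_C, mul_comm, mul_comm _ (C a), coeff_C_mul_X_pow, coeff_C_mul_X_pow]
  split_ifs <;> simp
lemma th_coeff (F : Y K) (k : ℕ) : (th F).coeff k = (k : K) • F.coeff k := by
  refine Y_mon (((Polynomial.lcoeff (S K) k).restrictScalars K) ∘ₗ th) ((k : K) • ((Polynomial.lcoeff (S K) k).restrictScalars K)) ?_ F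
  intro m a
  simp only [LinearMap.comp_apply, LinearMap.restrictScalars_apply, lcoeff_apply, LinearMap.smul_apply]
  rw [th_XC, coeff_smul, mul_comm, coeff_C_mul_X_pow]
  split_ifs with h
  · rw [h]
  · simp

lemma gp_EE (k j : ℕ) (f : S K) : gp k (EE j f) = EE j (gp k f) + (if j ≤ k then ((k - j : ℕ) : K) • gp (k - j) f else 0) := by
  rw [gp_apply, Phi_EE, coeff_add, hat_coeff, coeff_X_pow_mul', th_coeff]; rfl

lemma phi_gpD (ph : S K →ₗ[K] K) (f : S K) (k : ℕ) (h1 : ∀ j, 1 ≤ j → ph (pn j * gp (k + j) f) = 0)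
    (h2 : ∀ j, 1 ≤ j → ph (EE j (gp (k + j) f)) = 0) :
    ph (gp k (D al f)) = ph (D al (gp k f)) + (al * (k * (k - 1) / 2)) * ph (gp k f) - ph (EE 0 (gp k f)) := by
  rw [gp_apply, Phi_D, QD_apply, extR0_eq, Dl_Phi, coeff_add, coeff_add, coeff_sub, coeff_smul, coeff_sub, hat_coeff, th_coeff, th_coeff,
    map_add, map_add, map_sub, phi_TT ph _ k, phi_EP ph (Phi f) k h2, ← gp_apply, map_smul, map_sub, map_smul, map_smul]
  · simp only [smul_eq_mul]; ring
  · intro j hj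
    rw [th_coeff, mul_smul_comm, map_smul]
    have := h1 j hj
    rw [gp_apply] at this; rw [this, smul_zero]

/-- monomial coefficient functional -/
def MM : List ℕ → S K →ₗ[K] K
  | [] => MvPolynomial.lcoeff K 0
  | k :: L => MM L ∘ₗ gp k
lemma MM_cons (k : ℕ) (L : List ℕ) (f : S K) : MM (k :: L) f = MM L (gp k f) := rfl
lemma MM_zero (L : List ℕ) (f : S K) : MM (0 :: L) f = MM L f := by rw [MM_cons, gp_zero]
lemma MM_perm {L L' : List ℕ} (h : L.Perm L') (f : S K) : MM L f = MM L' f := by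
  induction h generalizing f with
  | nil => rfl
  | cons x _ ih => rw [MM_cons, MM_cons, ih]
  | swap x y l => rw [MM_cons, MM_cons, MM_cons, MM_cons, gp_comm]
  | trans _ _ h1 h2 => rw [h1, h2]

lemma c0_mul (a b : S K) : MvPolynomial.lcoeff K 0 (a * b) = MvPolynomial.lcoeff K 0 a * MvPolynomial.lcoeff K 0 b := by
  simp only [MvPolynomial.lcoeff_apply, ← MvPolynomial.constantCoeff_eq, map_mul]
lemma c0_pn (n : ℕ) : MvPolynomial.lcoeff K 0 (pn n : S K) = 0 := by
  rcases Nat.eq_zero_or_pos n with h | h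
  · simp [h, pn_zero]
  · obtain ⟨i, rfl⟩ : ∃ i' : ℕ+, (i' : ℕ) = n := ⟨⟨n, h⟩, rfl⟩
    rw [pn_coe, MvPolynomial.lcoeff_apply, ← MvPolynomial.constantCoeff_eq, MvPolynomial.constantCoeff_X]
inductive Dec (j : ℕ) : List ℕ → List ℕ → Prop
  | here (k : ℕ) (L : List ℕ) : j ≤ k → Dec j (k :: L) ((k - j) :: L)
  | there (k : ℕ) (L L' : List ℕ) : Dec j L L' → Dec j (k :: L) (k :: L')
inductive Up : List ℕ → List ℕ → Prop
  | here (k j : ℕ) (L L' : List ℕ) : 1 ≤ j → Dec j L L' → Up (k :: L) ((k + j) :: L')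
  | there (k : ℕ) (L L' : List ℕ) : Up L L' → Up (k :: L) (k :: L')

lemma MM_pn (j : ℕ) (hj : 1 ≤ j) (L : List ℕ) (f : S K) (h : ∀ L', Dec j L L' → MM L' f = 0) : MM L (pn j * f) = 0 := by
  obtain ⟨i, rfl⟩ : ∃ i : ℕ+, (i : ℕ) = j := ⟨⟨j, hj⟩, rfl⟩
  induction L generalizing f with
  | nil =>
    rw [MM, c0_mul, c0_pn, zero_mul]
  | cons k L ih =>
    rw [MM_cons, gp_pn, map_add, ih, zero_add]
    · split_ifs with h1
      · exact h _ (Dec.here k L h1)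
      · simp
    · intro L' hL'; exact h _ (Dec.there k L L' hL')
lemma EE_c0 (j : ℕ) (f : S K) : MvPolynomial.lcoeff K 0 (EE j f) = 0 := by
  refine S_ind (MvPolynomial.lcoeff K 0 ∘ₗ EE j) 0 ?_ ?_ f
  · simp [EE_one]
  · intro n f h
    rw [LinearMap.comp_apply, EE_mul, EE_pn, map_add, c0_mul, c0_mul, map_smul, c0_pn, c0_pn]
    simp
lemma MM_EE (j : ℕ) (L : List ℕ) (f : S K) (h : ∀ L', Dec j L L' → MM L' f = 0) : MM L (EE j f) = 0 := by
  induction L generalizing f with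
  | nil => exact EE_c0 j f
  | cons k L ih =>
    rw [MM_cons, gp_EE, map_add, ih, zero_add]
    · split_ifs with h1
      · have := h _ (Dec.here k L h1)
        rw [MM_cons] at this
        rw [map_smul, this, smul_zero]
      · simp
    · intro L' hL'; exact h _ (Dec.there k L L' hL')
lemma MM_EE0 (L : List ℕ) (f : S K) : MM L (EE 0 f) = (L.sum : K) * MM L f := by
  induction L generalizing f with
  | nil => rw [MM, EE_c0]; simp
  | cons k L ih =>
    rw [MM_cons, gp_EE, map_add, ih, if_pos (Nat.zero_le _), MM_cons, map_smul, List.sum_cons]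
    simp; ring

def ev : List ℕ → K
  | [] => 0
  | k :: L => al * (k * (k - 1) / 2) - (L.sum : K) + ev L

lemma MM_D (L : List ℕ) (f : S K) (h : ∀ L', Up L L' → MM L' f = 0) : MM L (D al f) = ev al L * MM L f := by
  induction L generalizing f with
  | nil =>
    have : MvPolynomial.lcoeff K 0 (D al f) = 0 := by
      refine S_ind (MvPolynomial.lcoeff K 0 ∘ₗ D al) 0 ?_ ?_ f
      · simp [D_one]
      · intro n f h
        have hs : MvPolynomial.lcoeff K 0 (sn n : S K) = 0 := by
          rw [sn, map_sum]
          refine Finset.sum_eq_zero ?_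
          rintro ⟨i, j⟩ _
          rw [c0_mul, c0_pn, zero_mul]
        rw [LinearMap.comp_apply, D_pn, map_add, map_add, map_add, map_smul, map_smul, map_smul, c0_mul, c0_mul, c0_mul, c0_pn, hs, EE_c0]
        simp
    rw [ev, zero_mul]; exact this
  | cons k L ih =>
    rw [MM_cons, phi_gpD, ih, MM_EE0, MM_cons, ev]
    · ring
    · intro L' hL'; exact h _ (Up.there k L L' hL')
    · intro j hj; exact MM_pn j hj L _ fun L' hL' => h _ (Up.here k j L L' hj hL')
    · intro j hj; exact MM_EE j L _ fun L' hL' => h _ (Up.here k j L L' hj hL')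
end JK
end

noncomputable section
namespace JK
open Polynomial
variable {K : Type} [Field K] [CharZero K] (al : K)

def evG (N : ℕ) : S K →ₐ[K] MvPolynomial (Fin N) K :=
  MvPolynomial.aeval fun i : ℕ+ => ∑ j : Fin N, MvPolynomial.X j ^ (i : ℕ)
lemma evG_succ (N : ℕ) (f : S K) : MvPolynomial.finSuccEquiv K N (evG (N + 1) f) = Polynomial.map (evG N).toRingHom (Phi f) := by
  have : ((MvPolynomial.finSuccEquiv K N).toAlgHom.comp (evG (N + 1))) = (Polynomial.mapAlgHom (evG N)).comp (Phi : S K →ₐ[K] Y K) := by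
    apply MvPolynomial.algHom_ext
    intro i
    simp only [AlgHom.comp_apply, evG, Phi, MvPolynomial.aeval_X, AlgEquiv.toAlgHom_eq_coe, AlgHom.coe_coe, map_sum, map_pow, map_add]
    rw [Fin.sum_univ_succ]
    simp only [MvPolynomial.finSuccEquiv_X_zero, MvPolynomial.finSuccEquiv_X_succ, coe_mapAlgHom, Polynomial.map_C, Polynomial.map_X, map_pow, Polynomial.map_pow]
    simp [add_comm, MvPolynomial.aeval_X]
    refine congrArg₂ (· + ·) (congrArg (· ^ (i : ℕ)) (MvPolynomial.finSuccEquiv_X_zero)) (Finset.sum_congr rfl fun x _ => congrArg (· ^ (i : ℕ)) (MvPolynomial.finSuccEquiv_X_succ))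
  have h := DFunLike.congr_fun this f
  exact h
lemma MM_ev (N : ℕ) (a : Fin N → ℕ) (f : S K) :
    MvPolynomial.coeff (Finsupp.equivFunOnFinite.symm a) (evG N f) = MM (List.ofFn a) f := by
  induction N generalizing f with
  | zero =>
    rw [List.ofFn_zero]
    refine S_ind (MvPolynomial.lcoeff K _ ∘ₗ (evG 0).toLinearMap) (MM []) ?_ ?_ f
    · have : (Finsupp.equivFunOnFinite.symm a) = 0 := by ext i; exact i.elim0
      simp [MM, this]
    · intro n f h
      rw [MM, c0_mul, c0_pn, zero_mul, LinearMap.comp_apply, AlgHom.toLinearMap_apply, map_mul, pn_coe, evG, MvPolynomial.aeval_X]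
      simp
  | succ N ih =>
    have h1 : Finsupp.equivFunOnFinite.symm a = Finsupp.cons (a 0) (Finsupp.equivFunOnFinite.symm (fun i => a i.succ)) := by
      ext i
      refine Fin.cases ?_ ?_ i
      · simp
      · intro j; simp
    rw [h1, ← MvPolynomial.finSuccEquiv_coeff_coeff, evG_succ, Polynomial.coeff_map, List.ofFn_succ, MM_cons, ← ih]
    rfl
lemma MM_zeros (L : List ℕ) (n : ℕ) (f : S K) : MM (L ++ List.replicate n 0) f = MM L f := by
  rw [MM_perm List.perm_append_comm]
  induction n with
  | zero => rfl
  | succ n ih => rw [List.replicate_succ, List.cons_append, MM_zero, ih]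
lemma ofFn_getD (L : List ℕ) (N : ℕ) (h : L.length ≤ N) : List.ofFn (fun j : Fin N => L.getD (j : ℕ) 0) = L ++ List.replicate (N - L.length) 0 := by
  apply List.ext_getElem
  · simp; omega
  · intro i h1 h2
    rw [List.getElem_ofFn, List.getElem_append]
    split_ifs with h3
    · simp [h3]
    · simp at h3; simp [h3]

/-- weights -/
lemma coeff_EE0 (m : Exp) (f : S K) : MvPolynomial.coeff m (EE 0 f) = (wt m : K) * MvPolynomial.coeff m f := by
  have := S_ind (LinearMap.pi fun m : Exp => MvPolynomial.lcoeff K m ∘ₗ EE 0)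
    (LinearMap.pi fun m : Exp => (wt m : K) • MvPolynomial.lcoeff K m) ?_ ?_ f
  · exact congrFun this m
  · ext1 m
    simp only [LinearMap.pi_apply, LinearMap.comp_apply, LinearMap.smul_apply, EE_one, map_zero, MvPolynomial.lcoeff_apply, MvPolynomial.coeff_one]
    split_ifs with h
    · rw [← h]; simp [wt]
    · simp
  · intro n f h
    ext1 m
    have h' : ∀ m, MvPolynomial.coeff m (EE 0 f) = (wt m : K) * MvPolynomial.coeff m f := fun m => congrFun h m
    simp only [LinearMap.pi_apply, LinearMap.comp_apply, LinearMap.smul_apply, MvPolynomial.lcoeff_apply]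
    rw [EE_mul, EE_pn, add_zero, mul_smul_comm, pn_coe, MvPolynomial.coeff_add, MvPolynomial.coeff_smul, mul_comm f,
      MvPolynomial.coeff_X_mul', MvPolynomial.coeff_X_mul', h']
    split_ifs with h1
    · have h2 : m = (m - Finsupp.single n 1) + Finsupp.single n 1 := by
        rw [tsub_add_cancel_of_le]
        rw [Finsupp.single_le_iff]; rw [Finsupp.mem_support_iff] at h1; omega
      have h3 : wt m = wt (m - Finsupp.single n 1) + n := by
        conv_lhs => rw [h2]
        rw [wt, Finsupp.sum_add_index']
        · rw [Finsupp.sum_single_index] <;> simp [wt]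
        · simp
        · intros; ring
      rw [h3]; push_cast; simp only [smul_eq_mul]; ring
    · simp

lemma hom_coeff {c : K} {f : S K} (h : EE 0 f = c • f) (m : Exp) (hm : (wt m : K) ≠ c) : MvPolynomial.coeff m f = 0 := by
  have h1 := coeff_EE0 m f
  rw [h, MvPolynomial.coeff_smul, smul_eq_mul] at h1
  have : ((wt m : K) - c) * MvPolynomial.coeff m f = 0 := by rw [sub_mul, ← h1, sub_self]
  exact (mul_eq_zero.mp this).resolve_left (sub_ne_zero.mpr hm)
lemma gp_hom {c : K} {f : S K} (h : EE 0 f = c • f) (k : ℕ) : EE 0 (gp k f) = (c - k) • gp k f := by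
  have := gp_EE k 0 f
  rw [h, map_smul, if_pos (Nat.zero_le _), Nat.sub_zero] at this
  rw [sub_smul, this]; abel

def comp (c : ℕ) (f : S K) : S K := ∑ m ∈ f.support.filter (fun m => wt m = c), MvPolynomial.monomial m (MvPolynomial.coeff m f)
lemma comp_hom (c : ℕ) (f : S K) : EE 0 (comp c f) = (c : K) • comp c f := by
  ext m
  rw [coeff_EE0, MvPolynomial.coeff_smul, smul_eq_mul]
  by_cases h : wt m = c
  · rw [h]
  · have : MvPolynomial.coeff m (comp c f) = 0 := by
      rw [comp, MvPolynomial.coeff_sum]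
      refine Finset.sum_eq_zero fun m' hm' => ?_
      rw [MvPolynomial.coeff_monomial, if_neg]
      rintro rfl; exact h (Finset.mem_filter.mp hm').2
    rw [this]; simp
lemma comp_sum (f : S K) : f = ∑ c ∈ f.support.image wt, comp c f := by
  conv_lhs => rw [f.as_sum]
  exact (Finset.sum_fiberwise_of_maps_to (fun m hm => Finset.mem_image_of_mem _ hm) _).symm

/-- derivatives -/
def pdn (n : ℕ) : S K →ₗ[K] S K := if 0 < n then (MvPolynomial.pderiv (R := K) (Nat.toPNat' n)).toLinearMap else 0
lemma pdn_coe (n : ℕ+) (f : S K) : pdn n f = MvPolynomial.pderiv n f := by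
  rw [pdn, if_pos n.pos, PNat.coe_toPNat']; rfl
lemma pdn_mul (n : ℕ) (a b : S K) : pdn n (a * b) = a * pdn n b + b * pdn n a := by
  rw [pdn]; split_ifs with h
  · exact (MvPolynomial.pderiv (R := K) (Nat.toPNat' n)).leibniz a b
  · simp
lemma pdn_one (n : ℕ) : pdn n (1 : S K) = 0 := by
  rw [pdn]; split_ifs with h
  · exact (MvPolynomial.pderiv (R := K) (Nat.toPNat' n)).map_one_eq_zero
  · simp
lemma pdn_pn (n : ℕ) (m : ℕ+) : pdn n (pn m : S K) = if n = m then 1 else 0 := by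
  rcases Nat.eq_zero_or_pos n with h | h
  · subst h; rw [if_neg m.pos.ne, pdn]; simp
  · obtain ⟨i, rfl⟩ : ∃ i' : ℕ+, (i' : ℕ) = n := ⟨⟨n, h⟩, rfl⟩
    rw [pdn_coe, pn_coe, MvPolynomial.pderiv_X, Pi.single_apply]
    by_cases h : m = i
    · subst h; simp
    · rw [if_neg h, if_neg]; intro h2; exact h (PNat.coe_injective h2.symm)
lemma Dl0_coeff (n : ℕ) (f : S K) : (Dl0 f).coeff n = (n : K) • pdn n f := by
  refine S_ind (((Polynomial.lcoeff (S K) n).restrictScalars K) ∘ₗ Dl0) ((n : K) • pdn n) ?_ ?_ f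
  · simp [Dl0_one, pdn_one]
  · intro m f h
    simp only [LinearMap.comp_apply, LinearMap.restrictScalars_apply, lcoeff_apply, LinearMap.smul_apply] at h ⊢
    rw [Dl0_mul, coeff_add, coeff_C_mul, coeff_C_mul, h, Dl0_pn, coeff_smul, coeff_X_pow, pdn_mul, pdn_pn]
    split_ifs with h1
    · rw [h1]; simp
    · simp
lemma Dl_coeff (n : ℕ) (F : Y K) : (Dl F).coeff n = ∑ ij ∈ Finset.HasAntidiagonal.antidiagonal n, (ij.1 : K) • pdn ij.1 (F.coeff ij.2) := by
  refine Eq.trans (Y_mon (((Polynomial.lcoeff (S K) n).restrictScalars K) ∘ₗ Dl) (∑ ij ∈ Finset.HasAntidiagonal.antidiagonal n, (ij.1 : K) • pdn ij.1 ∘ₗ ((Polynomial.lcoeff (S K) ij.2).restrictScalars K)) ?_ F) ?_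
  · intro m a
    simp only [LinearMap.comp_apply, LinearMap.restrictScalars_apply, lcoeff_apply, LinearMap.smul_apply, LinearMap.sum_apply]
    rw [Dl_Xp, Dl_C, coeff_X_pow_mul', Dl0_coeff, mul_comm]
    simp only [coeff_C_mul_X_pow]
    split_ifs with h
    · rw [Finset.sum_eq_single (n - m, m)]
      · simp
      · rintro ⟨i, j⟩ h1 h2
        rw [Finset.HasAntidiagonal.mem_antidiagonal] at h1; simp only at h1 ⊢
        rw [if_neg, map_zero, smul_zero]
        rintro rfl; apply h2; congr 1; omega
      · intro h2; exfalso; apply h2; simp [h]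
    · symm; refine Finset.sum_eq_zero ?_
      rintro ⟨i, j⟩ h1
      rw [Finset.HasAntidiagonal.mem_antidiagonal] at h1; simp only at h1 ⊢
      rw [if_neg (by omega), map_zero, smul_zero]
  · simp [LinearMap.sum_apply]
lemma const_of_pdn (f : S K) (h : ∀ n, 0 < n → pdn n f = 0) : f = MvPolynomial.C (MvPolynomial.coeff 0 f) := by
  ext m
  rw [MvPolynomial.coeff_C]
  split_ifs with h1
  · rw [← h1]
  · obtain ⟨i, hi⟩ : ∃ i, m i ≠ 0 := by
      by_contra hc; push Not at hc; exact h1 (by ext i; simp [hc i])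
    have h2 := h i i.pos
    rw [pdn_coe] at h2
    have h3 := MvPolynomial.coeff_pderiv (i := i) f (m - Finsupp.single i 1)
    rw [h2, tsub_add_cancel_of_le (by rw [Finsupp.single_le_iff]; omega)] at h3
    simp only [MvPolynomial.coeff_zero] at h3
    exact (mul_eq_zero.mp h3.symm).resolve_right (Nat.cast_add_one_ne_zero _)
lemma pn_gp (n : ℕ) (f : S K) : (n : K) • gp n f = ∑ ij ∈ Finset.HasAntidiagonal.antidiagonal n, (ij.1 : K) • pdn ij.1 (gp ij.2 f) := by
  have h := congrArg (fun F => Polynomial.coeff F n) (Dl_Phi f)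
  simp only [Dl_coeff, th_coeff] at h
  exact h.symm

lemma MM_inj_hom (n : ℕ) (f : S K) (hf : EE 0 f = (n : K) • f) (h : ∀ L, MM L f = 0) : f = 0 := by
  induction n using Nat.strong_induction_on generalizing f with
  | _ n ih =>
    have hg : ∀ k, 0 < k → gp k f = 0 := by
      intro k hk
      have h1 := gp_hom hf k
      rcases le_or_gt k n with h2 | h2
      · exact ih (n - k) (by omega) _ (by rw [h1, Nat.cast_sub h2]) fun L => h (k :: L)
      · ext m
        rw [hom_coeff h1 m]; · simp
        · intro h3
          have : ((wt m + k : ℕ) : K) = (n : ℕ) := by push_cast; rw [h3]; ring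
          have := Nat.cast_injective this
          omega
    have h2 : Phi f = C f := by
      ext1 k
      rw [coeff_C]; split_ifs with h3
      · subst h3; exact gp_zero f
      · exact hg k (Nat.pos_of_ne_zero h3)
    have h3 := Dl_Phi f
    rw [h2, th_C, Dl_C] at h3
    have h4 := const_of_pdn f (by
      intro n hn
      have := Dl0_coeff n f
      rw [h3, coeff_zero] at this
      exact (smul_eq_zero.mp this.symm).resolve_left (by exact_mod_cast hn.ne'))
    rw [h4]
    have : MvPolynomial.coeff 0 f = 0 := h []
    rw [this, MvPolynomial.C_0]
lemma MM_hom {c : K} {f : S K} (hf : EE 0 f = c • f) (L : List ℕ) (h : (L.sum : K) ≠ c) : MM L f = 0 := by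
  have := MM_EE0 L f
  rw [hf, map_smul, smul_eq_mul] at this
  have : (c - L.sum) * MM L f = 0 := by rw [sub_mul, this, sub_self]
  exact (mul_eq_zero.mp this).resolve_left (sub_ne_zero.mpr (Ne.symm h))
lemma MM_inj (f : S K) (h : ∀ L, MM L f = 0) : f = 0 := by
  rw [comp_sum f]
  refine Finset.sum_eq_zero fun c hc => ?_
  refine MM_inj_hom c _ (comp_hom c f) fun L => ?_
  by_cases hL : L.sum = c
  · have h1 := h L
    rw [comp_sum f, map_sum, Finset.sum_eq_single c] at h1
    · exact h1
    · intro c' _ hc'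
      exact MM_hom (comp_hom c' f) L (by rw [hL]; exact_mod_cast hc'.symm)
    · intro h2; exact absurd hc h2
  · exact MM_hom (comp_hom c f) L (by exact_mod_cast hL)
lemma hom_of_MM (f : S K) (n : ℕ) (h : ∀ L, L.sum ≠ n → MM L f = 0) : EE 0 f = (n : K) • f := by
  rw [← sub_eq_zero]
  refine MM_inj _ fun L => ?_
  rw [map_sub, MM_EE0, map_smul, smul_eq_mul]
  by_cases hL : L.sum = n
  · rw [hL, sub_self]
  · rw [h L hL]; simp
end JK
end

noncomputable section
namespace JK
open Polynomial
variable {K : Type} [Field K] [CharZero K] (al : K)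

def zz (m : Exp) : K := (m.prod fun i k => (Nat.factorial k : K) * ((i : ℕ) : K) ^ k) * al ^ (m.sum fun _ k => k)

lemma zz_add (m : Exp) (i : ℕ+) : zz al (m + Finsupp.single i 1) = al * (i : ℕ) * ((m i : K) + 1) * zz al m := by
  unfold zz
  rw [Finsupp.sum_add_index' (by simp) (by simp), pow_add, Finsupp.sum_single_index rfl]
  have h1 : (m + Finsupp.single i 1).support ⊆ insert i m.support := by
    intro j; simp only [Finsupp.mem_support_iff, Finset.mem_insert, Finsupp.add_apply]
    by_cases h : j = i
    · simp [h]
    · rw [Finsupp.single_eq_of_ne h]; simp; tauto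
  rw [Finsupp.prod_of_support_subset _ h1 _ (by simp), Finsupp.prod_of_support_subset m (Finset.subset_insert i _) _ (by simp)]
  rw [← Finset.mul_prod_erase _ _ (Finset.mem_insert_self i _), ← Finset.mul_prod_erase _ _ (Finset.mem_insert_self i m.support)]
  rw [Finset.prod_congr (g := fun j => ((Nat.factorial (m j) : K) * ((j : ℕ) : K) ^ (m j))) rfl]
  · simp only [Finsupp.add_apply, Finsupp.single_eq_same, Nat.factorial_succ, Nat.cast_mul]
    push_cast; ring
  · intro j hj
    rw [Finsupp.add_apply, Finsupp.single_eq_of_ne (Finset.ne_of_mem_erase hj)]; rfl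

lemma zz_ne (hal : al ≠ 0) (m : Exp) : zz al m ≠ 0 := by
  unfold zz
  refine mul_ne_zero ?_ (pow_ne_zero _ hal)
  refine Finset.prod_ne_zero_iff.mpr fun i _ => mul_ne_zero (by exact_mod_cast Nat.factorial_ne_zero _) (pow_ne_zero _ ?_)
  exact_mod_cast i.pos.ne'

def HB : S K →ₗ[K] S K →ₗ[K] K := (MvPolynomial.basisMonomials ℕ+ K).constr K fun m => zz al m • MvPolynomial.lcoeff K m
lemma HB_mon (m : Exp) (c : K) (h : S K) : HB al (MvPolynomial.monomial m c) h = c * zz al m * MvPolynomial.coeff m h := by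
  have h1 : (MvPolynomial.monomial m c : S K) = c • MvPolynomial.basisMonomials ℕ+ K m := by
    rw [MvPolynomial.coe_basisMonomials, MvPolynomial.smul_monomial, smul_eq_mul, mul_one]
  rw [h1, map_smul, HB, Module.Basis.constr_basis]
  simp [MvPolynomial.lcoeff_apply]; ring
lemma HB_sum (f h : S K) (s : Finset Exp) (hs : f.support ⊆ s) : HB al f h = ∑ m ∈ s, MvPolynomial.coeff m f * MvPolynomial.coeff m h * zz al m := by
  conv_lhs => rw [MvPolynomial.as_sum f]
  rw [map_sum, LinearMap.sum_apply]
  rw [Finset.sum_subset hs]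
  · refine Finset.sum_congr rfl fun m _ => ?_
    rw [HB_mon]; ring
  · intro m _ hm
    rw [HB_mon, MvPolynomial.notMem_support_iff.mp hm]; ring
lemma HB_symm (f h : S K) : HB al f h = HB al h f := by
  rw [HB_sum al f h (f.support ∪ h.support) Finset.subset_union_left, HB_sum al h f (f.support ∪ h.support) Finset.subset_union_right]
  exact Finset.sum_congr rfl fun m _ => by ring
lemma HB_nd (hal : al ≠ 0) (f : S K) (h : ∀ g, HB al f g = 0) : f = 0 := by
  ext m
  have := h (MvPolynomial.monomial m 1)
  rw [HB_symm, HB_mon] at this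
  simpa [zz_ne al hal] using this
lemma HB_pn (n : ℕ) (f h : S K) : HB al (pn n * f) h = al * n * HB al f (pdn n h) := by
  rcases Nat.eq_zero_or_pos n with h0 | h0
  · subst h0; simp [pn_zero]
  obtain ⟨i, rfl⟩ : ∃ i : ℕ+, (i : ℕ) = n := ⟨⟨n, h0⟩, rfl⟩
  rw [pn_coe, pdn_coe]
  have : (HB al).flip h ∘ₗ LinearMap.mulLeft K (MvPolynomial.X i) = (al * (i : ℕ)) • (HB al).flip (MvPolynomial.pderiv i h) := by
    refine (MvPolynomial.basisMonomials ℕ+ K).ext fun m => ?_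
    rw [MvPolynomial.coe_basisMonomials]
    simp only [LinearMap.comp_apply, LinearMap.flip_apply, LinearMap.mulLeft_apply, LinearMap.smul_apply, smul_eq_mul]
    rw [MvPolynomial.X, MvPolynomial.monomial_mul, HB_mon, HB_mon, add_comm, zz_add, MvPolynomial.coeff_pderiv]; ring
  exact LinearMap.congr_fun this f

def HY : Y K →ₗ[K] Y K →ₗ[K] K := mk fun m => (LinearMap.lcomp K K ((Polynomial.lcoeff (S K) m).restrictScalars K)) ∘ₗ HB al
lemma HY_XC (m : ℕ) (a : S K) (G : Y K) : HY al (X ^ m * C a) G = HB al a (G.coeff m) := by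
  rw [HY, mk_XC]; rfl
lemma coeff_XC (m n : ℕ) (a : S K) : (X ^ m * C a : Y K).coeff n = if m = n then a else 0 := by
  rw [mul_comm, coeff_C_mul_X_pow]; simp only [eq_comm]
lemma Y_mon2 {V : Type*} [AddCommGroup V] [Module K V] (L L' : Y K →ₗ[K] V)
    (h : ∀ m a, L (X ^ m * C a) = L' (X ^ m * C a)) (f : Y K) : L f = L' f := by
  rw [as_sum f, map_sum, map_sum]; exact Finset.sum_congr rfl fun m _ => h _ _
lemma HY_symm (F G : Y K) : HY al F G = HY al G F := by
  refine Y_mon2 ((HY al).flip G) (HY al G) (fun m a => ?_) F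
  rw [LinearMap.flip_apply]
  refine Y_mon2 (HY al (X ^ m * C a)) ((HY al).flip (X ^ m * C a)) (fun n b => ?_) G
  rw [LinearMap.flip_apply, HY_XC, HY_XC, coeff_XC, coeff_XC]
  by_cases h : m = n
  · rw [if_pos h, if_pos h.symm, HB_symm]
  · rw [if_neg h, if_neg (Ne.symm h), map_zero, map_zero]
lemma HB_Th0 (F : Y K) (h : S K) : HB al (Th0 F) h = al * HY al F (Dl0 h) := by
  refine Y_mon2 ((HB al).flip h ∘ₗ Th0) (al • (HY al).flip (Dl0 h)) (fun m a => ?_) F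
  simp only [LinearMap.comp_apply, LinearMap.flip_apply, LinearMap.smul_apply, smul_eq_mul]
  rw [Th0_XC, HB_pn, HY_XC, Dl0_coeff, map_smul, smul_eq_mul]; ring
lemma HY_TT (F G : Y K) : HY al (TT F) G = al * HY al F (Dl G) := by
  refine Y_mon2 ((HY al).flip G ∘ₗ TT) (al • (HY al).flip (Dl G)) (fun m a => ?_) F
  simp only [LinearMap.comp_apply, LinearMap.flip_apply, LinearMap.smul_apply, smul_eq_mul]
  rw [TT_XC, HY_XC, Dl_coeff, Tc, Finset.sum_mul, map_sum, LinearMap.sum_apply, map_sum, Finset.mul_sum]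
  refine Finset.sum_congr rfl fun ij _ => ?_
  rw [show (C (pn ij.1) * X ^ ij.2 * C a : Y K) = X ^ ij.2 * C (pn ij.1 * a) by rw [C_mul]; ring, HY_XC, HB_pn, map_smul, smul_eq_mul]; ring
lemma HY_th (F G : Y K) : HY al (th F) G = HY al F (th G) := by
  refine Y_mon2 ((HY al).flip G ∘ₗ th) ((HY al).flip (th G)) (fun m a => ?_) F
  simp only [LinearMap.comp_apply, LinearMap.flip_apply]
  rw [th_XC, map_smul, LinearMap.smul_apply, HY_XC, HY_XC, th_coeff, map_smul]
lemma D_adj (f h : S K) : HB al (D al f) h = HB al f (D al h) := by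
  have key : ∀ f h : S K, HB al (D al f) h = (2⁻¹ * al) * ((al - 1) * HY al (th (Dl0 f)) (Dl0 h) + al * HY al (Dl (Dl0 f)) (Dl0 h) + HY al (TT (Dl0 f)) (Dl0 h) - (al - 1) * HY al (Dl0 f) (Dl0 h)) := by
    intro f h
    rw [D_apply, map_smul, LinearMap.smul_apply, HB_Th0]
    simp only [map_add, map_sub, map_smul, LinearMap.add_apply, LinearMap.sub_apply, LinearMap.smul_apply, smul_eq_mul]; ring
  rw [key, HB_symm al f, key]
  rw [HY_th, HY_symm al (Dl0 f) (th _), HY_symm al (Dl (Dl0 f)), ← HY_TT, HY_TT al (Dl0 f) (Dl0 h), HY_symm al (Dl0 f) (Dl (Dl0 h)), HY_symm al (Dl0 f) (Dl0 h)]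
  ring

lemma gp_pdn (k n : ℕ) (f : S K) : gp k (pdn n f) = pdn n (gp k f) := by
  have := S_ind (LinearMap.pi fun k => gp k ∘ₗ pdn n) (LinearMap.pi fun k => (pdn n ∘ₗ gp k : S K →ₗ[K] S K)) ?_ ?_ f
  · exact congrFun this k
  · funext k; simp only [LinearMap.pi_apply, LinearMap.comp_apply]
    rw [pdn_one, gp_one, map_zero]; split_ifs <;> simp [pdn_one]
  · intro m f ih; funext k
    have ih' := fun k => congrFun ih k
    simp only [LinearMap.pi_apply, LinearMap.comp_apply] at ih' ⊢
    rw [pdn_mul, pdn_pn, map_add, gp_pn, gp_pn, map_add, pdn_mul, pdn_pn, ih']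
    have h1 : gp k (f * if n = (m : ℕ) then (1 : S K) else 0) = gp k f * if n = (m : ℕ) then (1 : S K) else 0 := by
      split_ifs <;> simp
    rw [h1]
    split_ifs with h h2 <;> simp only [ih', map_zero] <;> ring

def Em1 : S K →ₗ[K] S K := (MvPolynomial.mkDerivation K fun i : ℕ+ => ((i : ℕ) : K) • (pn ((i : ℕ) - 1) : S K)).toLinearMap
lemma Em1_mul (a b : S K) : Em1 (a * b) = a * Em1 b + b * Em1 a := by
  simp [Em1, Derivation.leibniz]
lemma Em1_one : Em1 (1 : S K) = 0 := by
  rw [Em1]; exact Derivation.map_one_eq_zero _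
lemma Em1_pn (m : ℕ) : Em1 (pn m : S K) = (m : K) • pn (m - 1) := by
  rcases Nat.eq_zero_or_pos m with h0 | h0
  · subst h0; simp [pn_zero]
  obtain ⟨i, rfl⟩ : ∃ i : ℕ+, (i : ℕ) = m := ⟨⟨m, h0⟩, rfl⟩
  rw [pn_coe, Em1]; simp [MvPolynomial.mkDerivation_X]
lemma pdn1_pn (m : ℕ) : pdn 1 (pn m : S K) = if m = 1 then 1 else 0 := by
  rcases Nat.eq_zero_or_pos m with h0 | h0
  · subst h0; simp [pn_zero]
  obtain ⟨i, rfl⟩ : ∃ i : ℕ+, (i : ℕ) = m := ⟨⟨m, h0⟩, rfl⟩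
  rw [pdn_pn]; simp only [eq_comm]
lemma pdn_EE (n : ℕ) (hn : 1 ≤ n) (f : S K) : pdn 1 (EE n f) = EE n (pdn 1 f) := by
  refine S_ind (pdn 1 ∘ₗ EE n) (EE n ∘ₗ pdn 1) ?_ ?_ f
  · simp [EE_one, pdn_one]
  · intro m f ih
    simp only [LinearMap.comp_apply] at ih ⊢
    have hm := m.pos
    rw [EE_mul, EE_pn, map_add, pdn_mul, pdn_mul, map_smul, pdn1_pn, pdn1_pn, pdn_mul, pdn1_pn, ih, map_add, EE_mul, EE_pn, if_neg (show ¬ ((m : ℕ) + n = 1) by omega)]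
    split_ifs <;> simp [EE_one] <;> ring
lemma pdn_sn (n : ℕ) (hn : 1 ≤ n) : pdn 1 (sn n : S K) = (2 : K) • pn (n - 1) := by
  rw [sn, map_sum, two_smul]
  simp only [pdn_mul, pdn1_pn, Finset.sum_add_distrib]
  have h1 : ∑ x ∈ Finset.HasAntidiagonal.antidiagonal n, (pn x.2 * if x.1 = 1 then 1 else 0 : S K) = pn (n - 1) := by
    rw [Finset.sum_eq_single (1, n - 1)]
    · simp
    · rintro ⟨i, j⟩ h1 h2
      rw [Finset.HasAntidiagonal.mem_antidiagonal] at h1; simp only at h1 ⊢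
      rw [if_neg, mul_zero]; rintro rfl; apply h2; congr 1; omega
    · intro h; exfalso; apply h; simp; omega
  rw [h1, ← Finset.Nat.sum_antidiagonal_swap]; simp only [Prod.fst_swap, Prod.snd_swap]; rw [h1]
lemma pdn_D (f : S K) : pdn 1 (D al f) = D al (pdn 1 f) + Em1 f := by
  refine S_ind (pdn 1 ∘ₗ D al) (D al ∘ₗ pdn 1 + Em1) ?_ ?_ f
  · simp [D_one, pdn_one, Em1_one]
  · intro m f ih
    simp only [LinearMap.comp_apply, LinearMap.add_apply] at ih ⊢
    have hm := m.pos
    rw [D_pn]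
    simp only [map_add, map_smul, pdn_mul, pdn_pn, D_pn, pdn_EE m hm, pdn_sn m hm, Em1_mul, Em1_pn, ih]
    by_cases h : 1 = (m : ℕ)
    · rw [← h]; simp [pn_zero]
      simp only [Algebra.smul_def, map_add, map_mul, map_natCast, map_one, map_sub, map_div₀]; ring
    · simp only [if_neg h, mul_zero, add_zero, map_zero]
      simp only [mul_smul_comm, smul_smul, smul_add, mul_add]
      rw [mul_comm f (pn _)]
      module
end JK
end

noncomputable section
namespace JK
open Polynomial
variable {K : Type} [Field K] [CharZero K] (al : K)

section W
variable {R : Type*} [CommRing R] [Algebra K R]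
def W (K : Type) [Field K] [Algebra K R] (c : ℕ → R) (x : R) : ℕ → R
  | 0 => 1
  | n + 1 => ((n + 1 : K)⁻¹) • ∑ i : Fin (n + 1), x * c (i + 1) * W K c x (n - i)
lemma W_zero (c : ℕ → R) (x : R) : W K c x 0 = 1 := by rw [W]
lemma W_rec (c : ℕ → R) (x : R) (n : ℕ) : ((n : K) + 1) • W K c x (n + 1) = ∑ ij ∈ Finset.HasAntidiagonal.antidiagonal n, x * c (ij.1 + 1) * W K c x ij.2 := by
  rw [W, smul_smul, mul_inv_cancel₀ (Nat.cast_add_one_ne_zero n), one_smul, Finset.Nat.sum_antidiagonal_eq_sum_range_succ_mk, Finset.sum_range]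
lemma W_rec' (c : ℕ → R) (hc : c 0 = 0) (x : R) (n : ℕ) : (n : K) • W K c x n = ∑ ij ∈ Finset.HasAntidiagonal.antidiagonal n, x * c ij.1 * W K c x ij.2 := by
  cases n with
  | zero => simp [hc]
  | succ n => rw [Finset.Nat.sum_antidiagonal_succ]; simp only [hc]; push_cast; rw [W_rec]; ring
lemma W_uniq (c : ℕ → R) (x : R) (A : ℕ → R) (h0 : A 0 = 1) (h : ∀ n : ℕ, ((n : K) + 1) • A (n + 1) = ∑ ij ∈ Finset.HasAntidiagonal.antidiagonal n, x * c (ij.1 + 1) * A ij.2) (n : ℕ) : A n = W K c x n := by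
  induction n using Nat.strong_induction_on with
  | _ n ih =>
    cases n with
    | zero => rw [h0, W_zero]
    | succ n =>
      have h1 : ((n : K) + 1) • A (n + 1) = ((n : K) + 1) • W K c x (n + 1) := by
        rw [h, W_rec]
        refine Finset.sum_congr rfl fun ij hij => ?_
        rw [Finset.HasAntidiagonal.mem_antidiagonal] at hij
        rw [ih _ (by omega)]
      have h2 := congrArg (fun z => ((n : K) + 1)⁻¹ • z) h1
      simpa [smul_smul, inv_mul_cancel₀ (Nat.cast_add_one_ne_zero (R := K) n)] using h2
lemma W_map {R' : Type*} [CommRing R'] [Algebra K R'] (φ : R →ₐ[K] R') (c : ℕ → R) (x : R) (n : ℕ) : φ (W K c x n) = W K (fun i => φ (c i)) (φ x) n := by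
  refine W_uniq _ _ (fun n => φ (W K c x n)) (by simp [W_zero]) (fun n => ?_) n
  rw [← map_smul, W_rec, map_sum]; simp
def Wp (K : Type) [Field K] [Algebra K R] (c : ℕ → R) (x : R) : PowerSeries R := PowerSeries.mk (W K c x)
lemma Wp_der (c : ℕ → R) (x : R) : PowerSeries.derivative R (Wp K c x) = PowerSeries.C x * PowerSeries.mk (fun i => c (i + 1)) * Wp K c x := by
  ext n
  rw [PowerSeries.coeff_derivative, PowerSeries.coeff_mul]
  simp only [Wp, PowerSeries.coeff_mk, PowerSeries.coeff_C_mul]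
  rw [← W_rec]
  simp only [Algebra.smul_def, map_add, map_natCast, map_one]; ring
lemma W_add (c : ℕ → R) (x y : R) (n : ℕ) : W K c (x + y) n = ∑ ij ∈ Finset.HasAntidiagonal.antidiagonal n, W K c x ij.1 * W K c y ij.2 := by
  symm
  have hh : ∀ n, ∑ ij ∈ Finset.HasAntidiagonal.antidiagonal n, W K c x ij.1 * W K c y ij.2 = PowerSeries.coeff n (Wp K c x * Wp K c y) := by
    intro n; rw [PowerSeries.coeff_mul]; simp [Wp]
  rw [hh]
  refine W_uniq c (x + y) (fun n => PowerSeries.coeff n (Wp K c x * Wp K c y)) ?_ (fun n => ?_) n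
  · simp [Wp, W_zero]
  · have h1 : PowerSeries.derivative R (Wp K c x * Wp K c y) = PowerSeries.C (x + y) * PowerSeries.mk (fun i => c (i + 1)) * (Wp K c x * Wp K c y) := by
      rw [Derivation.leibniz, Wp_der, Wp_der, map_add, smul_eq_mul, smul_eq_mul]; ring
    have h2 := congrArg (PowerSeries.coeff n) h1
    rw [PowerSeries.coeff_derivative, PowerSeries.coeff_mul n (PowerSeries.C (x + y) * PowerSeries.mk (fun i => c (i + 1)))] at h2
    simp only [PowerSeries.coeff_mk, PowerSeries.coeff_C_mul] at h2
    rw [← h2]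
    simp only [Algebra.smul_def, map_add, map_natCast, map_one]; ring
end W

def cc (n : ℕ) : S K := ((-1) ^ n * al⁻¹) • pn n
lemma cc_zero : cc al 0 = 0 := by simp [cc, pn_zero]
def Gh (n : ℕ) : S K := W K (cc al) 1 n
lemma Gh_zero : Gh al 0 = 1 := W_zero _ _
lemma Gh_rec (n : ℕ) : (n : K) • Gh al n = ∑ ij ∈ Finset.HasAntidiagonal.antidiagonal n, cc al ij.1 * Gh al ij.2 := by
  have := W_rec' (K := K) (cc al) (cc_zero al) 1 n
  simpa [Gh] using this

lemma Gh_adj (hal : al ≠ 0) (n : ℕ) (f h : S K) : HB al (Gh al n * f) h = (-1) ^ n * HB al f (gp n h) := by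
  induction n using Nat.strong_induction_on generalizing f h with
  | _ n ih =>
    rcases Nat.eq_zero_or_pos n with h0 | h0
    · subst h0; rw [Gh_zero, gp_zero]; simp
    · have hn : (n : K) ≠ 0 := by exact_mod_cast h0.ne'
      apply mul_left_cancel₀ hn
      rw [← smul_eq_mul, ← LinearMap.smul_apply, ← map_smul, ← smul_mul_assoc, Gh_rec, Finset.sum_mul, map_sum, LinearMap.sum_apply]
      rw [mul_left_comm, ← smul_eq_mul (n : K), ← map_smul, pn_gp, map_sum, Finset.mul_sum]
      refine Finset.sum_congr rfl fun ij hij => ?_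
      rw [Finset.HasAntidiagonal.mem_antidiagonal] at hij
      rcases Nat.eq_zero_or_pos ij.1 with h1 | h1
      · simp [h1, cc_zero]
      · rw [cc, smul_mul_assoc, smul_mul_assoc, map_smul, LinearMap.smul_apply, mul_assoc, HB_pn, ih _ (by omega), map_smul, ← hij, gp_pdn, pow_add, smul_eq_mul, smul_eq_mul]
        field_simp

lemma pdn_Gh (n : ℕ) : pdn 1 (Gh al (n + 1)) = -(al⁻¹ • Gh al n) := by
  induction n using Nat.strong_induction_on with
  | _ n ih =>
    have hn : ((n + 1 : ℕ) : K) ≠ 0 := by exact_mod_cast (Nat.succ_ne_zero n)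
    have h1 : ((n + 1 : ℕ) : K) • pdn 1 (Gh al (n + 1)) = ((n + 1 : ℕ) : K) • (-(al⁻¹ • Gh al n)) := by
      rw [← map_smul, Gh_rec, map_sum]
      simp only [pdn_mul, Finset.sum_add_distrib]
      have h2 : ∑ ij ∈ Finset.HasAntidiagonal.antidiagonal (n + 1), Gh al ij.2 * pdn 1 (cc al ij.1) = -(al⁻¹ • Gh al n) := by
        rw [Finset.sum_eq_single (1, n)]
        · rw [cc, map_smul, pdn1_pn, if_pos rfl]; simp
        · rintro ⟨i, j⟩ h3 h4
          rw [Finset.HasAntidiagonal.mem_antidiagonal] at h3; simp only at h3 ⊢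
          rw [cc, map_smul, pdn1_pn, if_neg]; · simp
          rintro rfl; apply h4; congr 1; omega
        · intro h; exfalso; apply h; simp; omega
      have h3 : ∑ ij ∈ Finset.HasAntidiagonal.antidiagonal (n + 1), cc al ij.1 * pdn 1 (Gh al ij.2) = -(al⁻¹ • ((n : K) • Gh al n)) := by
        rw [Finset.Nat.sum_antidiagonal_succ', Gh_rec, Finset.smul_sum, ← Finset.sum_neg_distrib]
        simp only [Gh_zero, pdn_one, mul_zero, zero_add, add_zero]
        refine Finset.sum_congr rfl fun ij hij => ?_
        rw [Finset.HasAntidiagonal.mem_antidiagonal] at hij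
        rcases Nat.eq_zero_or_pos ij.1 with h1 | h1
        · simp [h1, cc_zero]
        · rw [ih _ (by omega), mul_neg, mul_smul_comm]
      rw [h2, h3]; push_cast; module
    exact smul_right_injective _ hn h1

lemma Em1_cc (n : ℕ) : Em1 (cc al (n + 1)) = -(((n : K) + 1) • cc al n) := by
  rw [cc, cc, map_smul, Em1_pn, Nat.add_sub_cancel]; push_cast; rw [smul_smul, smul_smul, ← neg_smul]; congr 1; ring
lemma Em1_Gh (n : ℕ) : Em1 (Gh al (n + 1)) = -((n : K) • Gh al n) := by
  induction n using Nat.strong_induction_on with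
  | _ n ih =>
    have hn : ((n + 1 : ℕ) : K) ≠ 0 := by exact_mod_cast (Nat.succ_ne_zero n)
    have h1 : ((n + 1 : ℕ) : K) • Em1 (Gh al (n + 1)) = ((n + 1 : ℕ) : K) • (-((n : K) • Gh al n)) := by
      rw [← map_smul, Gh_rec, map_sum]
      simp only [Em1_mul, Finset.sum_add_distrib]
      have h2 : ∑ ij ∈ Finset.HasAntidiagonal.antidiagonal (n + 1), Gh al ij.2 * Em1 (cc al ij.1) = ∑ ij ∈ Finset.HasAntidiagonal.antidiagonal n, -(((ij.1 : K) + 1) • (cc al ij.1 * Gh al ij.2)) := by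
        rw [Finset.Nat.sum_antidiagonal_succ]
        simp only [cc_zero, map_zero, mul_zero, zero_add]
        refine Finset.sum_congr rfl fun ij hij => ?_
        rw [Em1_cc, mul_neg, mul_smul_comm, mul_comm]
      have h3 : ∑ ij ∈ Finset.HasAntidiagonal.antidiagonal (n + 1), cc al ij.1 * Em1 (Gh al ij.2) = ∑ ij ∈ Finset.HasAntidiagonal.antidiagonal n, -((ij.2 : K) • (cc al ij.1 * Gh al ij.2)) := by
        rw [Finset.Nat.sum_antidiagonal_succ']
        simp only [Gh_zero, Em1_one, mul_zero, zero_add, add_zero]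
        refine Finset.sum_congr rfl fun ij hij => ?_
        rw [Finset.HasAntidiagonal.mem_antidiagonal] at hij
        rcases Nat.eq_zero_or_pos ij.1 with h1 | h1
        · simp [h1, cc_zero]
        · rw [ih _ (by omega), mul_neg, mul_smul_comm]
      rw [h2, h3, smul_neg, Gh_rec, Finset.smul_sum, ← Finset.sum_neg_distrib, ← Finset.sum_add_distrib]
      refine Finset.sum_congr rfl fun ij hij => ?_
      rw [Finset.HasAntidiagonal.mem_antidiagonal] at hij
      rw [← hij]; push_cast; module
    exact smul_right_injective _ hn h1
end JK
end

noncomputable section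
namespace JK
open Polynomial
variable {K : Type} [Field K] [CharZero K] (al : K)

def nn : List ℕ → ℕ
  | [] => 0
  | _ :: L => L.sum + nn L
def nb : List ℕ → ℕ
  | [] => 0
  | k :: L => k.choose 2 + nb L
lemma ev_eq (L : List ℕ) : ev al L = al * (nb L : K) - (nn L : K) := by
  induction L with
  | nil => simp [ev, nb, nn]
  | cons k L ih =>
    rw [ev, nb, nn, ih]; push_cast; rw [Nat.cast_choose_two]; ring

lemma nn_ins (k : ℕ) (L : List ℕ) : nn (L.orderedInsert (· ≥ ·) k) ≤ L.sum + nn L ∧ (L.orderedInsert (· ≥ ·) k).sum = k + L.sum := by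
  induction L with
  | nil => simp [nn]
  | cons l L ih =>
    rw [List.orderedInsert_cons]
    split_ifs with h
    · simp [nn]
    · have : k < l := by simpa using h
      simp only [nn, List.sum_cons, ih.2]
      constructor
      · have := ih.1; omega
      · omega
lemma nn_sort (L : List ℕ) : nn (L.insertionSort (· ≥ ·)) ≤ nn L ∧ (L.insertionSort (· ≥ ·)).sum = L.sum := by
  induction L with
  | nil => simp [nn]
  | cons k L ih =>
    have h := nn_ins k (L.insertionSort (· ≥ ·))
    rw [List.insertionSort_cons, nn, List.sum_cons]
    rw [ih.2] at h
    exact ⟨by have := h.1; have := ih.1; omega, h.2⟩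
lemma nn_filter (L : List ℕ) : nn (L.filter (0 < ·)) ≤ nn L ∧ (L.filter (0 < ·)).sum = L.sum := by
  induction L with
  | nil => simp [nn]
  | cons k L ih =>
    rw [List.filter_cons]
    split_ifs with h
    · rw [nn, nn, List.sum_cons, List.sum_cons, ih.2]; exact ⟨by have := ih.1; omega, rfl⟩
    · have : k = 0 := by simpa using h
      rw [nn, List.sum_cons, ih.2]; exact ⟨by have := ih.1; omega, by omega⟩
lemma MM_filter (L : List ℕ) (f : S K) : MM (L.filter (0 < ·)) f = MM L f := by
  induction L generalizing f with
  | nil => rfl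
  | cons k L ih =>
    rw [List.filter_cons]
    split_ifs with h
    · rw [MM_cons, MM_cons, ih]
    · have : k = 0 := by simpa using h
      rw [this, MM_zero, ih]

def IsP (L : List ℕ) : Prop := L.Pairwise (· ≥ ·) ∧ ∀ x ∈ L, 0 < x
abbrev Pt := {L : List ℕ // IsP L}
def nrm (L : List ℕ) : Pt := ⟨(L.filter (0 < ·)).insertionSort (· ≥ ·), by
  constructor
  · exact List.pairwise_insertionSort _ _
  · intro x hx
    have := (List.perm_insertionSort (· ≥ ·) (L.filter (0 < ·))).mem_iff.mp hx
    simpa using (List.mem_filter.mp this).2⟩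
lemma nrm_nn (L : List ℕ) : nn (nrm L).1 ≤ nn L := (nn_sort _).1.trans (nn_filter L).1
lemma nrm_sum (L : List ℕ) : (nrm L).1.sum = L.sum := (nn_sort _).2.trans (nn_filter L).2
lemma nrm_mem (L : List ℕ) (k : ℕ) (hk : 0 < k) (h : k ∈ L) : k ∈ (nrm L).1 := by
  refine (List.perm_insertionSort (· ≥ ·) (L.filter (0 < ·))).mem_iff.mpr (List.mem_filter.mpr ⟨h, by simpa using hk⟩)
lemma nrm_MM (L : List ℕ) (f : S K) : MM (nrm L).1 f = MM L f := by
  rw [← MM_filter L f]; exact MM_perm (List.perm_insertionSort _ _) f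

lemma Dec_nn {j : ℕ} {L L' : List ℕ} (h : Dec j L L') : L.sum = L'.sum + j ∧ nn L' ≤ nn L := by
  induction h with
  | here k L h => simp only [List.sum_cons, nn]; constructor <;> omega
  | there k L L' _ ih => simp only [List.sum_cons, nn]; constructor <;> omega
lemma Up_nn {L L' : List ℕ} (h : Up L L') : L'.sum = L.sum ∧ nn L' < nn L := by
  induction h with
  | here k j L L' h h' => have := Dec_nn h'; simp only [List.sum_cons, nn]; constructor <;> omega
  | there k L L' _ ih => simp only [List.sum_cons, nn]; constructor <;> omega

def hd (L : List ℕ) : ℕ := L.headD 0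
lemma IsP_cons {k : ℕ} {L : List ℕ} : IsP (k :: L) ↔ 0 < k ∧ hd L ≤ k ∧ IsP L := by
  unfold IsP hd
  constructor
  · rintro ⟨h1, h2⟩
    rw [List.pairwise_cons] at h1
    refine ⟨h2 k (by simp), ?_, h1.2, fun x hx => h2 x (by simp [hx])⟩
    cases L with
    | nil => simp
    | cons l L => exact h1.1 l (by simp)
  · rintro ⟨h1, h2, h3, h4⟩
    refine ⟨?_, ?_⟩
    · rw [List.pairwise_cons]
      refine ⟨fun x hx => ?_, h3⟩
      cases L with
      | nil => simp at hx
      | cons l L =>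
        rcases List.mem_cons.mp hx with h | h
        · subst h; exact h2
        · exact le_trans ((List.pairwise_cons.mp h3).1 x h) h2
    · intro x hx
      rcases List.mem_cons.mp hx with h | h
      · subst h; exact h1
      · exact h4 x h
lemma mem_le_hd {L : List ℕ} (h : IsP L) {x : ℕ} (hx : x ∈ L) : x ≤ hd L := by
  cases L with
  | nil => simp at hx
  | cons l L =>
    rcases List.mem_cons.mp hx with h1 | h1
    · subst h1; exact le_rfl
    · exact (List.pairwise_cons.mp h.1).1 x h1
lemma IsP_nil : IsP [] := ⟨by simp, by simp⟩
lemma Pfin (n : ℕ) : {L : Pt | L.1.sum = n}.Finite := by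
  refine Set.Finite.subset (Set.finite_range (fun p : Nat.Partition n => nrm p.parts.toList)) ?_
  rintro ⟨L, hL⟩ h
  refine ⟨⟨(L : Multiset ℕ), fun hi => hL.2 _ (by simpa using hi), by simpa using h⟩, ?_⟩
  apply Subtype.ext
  simp only
  have hperm : (nrm (L : Multiset ℕ).toList).1.Perm L := by
    have h1 : (L : Multiset ℕ).toList.Perm L := Multiset.coe_eq_coe.mp (by simp)
    refine (List.perm_insertionSort _ _).trans ((h1.filter _).trans ?_)
    rw [List.filter_eq_self.mpr]
    intro a ha; simpa using hL.2 a ha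
  exact hperm.eq_of_pairwise (fun a b _ _ h1 h2 => le_antisymm h2 h1) (nrm _).2.1 hL.1

-- dominance
lemma nn_drop (L : List ℕ) (N : ℕ) (h : L.length ≤ N) : nn L = ∑ k ∈ Finset.range N, (L.drop (k + 1)).sum := by
  induction L generalizing N with
  | nil => simp [nn]
  | cons l L ih =>
    cases N with
    | zero => simp at h
    | succ N =>
      rw [Finset.sum_range_succ', nn, ih N (by simpa using h)]; simp; omega
lemma dom_nn {L M : List ℕ} (hL : IsP L) (hM : IsP M) (hs : L.sum = M.sum) (h : ∀ k, (M.take k).sum ≤ (L.take k).sum) :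
    M = L ∨ nn L < nn M := by
  have hd : ∀ k, (L.drop k).sum ≤ (M.drop k).sum := fun k => by
    have h1 := List.sum_take_add_sum_drop L k
    have h2 := List.sum_take_add_sum_drop M k
    have := h k; omega
  have hN1 := nn_drop L (max L.length M.length) (le_max_left _ _)
  have hN2 := nn_drop M (max L.length M.length) (le_max_right _ _)
  by_cases heq : ∀ k, (L.drop k).sum = (M.drop k).sum
  · left
    clear hN1 hN2 hd h hs
    induction L generalizing M with
    | nil =>
      cases M with
      | nil => rfl
      | cons m M => have := heq 0; have := hM.2 m (by simp); simp at *; omega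
    | cons l L ih =>
      cases M with
      | nil => have := heq 0; have := hL.2 l (by simp); simp at *; omega
      | cons m M =>
        have h1 := ih (IsP_cons.mp hL).2.2 (IsP_cons.mp hM).2.2 (fun k => by simpa using heq (k + 1))
        subst h1
        have := heq 0; simp at this; rw [this]
  · right
    push Not at heq
    obtain ⟨k, hk⟩ := heq
    rw [hN1, hN2]
    cases k with
    | zero => simp at hk; omega
    | succ k =>
      refine Finset.sum_lt_sum (fun i _ => hd (i + 1)) ⟨k, ?_, lt_of_le_of_ne (hd _) hk⟩
      rw [Finset.mem_range]
      by_contra hc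
      push Not at hc
      rw [List.drop_eq_nil_of_le (by omega), List.drop_eq_nil_of_le (by omega)] at hk
      exact hk rfl
end JK
end

noncomputable section
namespace JK
open Polynomial
variable {K : Type} [Field K] [CharZero K] (al : K)

structure JF (J : Pt → S K) : Prop where
  orth : ∀ L M : Pt, L ≠ M → HB al (J L) (J M) = 0
  aniso : ∀ f : S K, HB al f f = 0 → f = 0
  gen : ∀ a b : ℤ, (a : K) * al = b → a = 0 ∧ b = 0
  tri : ∀ L M : Pt, MM M.1 (J L) ≠ 0 → M.1.sum = L.1.sum ∧ hd M.1 ≤ hd L.1 ∧ (M = L ∨ nn L.1 < nn M.1)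
  norm : ∀ L : Pt, MvPolynomial.coeff (Finsupp.single 1 L.1.sum) (J L) = 1

namespace JF
variable {al} {J : Pt → S K} (h : JF al J)
include h
lemma al0 : al ≠ 0 := by
  intro h0
  have := h.gen 1 0 (by simp [h0])
  omega
lemma Jne (L : Pt) : J L ≠ 0 := by
  intro h0; have := h.norm L; rw [h0] at this; simp at this
lemma sq_ne (L : Pt) : HB al (J L) (J L) ≠ 0 := fun h0 => h.Jne L (h.aniso _ h0)
lemma hom (L : Pt) : EE 0 (J L) = (L.1.sum : K) • J L := by
  apply hom_of_MM
  intro M hM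
  by_contra hc
  rw [← nrm_MM] at hc
  have := (h.tri L (nrm M) hc).1
  rw [nrm_sum] at this; exact hM this
lemma li : LinearIndependent K J := by
  rw [linearIndependent_iff']
  intro s c hc i hi
  have h1 := congrArg (fun z => HB al z (J i)) hc
  simp only [map_sum, LinearMap.sum_apply, map_smul, LinearMap.smul_apply, map_zero, LinearMap.zero_apply] at h1
  rw [Finset.sum_eq_single i] at h1
  · exact (mul_eq_zero.mp h1).resolve_right (h.sq_ne i)
  · intro b _ hb; rw [h.orth _ _ hb, smul_zero]
  · exact fun h2 => absurd hi h2
lemma span_hom (n : ℕ) (f : S K) (hf : EE 0 f = (n : K) • f) : f ∈ Submodule.span K (Set.range J) := by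
  let I := {L : Pt // L.1.sum = n}
  haveI : Finite I := (Pfin n).to_subtype
  haveI : Fintype I := Fintype.ofFinite I
  let T : (I → K) →ₗ[K] (I → K) := LinearMap.pi fun M => MM M.1.1 ∘ₗ Fintype.linearCombination K (fun L : I => J L.1)
  have hsum : ∀ c : I → K, EE 0 (Fintype.linearCombination K (fun L : I => J L.1) c) = (n : K) • Fintype.linearCombination K (fun L : I => J L.1) c := by
    intro c
    rw [Fintype.linearCombination_apply, map_sum, Finset.smul_sum]
    refine Finset.sum_congr rfl fun L _ => ?_
    rw [map_smul, h.hom, L.2, smul_comm]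
  have sep : ∀ g : S K, EE 0 g = (n : K) • g → (∀ M : I, MM M.1.1 g = 0) → g = 0 := by
    intro g hg hM
    apply MM_inj
    intro L
    by_cases hL : L.sum = n
    · rw [← nrm_MM]; exact hM ⟨nrm L, by rw [nrm_sum, hL]⟩
    · exact MM_hom hg L (by exact_mod_cast hL)
  have hinj : Function.Injective T := by
    rw [← LinearMap.ker_eq_bot, LinearMap.ker_eq_bot']
    intro c hc
    have h1 := sep _ (hsum c) fun M => congrFun hc M
    have h2 : LinearIndependent K (fun L : I => J L.1) := h.li.comp _ Subtype.val_injective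
    rw [Fintype.linearCombination_apply] at h1
    funext i
    exact Fintype.linearIndependent_iff.mp h2 c h1 i
  obtain ⟨c, hc⟩ := (LinearMap.injective_iff_surjective.mp hinj) (fun M => MM M.1.1 f)
  have h3 : f - Fintype.linearCombination K (fun L : I => J L.1) c = 0 := by
    apply sep
    · rw [map_sub, hf, hsum, smul_sub]
    · intro M
      rw [map_sub, sub_eq_zero]; exact (congrFun hc M).symm
  rw [sub_eq_zero.mp h3, Fintype.linearCombination_apply]
  exact Submodule.sum_mem _ fun L _ => Submodule.smul_mem _ _ (Submodule.subset_span ⟨L.1, rfl⟩)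
lemma span_top : ⊤ ≤ Submodule.span K (Set.range J) := by
  intro f _
  rw [comp_sum f]
  exact Submodule.sum_mem _ fun c _ => h.span_hom c _ (comp_hom c f)
omit h in
def jb (h : JF al J) : Module.Basis Pt K (S K) := Module.Basis.mk h.li h.span_top
lemma jb_apply (L : Pt) : h.jb L = J L := Module.Basis.mk_apply _ _ _
def c (h : JF al J) (f : S K) (L : Pt) : K := h.jb.repr f L
lemma c_add (f g : S K) (L : Pt) : h.c (f + g) L = h.c f L + h.c g L := by simp [c]
lemma c_sub (f g : S K) (L : Pt) : h.c (f - g) L = h.c f L - h.c g L := by simp [c]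
lemma c_smul (a : K) (f : S K) (L : Pt) : h.c (a • f) L = a * h.c f L := by simp [c]
lemma c_zero (L : Pt) : h.c 0 L = 0 := by simp [c]
lemma c_J (M L : Pt) : h.c (J M) L = if M = L then 1 else 0 := by
  rw [c, ← h.jb_apply, Module.Basis.repr_self, Finsupp.single_apply]
lemma ext_c (f g : S K) (hc : ∀ L, h.c f L = h.c g L) : f = g := h.jb.ext_elem hc
lemma sum_c (f : S K) : f = ∑ L ∈ (h.jb.repr f).support, h.c f L • J L := by
  conv_lhs => rw [← h.jb.linearCombination_repr f]
  rw [Finsupp.linearCombination_apply, Finsupp.sum]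
  exact Finset.sum_congr rfl fun L _ => by rw [h.jb_apply]; rfl
lemma mem_supp (f : S K) (L : Pt) : L ∈ (h.jb.repr f).support ↔ h.c f L ≠ 0 := Finsupp.mem_support_iff
lemma HB_c (f : S K) (L : Pt) : HB al f (J L) = h.c f L * HB al (J L) (J L) := by
  conv_lhs => rw [h.sum_c f]
  rw [map_sum, LinearMap.sum_apply, Finset.sum_eq_single L]
  · rw [map_smul, LinearMap.smul_apply, smul_eq_mul]
  · intro M _ hM; rw [map_smul, LinearMap.smul_apply, h.orth _ _ hM, smul_zero]
  · intro h1; rw [h.mem_supp, not_not] at h1; rw [h1]; simp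
lemma c_ne_iff (f : S K) (L : Pt) : h.c f L ≠ 0 ↔ HB al f (J L) ≠ 0 := by
  rw [h.HB_c]; simp [h.sq_ne L]
/-- linear functional/operator expansion -/
lemma map_c {V : Type*} [AddCommGroup V] [Module K V] (T : S K →ₗ[K] V) (f : S K) : T f = ∑ L ∈ (h.jb.repr f).support, h.c f L • T (J L) := by
  conv_lhs => rw [h.sum_c f]
  rw [map_sum]; exact Finset.sum_congr rfl fun L _ => map_smul _ _ _
lemma ext_J {V : Type*} [AddCommGroup V] [Module K V] (T T' : S K →ₗ[K] V) (hT : ∀ L, T (J L) = T' (J L)) (f : S K) : T f = T' f := by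
  rw [h.map_c T, h.map_c T']; exact Finset.sum_congr rfl fun L _ => by rw [hT]
end JF
end JK
end

noncomputable section
namespace JK
open Polynomial
variable {K : Type} [Field K] [CharZero K] (al : K)

lemma gp_D (f : S K) (k : ℕ) (hk : ∀ j, k < j → gp j f = 0) :
    gp k (D al f) = D al (gp k f) + (al * (k * (k - 1) / 2)) • gp k f - EE 0 (gp k f) := by
  ext m
  have := phi_gpD al (MvPolynomial.lcoeff K m) f k (fun j hj => by rw [hk _ (by omega)]; simp) (fun j hj => by rw [hk _ (by omega)]; simp)
  simpa [MvPolynomial.lcoeff_apply] using this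

namespace JF
variable {al} {J : Pt → S K} (h : JF al J)
include h
lemma tri' (L : Pt) (M : List ℕ) (hM : MM M (J L) ≠ 0) : M.sum = L.1.sum ∧ hd (nrm M).1 ≤ hd L.1 ∧ (nrm M = L ∨ nn L.1 < nn M) := by
  rw [← nrm_MM] at hM
  have h1 := h.tri L (nrm M) hM
  rw [nrm_sum] at h1
  exact ⟨h1.1, h1.2.1, h1.2.2.imp id fun h2 => h2.trans_le (nrm_nn M)⟩
lemma diag (L : Pt) : MM L.1 (J L) ≠ 0 := by
  intro h0
  let Q := {M : Pt // M.1.sum = L.1.sum ∧ (M = L ∨ nn L.1 < nn M.1)}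
  let Q' := {M : Pt // M.1.sum = L.1.sum ∧ nn L.1 < nn M.1}
  haveI : Finite Q := ((Pfin L.1.sum).subset (fun M hM => hM.1)).to_subtype
  haveI : Finite Q' := ((Pfin L.1.sum).subset (fun M hM => hM.1)).to_subtype
  haveI : Fintype Q := Fintype.ofFinite _
  haveI : Fintype Q' := Fintype.ofFinite _
  let lc := Fintype.linearCombination K (fun M : Q => J M.1)
  let T : (Q → K) →ₗ[K] (Q' → K) := LinearMap.pi fun M => MM M.1.1 ∘ₗ lc
  have hinj : Function.Injective T := by
    rw [← LinearMap.ker_eq_bot, LinearMap.ker_eq_bot']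
    intro c hc
    have h1 : lc c = 0 := by
      apply MM_inj
      intro M
      rw [← nrm_MM]
      by_contra hcon
      by_cases hQ : (nrm M).1.sum = L.1.sum ∧ nn L.1 < nn (nrm M).1
      · exact hcon (congrFun hc ⟨nrm M, hQ⟩)
      · apply hcon
        show MM _ (Fintype.linearCombination K (fun M : Q => J M.1) c) = 0
        rw [Fintype.linearCombination_apply, map_sum]
        refine Finset.sum_eq_zero fun N _ => ?_
        rw [map_smul]
        by_contra hne
        have hne' : MM (nrm M).1 (J N.1) ≠ 0 := fun h2 => hne (by rw [h2, smul_zero])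
        obtain ⟨h3, _, h4⟩ := h.tri _ _ hne'
        have hN := N.2
        apply hQ
        refine ⟨h3.trans hN.1, ?_⟩
        rcases h4 with h4 | h4
        · rcases hN.2 with h5 | h5
          · exfalso; rw [h4, h5] at hne'; exact hne' h0
          · rw [h4]; exact h5
        · rcases hN.2 with h5 | h5
          · rw [h5] at h4; exact h4
          · exact h5.trans h4
    have h2 : LinearIndependent K (fun M : Q => J M.1) := h.li.comp _ Subtype.val_injective
    funext i
    exact Fintype.linearIndependent_iff.mp h2 c (by rw [← Fintype.linearCombination_apply K]; exact h1) i
  have h1 := LinearMap.finrank_le_finrank_of_injective hinj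
  rw [Module.finrank_fintype_fun_eq_card, Module.finrank_fintype_fun_eq_card] at h1
  have h2 : Fintype.card Q' < Fintype.card Q := by
    refine Fintype.card_lt_of_injective_of_notMem (fun M : Q' => (⟨M.1, M.2.1, Or.inr M.2.2⟩ : Q)) ?_ (b := ⟨L, rfl, Or.inl rfl⟩) ?_
    · intro a b hab; exact Subtype.ext (congrArg (fun z : Q => z.1) hab)
    · rintro ⟨M, hM⟩
      have h3 : M.1 = L := congrArg (fun z : Q => z.1) hM
      have := M.2.2; rw [h3] at this; exact lt_irrefl _ this
  omega
lemma claimA (L : Pt) (f : S K) (hf : ∀ M : Pt, MM M.1 f ≠ 0 → M = L ∨ nn L.1 < nn M.1) (M : Pt) (hM : h.c f M ≠ 0) : M = L ∨ nn L.1 < nn M.1 := by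
  -- key: a rank-minimal element of the support has nonzero monomial coefficient
  have key : ∀ N : Pt, h.c f N ≠ 0 → (∀ N', h.c f N' ≠ 0 → nn N.1 ≤ nn N'.1) → N = L ∨ nn L.1 < nn N.1 := by
    intro N hN hmin
    apply hf
    rw [h.map_c, Finset.sum_eq_single N]
    · exact mul_ne_zero hN (h.diag N)
    · intro N' hN' hne
      rw [h.mem_supp] at hN'
      by_contra hc
      have := (h.tri N' N (fun h2 => hc (by rw [h2, smul_zero]))).2.2
      rcases this with h3 | h3
      · exact hne h3.symm
      · exact absurd (hmin N' hN') (by omega)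
    · intro h2; rw [h.mem_supp, not_not] at h2; exact absurd h2 hN
  obtain ⟨N, hN, hmin⟩ := Finset.exists_min_image (h.jb.repr f).support (fun N => nn N.1) ⟨M, (h.mem_supp f M).mpr hM⟩
  rw [h.mem_supp] at hN
  have hmin' : ∀ N', h.c f N' ≠ 0 → nn N.1 ≤ nn N'.1 := fun N' h' => hmin N' ((h.mem_supp f N').mpr h')
  have h1 : nn N.1 ≤ nn M.1 := hmin' M hM
  rcases key N hN hmin' with h2 | h2
  · rcases h1.lt_or_eq with h3 | h3
    · right; rw [h2] at h3; exact h3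
    · exact key M hM (fun N' h' => h3 ▸ hmin' N' h')
  · right; omega
lemma MMD (L : Pt) (M : List ℕ) (hM : nn M ≤ nn L.1) : MM M (D al (J L)) = ev al M * MM M (J L) := by
  apply MM_D
  intro L' hU
  have h1 := Up_nn hU
  by_contra hc
  rcases (h.tri' L L' hc).2.2 with h2 | h2
  · have := nrm_nn L'; rw [h2] at this; omega
  · omega
lemma DJ (L : Pt) : D al (J L) = ev al L.1 • J L := by
  have tr : ∀ L M : Pt, h.c (D al (J L)) M ≠ 0 → M = L ∨ nn L.1 < nn M.1 := by
    intro L M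
    apply h.claimA L
    intro M hM
    by_contra hc
    push Not at hc
    rw [h.MMD L M.1 hc.2] at hM
    rcases (h.tri L M (fun h2 => hM (by rw [h2, mul_zero]))).2.2 with h2 | h2
    · exact hc.1 h2
    · omega
  have off : ∀ M : Pt, M ≠ L → h.c (D al (J L)) M = 0 := by
    intro M hM
    by_contra hc
    have h1 := (tr L M hc).resolve_left hM
    have h2 : h.c (D al (J M)) L ≠ 0 := by
      have hc' := (h.c_ne_iff _ _).mp hc
      rw [h.c_ne_iff]
      rw [D_adj, HB_symm]; exact hc'
    have h3 := (tr M L h2).resolve_left (Ne.symm hM)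
    omega
  have h4 : D al (J L) = h.c (D al (J L)) L • J L := by
    apply h.ext_c
    intro M
    rw [h.c_smul, h.c_J]
    split_ifs with h5
    · rw [h5, mul_one]
    · rw [off M (Ne.symm h5), mul_zero]
  have h5 := h.MMD L L.1 le_rfl
  rw [h4, map_smul, smul_eq_mul] at h5
  rw [h4, mul_right_cancel₀ (h.diag L) h5]
lemma c_D (f : S K) (L : Pt) : h.c (D al f) L = ev al L.1 * h.c f L := by
  have : HB al (D al f) (J L) = ev al L.1 * HB al f (J L) := by
    rw [D_adj, h.DJ, map_smul, smul_eq_mul]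
  rw [h.HB_c (D al f), h.HB_c f, ← mul_assoc] at this
  exact mul_right_cancel₀ (h.sq_ne L) this
lemma ev_inj {L M : List ℕ} (he : ev al L = ev al M) : nn L = nn M := by
  rw [ev_eq, ev_eq] at he
  have := h.gen ((nb L : ℤ) - nb M) ((nn L : ℤ) - nn M) (by push_cast; linear_combination he)
  omega
lemma uniq (L : Pt) (f : S K) (hf : ∀ M : Pt, MM M.1 f ≠ 0 → M = L ∨ nn L.1 < nn M.1) (hD : D al f = ev al L.1 • f) : f = h.c f L • J L := by
  apply h.ext_c
  intro M
  rw [h.c_smul, h.c_J]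
  split_ifs with h5
  · rw [h5, mul_one]
  · rw [mul_zero]
    by_contra hc
    have h1 := h.c_D f M
    rw [hD, h.c_smul] at h1
    have h2 := h.ev_inj (mul_right_cancel₀ hc h1)
    rcases h.claimA L f hf M hc with h3 | h3
    · exact h5 h3.symm
    · omega
lemma gp_gt (L : Pt) (k : ℕ) (hk : hd L.1 < k) : gp k (J L) = 0 := by
  apply MM_inj
  intro M
  rw [← MM_cons]
  by_contra hc
  have h1 := (h.tri' L _ hc).2.1
  have h2 := mem_le_hd (nrm (k :: M)).2 (nrm_mem (k :: M) k (by omega) (by simp))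
  omega
omit h in
def cns (s : ℕ) (L : Pt) (hs : 0 < s ∧ hd L.1 ≤ s) : Pt := ⟨s :: L.1, IsP_cons.mpr ⟨hs.1, hs.2, L.2⟩⟩
lemma gp_hd (s : ℕ) (L : Pt) (hs : 0 < s ∧ hd L.1 ≤ s) : ∃ κ : K, κ ≠ 0 ∧ gp s (J (cns s L hs)) = κ • J L := by
  set N := cns s L hs with hN
  have hN1 : N.1 = s :: L.1 := rfl
  have h1 : ∀ M : Pt, MM M.1 (gp s (J N)) ≠ 0 → M = L ∨ nn L.1 < nn M.1 := by
    intro M hM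
    rw [← MM_cons] at hM
    by_cases hM2 : hd M.1 ≤ s
    · have h2 := h.tri N (cns s M ⟨hs.1, hM2⟩) hM
      have h3 : (cns s M ⟨hs.1, hM2⟩).1 = s :: M.1 := rfl
      rcases h2.2.2 with h4 | h4
      · left; have := congrArg (fun z : Pt => z.1) h4
        apply Subtype.ext
        simp only [h3, hN1] at this
        exact (List.cons.inj this).2
      · right
        have h5 := h2.1
        rw [h3, hN1] at h4 h5
        simp only [nn, List.sum_cons] at h4 h5
        omega
    · exfalso
      have h2 := (h.tri' N _ hM).2.1
      have hne : M.1 ≠ [] := by rintro h0; rw [h0] at hM2; simp [hd] at hM2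
      have h3 : hd M.1 ∈ M.1 := by
        cases hM' : M.1 with
        | nil => exact absurd hM' hne
        | cons a b => simp [hd]
      have h4 := mem_le_hd (nrm (s :: M.1)).2 (nrm_mem (s :: M.1) (hd M.1) (by omega) (by simp [h3]))
      have : hd N.1 = s := rfl
      omega
  have h2 : D al (gp s (J N)) = ev al L.1 • gp s (J N) := by
    have h3 := gp_D al (J N) s (fun j hj => h.gp_gt N j hj)
    rw [h.DJ, map_smul, gp_hom (h.hom N)] at h3
    have h4 : D al (gp s (J N)) = ev al N.1 • gp s (J N) - (al * (s * (s - 1) / 2)) • gp s (J N) + ((N.1.sum : K) - s) • gp s (J N) := by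
      rw [h3]; abel
    rw [h4, ← sub_smul, ← add_smul, hN1, ev, List.sum_cons]
    congr 1; push_cast; ring
  refine ⟨h.c (gp s (J N)) L, ?_, h.uniq L _ h1 h2⟩
  intro h0
  have h3 := h.uniq L _ h1 h2
  rw [h0, zero_smul] at h3
  have h4 := h.diag N
  rw [hN1, MM_cons, h3, map_zero] at h4
  exact h4 rfl
end JF
end JK
end

noncomputable section
namespace JK
open Polynomial
variable {K : Type} [Field K] [CharZero K] (al : K)

def vv (al : K) : K → List ℕ → K
  | _, [] => 1
  | u, k :: L => (∏ j ∈ Finset.range k, (u + al * j)) * vv al (u - 1) L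

lemma p1_D (f : S K) : al • EE 1 f = D al (pn 1 * f) - pn 1 * D al f := by
  rw [D_pn, sn_one]; simp
lemma EE1_adj (hal : al ≠ 0) (f g : S K) : HB al (EE 1 f) g = HB al f (Em1 g) := by
  have h1 : HB al (al • EE 1 f) g = al * HB al f (Em1 g) := by
    rw [p1_D, map_sub, LinearMap.sub_apply, D_adj, HB_pn, HB_pn, D_adj, pdn_D, map_add]; push_cast; ring
  rw [map_smul, LinearMap.smul_apply, smul_eq_mul] at h1
  exact mul_left_cancel₀ hal h1
namespace JF
variable {al} {J : Pt → S K} (h : JF al J)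
include h
omit h in
def cl (h : JF al J) (L : Pt) : S K →ₗ[K] K := Finsupp.lapply L ∘ₗ h.jb.repr.toLinearMap
lemma cl_apply (L : Pt) (f : S K) : h.cl L f = h.c f L := rfl
lemma c_EE0 (f : S K) (L : Pt) : h.c (EE 0 f) L = (L.1.sum : K) * h.c f L := by
  refine h.ext_J (h.cl L ∘ₗ EE 0) ((L.1.sum : K) • h.cl L) ?_ f
  intro M
  simp only [LinearMap.comp_apply, LinearMap.smul_apply, h.cl_apply, h.hom, h.c_smul, h.c_J, smul_eq_mul]
  split_ifs with h1
  · rw [h1]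
  · simp
lemma c_hom {f : S K} {n : K} (hf : EE 0 f = n • f) (L : Pt) (hc : h.c f L ≠ 0) : (L.1.sum : K) = n := by
  have h1 := h.c_EE0 f L
  rw [hf, h.c_smul] at h1
  exact (mul_right_cancel₀ hc h1).symm
lemma kap_ne (s : ℕ) (L : Pt) (hs : 0 < s ∧ hd L.1 ≤ s) : h.c (gp s (J (cns s L hs))) L ≠ 0 := by
  obtain ⟨κ, hκ, h1⟩ := h.gp_hd s L hs
  rw [h1, h.c_smul, h.c_J]; simpa using hκ
lemma kap_eq (s : ℕ) (L : Pt) (hs : 0 < s ∧ hd L.1 ≤ s) : gp s (J (cns s L hs)) = h.c (gp s (J (cns s L hs))) L • J L := by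
  obtain ⟨κ, hκ, h1⟩ := h.gp_hd s L hs
  rw [h1, h.c_smul, h.c_J]; simp
omit h in
lemma ex_cns (N : Pt) (hN : 0 < hd N.1) : ∃ (s : ℕ) (N' : Pt) (hs : 0 < s ∧ hd N'.1 ≤ s), hd N.1 = s ∧ N = cns s N' hs := by
  obtain ⟨L, hL⟩ := N
  cases L with
  | nil => simp [hd] at hN
  | cons a b => 
    have := IsP_cons.mp hL
    exact ⟨a, ⟨b, this.2.2⟩, ⟨this.1, this.2.1⟩, rfl, rfl⟩
lemma H2 (s : ℕ) (f : S K) (hf : ∀ L, h.c f L ≠ 0 → hd L.1 ≤ s) (L : Pt) (hs : 0 < s ∧ hd L.1 ≤ s) :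
    h.c (gp s f) L = h.c f (cns s L hs) * h.c (gp s (J (cns s L hs))) L := by
  have h0 := h.map_c (h.cl L ∘ₗ gp s) f
  simp only [LinearMap.comp_apply, h.cl_apply] at h0
  rw [h0, Finset.sum_eq_single (cns s L hs)]
  · rfl
  · intro N hN hne
    rw [h.mem_supp] at hN
    have h1 := hf N hN
    rcases h1.lt_or_eq with h2 | h2
    · rw [h.gp_gt N s h2, h.c_zero, smul_zero]
    · obtain ⟨t, N', hs', ht, hN'⟩ := ex_cns N (by omega)
      obtain rfl : t = s := ht.symm.trans h2
      rw [hN', h.kap_eq, h.c_smul, h.c_J, if_neg, mul_zero, smul_zero]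
      rintro rfl
      exact hne hN'
  · intro h1; rw [h.mem_supp, not_not] at h1; rw [h1, zero_smul]
lemma H1 (s : ℕ) (f : S K) (hf : ∀ k, s < k → gp k f = 0) (L : Pt) (hL : h.c f L ≠ 0) : hd L.1 ≤ s := by
  obtain ⟨N, hN, hmax⟩ := Finset.exists_max_image (h.jb.repr f).support (fun N => hd N.1) ⟨L, (h.mem_supp f L).mpr hL⟩
  have h1 := hmax L ((h.mem_supp f L).mpr hL)
  rw [h.mem_supp] at hN
  by_contra hc
  have h1' : hd L.1 ≤ hd N.1 := h1
  obtain ⟨t, N', hs', ht, hN'⟩ := ex_cns N (by omega)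
  have h2 := h.H2 t f (fun M hM => ht ▸ hmax M ((h.mem_supp f M).mpr hM)) N' hs'
  rw [hf _ (by omega), h.c_zero, ← hN'] at h2
  have h3 := h.kap_ne _ _ hs'
  rw [← hN'] at h3
  exact mul_ne_zero hN h3 h2.symm
lemma occ_iff (L M : Pt) : h.c (pn 1 * J M) L ≠ 0 ↔ h.c (pdn 1 (J L)) M ≠ 0 := by
  rw [h.c_ne_iff, h.c_ne_iff, HB_pn, HB_symm]
  simp [h.al0]
lemma occ_sum (L M : Pt) (ho : h.c (pn 1 * J M) L ≠ 0) : L.1.sum = M.1.sum + 1 := by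
  have h1 : EE 0 (pn 1 * J M) = ((M.1.sum : K) + 1) • (pn 1 * J M) := by
    rw [EE_mul, h.hom, EE_pn]; simp only [Nat.cast_one, one_smul, add_zero, mul_smul_comm, add_smul]; rw [mul_comm (J M)]
  have := h.c_hom h1 L ho
  exact_mod_cast this
lemma occ_vv (n : ℕ) : ∀ (L M : Pt) (ho : h.c (pn 1 * J M) L ≠ 0) (hn : L.1.length ≤ n) (u : K), vv al u L.1 = (u + ev al L.1 - ev al M.1) * vv al u M.1 := by
  induction n with
  | zero =>
    intro L M ho hn
    have h1 := h.occ_sum L M ho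
    have : L.1 = [] := List.length_eq_zero_iff.mp (by omega)
    rw [this] at h1; simp at h1
  | succ n ih =>
    intro L M ho hn u
    have h1 := h.occ_sum L M ho
    have hL : 0 < hd L.1 := by
      obtain ⟨L, hL⟩ := L
      cases L with
      | nil => simp at h1
      | cons a b => exact (IsP_cons.mp hL).1
    obtain ⟨t, L', hsL, ht, hL'⟩ := ex_cns L hL
    have hL1 : L.1 = t :: L'.1 := congrArg (fun z : Pt => z.1) hL'
    rcases Nat.eq_zero_or_pos (hd M.1) with hM | hM
    · have hM0 : M.1 = [] := by
        obtain ⟨M, hM2⟩ := M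
        cases M with
        | nil => rfl
        | cons a b => have := (IsP_cons.mp hM2).1; simp [hd] at hM; omega
      rw [hM0] at h1 ⊢
      have hL2 : L'.1 = [] := by
        obtain ⟨N, hN2⟩ := L'
        cases N with
        | nil => rfl
        | cons a b => 
          have := (IsP_cons.mp hN2).1
          rw [hL1] at h1
          simp at h1; omega
      rw [hL2] at hL1
      have : t = 1 := by rw [hL1] at h1; simpa using h1
      rw [this] at hL1
      rw [hL1]; simp [vv, ev]
    · obtain ⟨s, M', hsM, hs, hM'⟩ := ex_cns M hM
      have hM1 : M.1 = s :: M'.1 := congrArg (fun z : Pt => z.1) hM'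
      have ho' := (h.occ_iff L M).mp ho
      have g1 : ∀ k, s + 1 < k → gp k (pn 1 * J M) = 0 := by
        intro k hk
        rw [show (1 : ℕ) = ((1 : ℕ+) : ℕ) from rfl, gp_pn, PNat.one_coe, if_pos (by omega), h.gp_gt M k (by omega), h.gp_gt M (k - 1) (by omega)]; simp
      have g3 : gp (s + 1) (pn 1 * J M) = pn 1 * gp (s + 1) (J M) + gp (s + 1 - 1) (J M) := by
        have := gp_pn (s + 1) 1 (J M)
        rw [PNat.one_coe, if_pos (by omega)] at this
        exact this
      have g2 : ∀ k, t < k → gp k (pdn 1 (J L)) = 0 := by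
        intro k hk
        rw [gp_pdn, h.gp_gt L k (by omega), map_zero]
      have h2 := h.H1 _ _ g1 L ho
      have h3 := h.H1 _ _ g2 M ho'
      have h4 : t = s + 1 ∨ t = s := by omega
      rcases h4 with h4 | h4
      · have h5 := h.H2 (s + 1) _ (h.H1 _ _ g1) L' ⟨by omega, by omega⟩
        have h6 : cns (s + 1) L' ⟨by omega, by omega⟩ = L := by
          apply Subtype.ext; rw [hL1]; exact congrArg (· :: L'.1) h4.symm
        rw [h6] at h5
        have h7 := h.kap_ne (s + 1) L' ⟨by omega, by omega⟩
        rw [h6] at h7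
        have h8 := mul_ne_zero ho h7
        rw [← h5, g3, h.gp_gt M (s + 1) (by omega), mul_zero, zero_add, Nat.add_sub_cancel, hM', h.kap_eq, h.c_smul, h.c_J] at h8
        have h9 : M' = L' := by
          by_contra hne; rw [if_neg hne, mul_zero] at h8; exact h8 rfl
        rw [hL1, hM1, h9, h4, vv, vv, ev, ev, Finset.prod_range_succ]
        push_cast; ring
      · have h5 := h.H2 t _ (h.H1 _ _ g2) M' ⟨by omega, by omega⟩
        have h6 : cns t M' ⟨by omega, by omega⟩ = M := by
          apply Subtype.ext; rw [hM1]; exact congrArg (· :: M'.1) h4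
        rw [h6] at h5
        have h7 := h.kap_ne t M' ⟨by omega, by omega⟩
        rw [h6] at h7
        have h8 := mul_ne_zero ho' h7
        rw [← h5, gp_pdn, hL', h.kap_eq, map_smul, h.c_smul] at h8
        have h9 := (h.occ_iff L' M').mpr (right_ne_zero_of_mul h8)
        have h10 := ih L' M' h9 (by rw [hL1] at hn; simpa using hn) (u - 1)
        have h11 := h.occ_sum _ _ h9
        rw [hL1, hM1, h4, vv, vv, h10, ev, ev, h11]
        push_cast; ring

omit h in
def V (h : JF al J) (u : K) : S K →ₗ[K] S K := h.jb.constr K fun L => vv al u L.1 • J L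
variable (u : K)
lemma V_J (L : Pt) : h.V u (J L) = vv al u L.1 • J L := by
  rw [← h.jb_apply, V, Module.Basis.constr_basis, h.jb_apply]
lemma c_V (f : S K) (L : Pt) : h.c (h.V u f) L = vv al u L.1 * h.c f L := by
  refine h.ext_J (h.cl L ∘ₗ h.V u) (vv al u L.1 • h.cl L) ?_ f
  intro M
  simp only [LinearMap.comp_apply, LinearMap.smul_apply, h.cl_apply, h.V_J, h.c_smul, h.c_J, smul_eq_mul]
  split_ifs with h1
  · rw [h1]
  · simp
lemma V_adj (f g : S K) : HB al (h.V u f) g = HB al f (h.V u g) := by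
  refine h.ext_J (HB al (h.V u f)) (HB al f ∘ₗ h.V u) ?_ g
  intro M
  rw [LinearMap.comp_apply, h.V_J, map_smul, h.HB_c, h.HB_c f, h.c_V, smul_eq_mul, mul_assoc]
lemma V_D (f : S K) : h.V u (D al f) = D al (h.V u f) := by
  refine h.ext_J (h.V u ∘ₗ D al) (D al ∘ₗ h.V u) ?_ f
  intro M
  rw [LinearMap.comp_apply, LinearMap.comp_apply, h.DJ, map_smul, h.V_J, map_smul, h.DJ, smul_comm]
lemma V_p1 (f : S K) : h.V u (pn 1 * f) = al • B1 al u (h.V u f) := by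
  refine h.ext_J (h.V u ∘ₗ LinearMap.mulLeft K (pn 1)) (al • B1 al u ∘ₗ h.V u) ?_ f
  intro M
  simp only [LinearMap.comp_apply, LinearMap.smul_apply, LinearMap.mulLeft_apply]
  apply h.ext_c
  intro L
  rw [h.c_V, h.V_J, map_smul, smul_comm, h.c_smul, B1_apply, smul_add, smul_smul, p1_D, h.DJ, mul_smul_comm,
    show al * (u * al⁻¹) = u by field_simp [h.al0], h.c_add, h.c_sub, h.c_smul, h.c_smul, h.c_D]
  by_cases ho : h.c (pn 1 * J M) L = 0
  · rw [ho]; ring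
  · rw [h.occ_vv _ L M ho le_rfl]; ring
lemma V_E1 (f : S K) : h.V u (EE 1 f) = EH0 al u (h.V u f) := by
  have h1 : h.V u (al • EE 1 f) = al • EH0 al u (h.V u f) := by
    rw [p1_D, map_sub, h.V_D, h.V_p1, h.V_p1, h.V_D, EH0_apply, map_smul, smul_sub]
  rw [map_smul] at h1
  exact smul_right_injective _ h.al0 h1
lemma V_pn (n : ℕ) (hn : 1 ≤ n) (f : S K) : h.V u (pn n * f) = al • Bn al u n (h.V u f) := by
  induction n, hn using Nat.le_induction generalizing f with
  | base => rw [h.V_p1, Bn_one h.al0]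
  | succ n hn ih =>
    have h1 : (n : K) • (pn (n + 1) * f) = EE 1 (pn n * f) - pn n * EE 1 f := by
      rw [EE_mul, EE_pn, mul_smul_comm, mul_comm f]; abel
    have h2 := congrArg (h.V u) h1
    rw [map_smul, map_sub, h.V_E1, ih, ih, h.V_E1, map_smul, EH0_Bn h.al0] at h2
    have hn0 : (n : K) ≠ 0 := by exact_mod_cast (by omega : n ≠ 0)
    apply smul_right_injective _ hn0
    show (n : K) • _ = (n : K) • _
    rw [h2]; module
lemma V_ker (f g : S K) (hf : h.V u f = 0) : h.V u (g * f) = 0 := by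
  induction g using MvPolynomial.induction_on generalizing f with
  | C a => rw [← MvPolynomial.smul_eq_C_mul, map_smul, hf, smul_zero]
  | add p q hp hq => rw [add_mul, map_add, hp f hf, hq f hf, add_zero]
  | mul_X p i hp =>
    rw [mul_assoc]; apply hp
    rw [← pn_coe, h.V_pn u i i.pos, hf, map_zero, smul_zero]
lemma pdn_V (f : S K) : pdn 1 (h.V u f) = h.V u (u • pdn 1 f + Em1 f) := by
  rw [← sub_eq_zero]
  apply HB_nd al h.al0
  intro g
  rw [HB_symm, map_sub, sub_eq_zero]
  have h1 := HB_pn al 1 g (h.V u f)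
  rw [← h.V_adj, h.V_p1, map_smul, B1_apply, map_add, map_smul, LinearMap.smul_apply, LinearMap.add_apply, LinearMap.smul_apply, HB_pn, EE1_adj al h.al0] at h1
  rw [← h.V_adj, map_add, map_smul]
  simp only [smul_eq_mul, Nat.cast_one, mul_one] at h1 ⊢
  have := h.al0
  rw [show u * al⁻¹ * (al * HB al (h.V u g) (pdn 1 f)) = u * HB al (h.V u g) (pdn 1 f) by field_simp] at h1
  exact (mul_left_cancel₀ this h1).symm
end JF
end JK
end

noncomputable section
namespace JK
open Polynomial
variable {K : Type} [Field K] [CharZero K] (al : K)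

lemma coeff_pdn1 (m : Exp) (f : S K) : MvPolynomial.coeff m (pdn 1 f) = ((m 1 : K) + 1) * MvPolynomial.coeff (m + Finsupp.single 1 1) f := by
  rw [show (1 : ℕ) = ((1 : ℕ+) : ℕ) from rfl, pdn_coe, MvPolynomial.coeff_pderiv]
  simp only [PNat.one_coe]; ring
lemma coeff_pdn1_it (j : ℕ) (m : Exp) (f : S K) : (Nat.factorial (m 1) : K) * MvPolynomial.coeff m ((pdn 1)^[j] f) = (Nat.factorial (m 1 + j) : K) * MvPolynomial.coeff (m + Finsupp.single 1 j) f := by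
  induction j generalizing f with
  | zero => simp
  | succ j ih =>
    rw [Function.iterate_succ_apply, ih, coeff_pdn1, add_assoc, ← Finsupp.single_add, Finsupp.add_apply, Finsupp.single_eq_same, ← add_assoc (m 1) j 1, Nat.factorial_succ]
    push_cast; ring
lemma EE0_pdn1 (n : K) (f : S K) (hf : EE 0 f = n • f) : EE 0 (pdn 1 f) = (n - 1) • pdn 1 f := by
  ext m
  rw [coeff_EE0, MvPolynomial.coeff_smul, coeff_pdn1]
  have h1 := congrArg (MvPolynomial.coeff (m + Finsupp.single 1 1)) hf
  rw [coeff_EE0, MvPolynomial.coeff_smul] at h1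
  have h2 : wt (m + Finsupp.single 1 1) = wt m + 1 := by
    unfold wt; rw [Finsupp.sum_add_index' (by simp) (by intros; ring), Finsupp.sum_single_index (by simp)]; simp
  rw [h2] at h1; push_cast at h1; simp only [smul_eq_mul] at h1 ⊢
  linear_combination ((m 1 : K) + 1) * h1
lemma vv_ne (hgen : ∀ a b : ℤ, (a : K) * al = b → a = 0 ∧ b = 0) (s : ℕ) : ∀ (M : List ℕ) (r : ℕ), (∀ x ∈ M, x ≤ s) → vv al (-(al * s) - r) M ≠ 0
  | [], r, _ => by simp [vv]
  | k :: M, r, hM => by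
    rw [vv]
    refine mul_ne_zero ?_ ?_
    · rw [Finset.prod_ne_zero_iff]
      intro j hj h0
      have h1 := hgen ((j : ℤ) - s) r (by push_cast; linear_combination h0)
      have h2 := hM k (by simp)
      rw [Finset.mem_range] at hj
      omega
    · have := vv_ne hgen s M (r + 1) (fun x hx => hM x (by simp [hx]))
      rw [show -(al * (s : K)) - r - 1 = -(al * s) - ((r + 1 : ℕ) : K) by push_cast; ring]
      exact this
lemma vv_zero (s : ℕ) (M : List ℕ) (hM : s < hd M) : vv al (-(al * s)) M = 0 := by
  cases M with
  | nil => simp [hd] at hM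
  | cons k M =>
    rw [vv, Finset.prod_eq_zero (i := s), zero_mul]
    · simpa [hd] using hM
    · ring
namespace JF
variable {al} {J : Pt → S K} (h : JF al J)
include h
omit h in
def Th (J : Pt → S K) (L : Pt) (k : ℕ) : S K := if k ≤ L.1.sum then (Nat.factorial (L.1.sum - k) : K)⁻¹ • (pdn 1)^[L.1.sum - k] (J L) else 0
omit h in
lemma Th_coeff (L : Pt) (k : ℕ) (m : Exp) (hk : k ≤ L.1.sum) : MvPolynomial.coeff m (Th J L k) = (Nat.choose (L.1.sum - k + m 1) (m 1) : K) * MvPolynomial.coeff (m + Finsupp.single 1 (L.1.sum - k)) (J L) := by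
  rw [Th, if_pos hk, MvPolynomial.coeff_smul, smul_eq_mul]
  have h1 := coeff_pdn1_it (L.1.sum - k) m (J L)
  have h2 := Nat.add_choose_mul_factorial_mul_factorial (L.1.sum - k) (m 1)
  have h3 : ((Nat.choose (L.1.sum - k + m 1) (m 1) : ℕ) : K) * (Nat.factorial (L.1.sum - k) : K) * (Nat.factorial (m 1) : K) = (Nat.factorial (m 1 + (L.1.sum - k)) : K) := by
    rw [add_comm (m 1), ← h2]; push_cast; ring
  have h4 : (Nat.factorial (L.1.sum - k) : K) ≠ 0 := by exact_mod_cast Nat.factorial_ne_zero _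
  have h5 : (Nat.factorial (m 1) : K) ≠ 0 := by exact_mod_cast Nat.factorial_ne_zero _
  rw [inv_mul_eq_iff_eq_mul₀ h4]
  apply mul_left_cancel₀ h5
  rw [h1, ← h3]; ring
omit h in
lemma Th_gt (L : Pt) (k : ℕ) (hk : L.1.sum < k) : Th J L k = 0 := by rw [Th, if_neg (by omega)]
omit h in
lemma Th_top (L : Pt) : Th J L L.1.sum = J L := by rw [Th, if_pos le_rfl]; simp
omit h in
lemma Th_pdn (L : Pt) (k : ℕ) : pdn 1 (Th J L (k + 1)) = ((L.1.sum : K) - k) • Th J L k := by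
  rcases lt_trichotomy k L.1.sum with h1 | h1 | h1
  · rw [Th, Th, if_pos (by omega), if_pos (by omega), map_smul, ← Function.iterate_succ_apply' (pdn 1), smul_smul,
      show (L.1.sum - (k + 1)).succ = L.1.sum - k by omega]
    congr 1
    obtain ⟨d, hd⟩ : ∃ d, L.1.sum = k + d + 1 := ⟨L.1.sum - k - 1, by omega⟩
    rw [hd, show k + d + 1 - (k + 1) = d by omega, show k + d + 1 - k = d + 1 by omega, Nat.factorial_succ]
    have h4 : (Nat.factorial d : K) ≠ 0 := by exact_mod_cast Nat.factorial_ne_zero _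
    have h5 : (d : K) + 1 ≠ 0 := by exact_mod_cast Nat.succ_ne_zero d
    push_cast; field_simp; ring
  · rw [Th_gt L (k + 1) (by omega), h1, sub_self, zero_smul, map_zero]
  · rw [Th_gt L (k + 1) (by omega), Th_gt L k (by omega), smul_zero, map_zero]
lemma Th_hom (L : Pt) (k : ℕ) : EE 0 (Th J L k) = (k : K) • Th J L k := by
  rcases le_or_gt k L.1.sum with h1 | h1
  · obtain ⟨d, hd⟩ : ∃ d, L.1.sum = k + d := ⟨L.1.sum - k, by omega⟩
    induction d generalizing k with
    | zero => rw [show k = L.1.sum by omega, Th_top, h.hom]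
    | succ d ih =>
      have h2 := ih (k + 1) (by omega) (by omega)
      have h3 := EE0_pdn1 _ _ h2
      rw [Th_pdn, hd, map_smul] at h3
      have h4 : ((k + (d + 1) : ℕ) : K) - k ≠ 0 := by
        push_cast; rw [add_sub_cancel_left]; exact_mod_cast Nat.succ_ne_zero d
      apply smul_right_injective _ h4
      show _ • _ = _ • _
      rw [h3]; push_cast; module
  · rw [Th_gt L k h1]; simp
lemma Th_zero (L : Pt) : Th J L 0 = 1 := by
  ext m
  by_cases hm : m = 0
  · rw [hm, Th_coeff L 0 0 (by omega)]
    simp [h.norm]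
  · rw [MvPolynomial.coeff_one, if_neg (Ne.symm hm)]
    apply hom_coeff (h.Th_hom L 0)
    have : wt m ≠ 0 := by
      unfold wt Finsupp.sum
      intro h0
      apply hm
      ext i
      rw [Finset.sum_eq_zero_iff] at h0
      by_contra hc
      have := h0 i (by simpa using hc)
      have hi := i.pos
      rcases Nat.mul_eq_zero.mp this with h1 | h1
      · exact hc h1
      · omega
    exact_mod_cast this
lemma Th_gp (L : Pt) (k j : ℕ) (hj : hd L.1 < j) : gp j (Th J L k) = 0 := by
  rw [Th]
  split_ifs
  · rw [map_smul]
    have : ∀ d, gp j ((pdn 1)^[d] (J L)) = 0 := by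
      intro d
      induction d with
      | zero => exact h.gp_gt L j hj
      | succ d ih => rw [Function.iterate_succ_apply', gp_pdn, ih, map_zero]
    rw [this, smul_zero]
  · rw [map_zero]
lemma V_surj (s : ℕ) (f : S K) (hf : ∀ M, h.c f M ≠ 0 → hd M.1 ≤ s) : ∃ a, h.V (-(al * s)) a = f := by
  refine ⟨∑ M ∈ (h.jb.repr f).support, (h.c f M / vv al (-(al * s)) M.1) • J M, ?_⟩
  rw [map_sum]
  conv_rhs => rw [h.sum_c f]
  refine Finset.sum_congr rfl fun M hM => ?_
  rw [h.mem_supp] at hM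
  have h1 := vv_ne al h.gen s M.1 0 (fun x hx => (mem_le_hd M.2 hx).trans (hf M hM))
  rw [Nat.cast_zero, sub_zero] at h1
  rw [map_smul, h.V_J, smul_smul, div_mul_cancel₀ _ h1]
lemma V_Th (s : ℕ) (L : Pt) (hs : hd L.1 ≤ s) : ∃ a : ℕ → S K, ∀ k, h.V (-(al * s)) (a k) = Th J L k := by
  have : ∀ k, ∃ a, h.V (-(al * s)) a = Th J L k := fun k => h.V_surj s _ fun M hM =>
    (h.H1 _ _ (fun j hj => h.Th_gp L k j hj) M hM).trans hs
  choose a ha using this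
  exact ⟨a, ha⟩
lemma V_Gh (s i : ℕ) (hi : s < i) (f : S K) : h.V (-(al * s)) (Gh al i * f) = 0 := by
  apply h.ext_c
  intro M
  rw [h.c_zero, h.c_V]
  rcases lt_or_ge (hd M.1) i with h1 | h1
  · have h2 := h.HB_c (Gh al i * f) M
    rw [Gh_adj al h.al0, h.gp_gt M i h1, map_zero, mul_zero] at h2
    rw [(mul_eq_zero.mp h2.symm).resolve_right (h.sq_ne M), mul_zero]
  · rw [vv_zero al s M.1 (by omega), zero_mul]
lemma V_Ghs (s : ℕ) (L : Pt) (hs : 0 < s ∧ hd L.1 ≤ s) (a : S K) (ha : h.V (-(al * s)) a = J L) :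
    ∃ κ : K, h.V (-(al * s)) (Gh al s * a) = κ • J (cns s L hs) := by
  refine ⟨h.c (h.V (-(al * s)) (Gh al s * a)) (cns s L hs), ?_⟩
  apply h.ext_c
  intro M
  rw [h.c_smul, h.c_J]
  split_ifs with h0
  · rw [h0, mul_one]
  · rw [mul_zero, h.c_V]
    have h2 := h.HB_c (Gh al s * a) M
    rw [Gh_adj al h.al0] at h2
    rcases lt_trichotomy (hd M.1) s with h1 | h1 | h1
    · rw [h.gp_gt M s h1, map_zero, mul_zero] at h2
      rw [(mul_eq_zero.mp h2.symm).resolve_right (h.sq_ne M), mul_zero]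
    · obtain ⟨t, M', hs', ht, hM⟩ := ex_cns M (by omega)
      obtain rfl : t = s := ht.symm.trans h1
      have h3 : M' ≠ L := by rintro rfl; exact h0 hM.symm
      have h4 := h.c_V (-(al * t)) a M'
      rw [ha, h.c_J, if_neg (Ne.symm h3)] at h4
      have h5 := vv_ne al h.gen t M'.1 0 (fun x hx => (mem_le_hd M'.2 hx).trans hs'.2)
      rw [Nat.cast_zero, sub_zero] at h5
      have h6 := (mul_eq_zero.mp h4.symm).resolve_left h5
      conv_lhs at h2 => rw [hM, h.kap_eq, map_smul, h.HB_c, h6, zero_mul, smul_zero, mul_zero]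
      rw [(mul_eq_zero.mp h2.symm).resolve_right (h.sq_ne M), mul_zero]
    · rw [vv_zero al s M.1 (by omega), zero_mul]
lemma V_congr (u : K) (f g x : S K) (hfg : h.V u f = h.V u g) : h.V u (x * f) = h.V u (x * g) := by
  rw [← sub_eq_zero, ← map_sub, ← mul_sub]
  apply h.V_ker; rw [map_sub, hfg, sub_self]
lemma key (s : ℕ) (L : Pt) (hs : 0 < s ∧ hd L.1 ≤ s) (a : ℕ → S K) (ha : ∀ k, h.V (-(al * s)) (a k) = Th J L k) (k : ℕ) :
    h.V (-(al * s)) (∑ ij ∈ Finset.HasAntidiagonal.antidiagonal k, Gh al ij.1 * a ij.2) = Th J (cns s L hs) k := by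
  set u := -(al * (s : K)) with hu
  set n := L.1.sum with hn
  let F : ℕ → S K := fun k => h.V u (∑ ij ∈ Finset.HasAntidiagonal.antidiagonal k, Gh al ij.1 * a ij.2)
  have hF : ∀ k, F k = ∑ ij ∈ Finset.HasAntidiagonal.antidiagonal k, h.V u (Gh al ij.1 * a ij.2) := fun k => map_sum _ _ _
  have hN : (cns s L hs).1.sum = s + n := rfl
  let R : S K →ₗ[K] S K := u • pdn 1 + Em1
  have hR : ∀ f, pdn 1 (h.V u f) = h.V u (R f) := fun f => h.pdn_V u f
  have Rmul : ∀ f g, R (f * g) = f * R g + R f * g := by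
    intro f g
    simp only [R, LinearMap.add_apply, LinearMap.smul_apply, pdn_mul, Em1_mul]
    simp only [smul_add, mul_add, add_mul, mul_smul_comm, smul_mul_assoc, mul_comm g]; abel
  have RG : ∀ i, R (Gh al (i + 1)) = ((s : K) - i) • Gh al i := by
    intro i
    simp only [R, LinearMap.add_apply, LinearMap.smul_apply, pdn_Gh, Em1_Gh]
    rw [smul_neg, smul_smul, hu, show -(al * (s : K)) * al⁻¹ = -(s : K) by field_simp [h.al0]]
    module
  have R0 : R (Gh al 0) = 0 := by
    rw [Gh_zero]; simp [R, pdn_one, Em1_one]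
  have hstep : ∀ k, pdn 1 (F (k + 1)) = ((s : K) + n - k) • F k := by
    intro k
    have e1 : ∀ ij : ℕ × ℕ, pdn 1 (h.V u (Gh al ij.1 * a ij.2)) = h.V u (Gh al ij.1 * R (a ij.2)) + h.V u (R (Gh al ij.1) * a ij.2) := by
      intro ij; rw [hR, Rmul, map_add]
    rw [hF, map_sum, Finset.sum_congr rfl (fun ij _ => e1 ij), Finset.sum_add_distrib, Finset.Nat.sum_antidiagonal_succ', Finset.Nat.sum_antidiagonal_succ (f := fun ij => h.V u (R (Gh al ij.1) * a ij.2))]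
    dsimp only
    rw [R0, zero_mul, map_zero, zero_add]
    have e2 : h.V u (Gh al (k + 1) * R (a 0)) = 0 := by
      apply h.V_ker
      rw [← hR, ha, h.Th_zero, pdn_one]
    rw [e2, zero_add, ← Finset.sum_add_distrib, hF, Finset.smul_sum]
    refine Finset.sum_congr rfl fun ij hij => ?_
    rw [Finset.HasAntidiagonal.mem_antidiagonal] at hij
    rw [RG, smul_mul_assoc, map_smul]
    have e3 : h.V u (Gh al ij.1 * R (a (ij.2 + 1))) = ((n : K) - ij.2) • h.V u (Gh al ij.1 * a ij.2) := by
      rw [← map_smul, ← mul_smul_comm]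
      apply h.V_congr
      rw [← hR, ha, Th_pdn, map_smul, ha]
    rw [e3, ← add_smul, ← hij]; push_cast; congr 1; ring
  have hgt : ∀ k, s + n < k → F k = 0 := by
    intro k hk
    rw [hF]
    refine Finset.sum_eq_zero fun ij hij => ?_
    rw [Finset.HasAntidiagonal.mem_antidiagonal] at hij
    rcases lt_or_ge s ij.1 with h1 | h1
    · exact h.V_Gh s _ h1 _
    · apply h.V_ker; rw [ha, Th_gt L _ (by omega)]
  have htop : ∃ κ : K, F (s + n) = κ • J (cns s L hs) := by
    rw [hF, Finset.sum_eq_single (s, n)]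
    · exact h.V_Ghs s L hs _ (by rw [ha, hn, Th_top])
    · intro ij hij hne
      rw [Finset.HasAntidiagonal.mem_antidiagonal] at hij
      rcases lt_trichotomy s ij.1 with h1 | h1 | h1
      · exact h.V_Gh s _ h1 _
      · exact absurd (Prod.ext h1.symm (by show ij.2 = n; omega)) hne
      · apply h.V_ker; rw [ha, Th_gt L _ (by omega)]
    · intro h1; exact absurd (by simp) h1
  obtain ⟨κ, hκ⟩ := htop
  have hdown : ∀ d k, k + d = s + n → F k = κ • Th J (cns s L hs) k := by
    intro d
    induction d with
    | zero => intro k hk; rw [show k = s + n by omega, hκ, ← hN, Th_top]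
    | succ d ih =>
      intro k hk
      have h1 := hstep k
      rw [ih (k + 1) (by omega), map_smul, Th_pdn, hN] at h1
      have h4 : (s : K) + n - k ≠ 0 := by
        have : (s : K) + n = k + (d + 1 : ℕ) := by exact_mod_cast hk.symm
        rw [this, add_sub_cancel_left]; exact_mod_cast Nat.succ_ne_zero d
      apply smul_right_injective _ h4
      show _ • _ = _ • _
      rw [← h1, smul_comm]; push_cast; rfl
  have h1 : κ = 1 := by
    have h2 := hdown (s + n) 0 (by omega)
    rw [h.Th_zero, hF] at h2
    simp only [Finset.Nat.antidiagonal_zero, Finset.sum_singleton, Gh_zero, one_mul, ha, h.Th_zero] at h2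
    have h3 := congrArg (MvPolynomial.coeff 0) h2
    simp at h3; exact h3.symm
  rcases le_or_gt k (s + n) with h2 | h2
  · have := hdown (s + n - k) k (by omega)
    rw [h1, one_smul] at this; exact this
  · rw [Th_gt _ _ (by rw [hN]; exact h2)]; exact hgt k h2
end JF
end JK
end

noncomputable section
namespace JK
open Polynomial
variable {K : Type} [Field K] [CharZero K] (al : K)

lemma W_x0 {R : Type*} [CommRing R] [Algebra K R] (c : ℕ → R) (n : ℕ) : W K c 0 n = if n = 0 then 1 else 0 := by
  cases n with
  | zero => rw [W_zero]; rfl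
  | succ n =>
    have h1 := W_rec (K := K) c 0 n
    simp only [zero_mul, Finset.sum_const_zero] at h1
    have h2 : (n : K) + 1 ≠ 0 := by exact_mod_cast Nat.succ_ne_zero n
    rw [if_neg (by omega)]
    have h3 := congrArg (fun z => ((n : K) + 1)⁻¹ • z) h1
    simpa only [smul_smul, inv_mul_cancel₀ h2, one_smul, smul_zero] using h3
def QP (i : ℕ) : Y K := W K (fun n => C (cc al n)) X i
lemma QP_eval (j i : ℕ) : (QP al i).eval (j : S K) = W K (cc al) (j : S K) i := by
  have h1 := W_map ((Polynomial.aeval (R := S K) (j : S K)).restrictScalars K) (fun n => C (cc al n)) (X : Y K) i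
  simp only [AlgHom.restrictScalars_apply, Polynomial.aeval_X, Polynomial.aeval_C, Algebra.algebraMap_self, RingHom.id_apply] at h1
  rw [← h1, QP, Polynomial.coe_aeval_eq_eval]
lemma QP_zero : QP al 0 = 1 := W_zero _ _
lemma QP_coeff0 (i : ℕ) : (QP al i).coeff 0 = if i = 0 then 1 else 0 := by
  have h1 := QP_eval al 0 i
  rw [Nat.cast_zero, W_x0, ← Polynomial.coeff_zero_eq_eval_zero] at h1
  exact h1
def bb (K : Type) [Field K] (n : ℕ) : K := (-1) ^ n / n
lemma QP_coeff1 (i : ℕ) : (QP al i).coeff 1 = (bb K i * al⁻¹) • pn i := by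
  cases i with
  | zero => rw [QP_zero, Polynomial.coeff_one]; simp [bb]
  | succ n =>
    have h1 := congrArg (fun z : Y K => z.coeff (0 + 1)) (W_rec (K := K) (fun n => C (cc al n)) (X : Y K) n)
    have h4 : ∑ x ∈ Finset.HasAntidiagonal.antidiagonal n, cc al (x.1 + 1) * (W K (fun n => C (cc al n)) (X : Y K) x.2).coeff 0 = cc al (n + 1) := by
      rw [Finset.sum_eq_single (n, 0)]
      · simp [W_zero]
      · intro ij hij hne
        have := QP_coeff0 al ij.2
        rw [QP] at this
        rw [Finset.HasAntidiagonal.mem_antidiagonal] at hij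
        rw [this, if_neg, mul_zero]
        intro h0; exact hne (Prod.ext (by show ij.1 = n; omega) h0)
      · intro h1; exact absurd (by simp) h1
    simp only [Polynomial.coeff_smul, Polynomial.finset_sum_coeff, mul_assoc, Polynomial.coeff_X_mul, Polynomial.coeff_C_mul] at h1
    have h2 : (n : K) + 1 ≠ 0 := by exact_mod_cast Nat.succ_ne_zero n
    have h5 : ((n : K) + 1) • (QP al (n + 1)).coeff 1 = cc al (n + 1) := by
      rw [← h4]; exact h1
    have h3 := congrArg (fun z => ((n : K) + 1)⁻¹ • z) h5
    simp only [smul_smul, inv_mul_cancel₀ h2, one_smul] at h3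
    rw [h3, cc, smul_smul, bb]; push_cast; congr 1; field_simp
/-- apply a functional coefficientwise -/
def lf (φ : S K →ₗ[K] K) (Q : Y K) : K[X] := Q.sum fun d c => Polynomial.monomial d (φ c)
lemma lf_coeff (φ : S K →ₗ[K] K) (Q : Y K) (d : ℕ) : (lf φ Q).coeff d = φ (Q.coeff d) := by
  rw [lf, Polynomial.sum, Polynomial.finset_sum_coeff]
  simp only [Polynomial.coeff_monomial]
  rw [Finset.sum_ite_eq' Q.support d]
  split_ifs with h1
  · rfl
  · rw [Polynomial.notMem_support_iff.mp h1, map_zero]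
lemma lf_eval (φ : S K →ₗ[K] K) (Q : Y K) (j : ℕ) : (lf φ Q).eval (j : K) = φ (Q.eval (j : S K)) := by
  rw [lf, Polynomial.sum, Polynomial.eval_finset_sum, Polynomial.eval_eq_sum, Polynomial.sum, map_sum]
  refine Finset.sum_congr rfl fun d _ => ?_
  rw [Polynomial.eval_monomial, show Q.coeff d * (j : S K) ^ d = ((j : K) ^ d) • Q.coeff d by
    rw [Algebra.smul_def, map_pow, map_natCast, mul_comm], map_smul, smul_eq_mul, mul_comm]
namespace JF
variable {al} {J : Pt → S K} (h : JF al J)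
include h
lemma iter (s : ℕ) (L : Pt) (hs : 0 < s ∧ hd L.1 ≤ s) (a : ℕ → S K) (ha : ∀ k, h.V (-(al * s)) (a k) = Th J L k) (j : ℕ) :
    ∃ N : Pt, hd N.1 ≤ s ∧ ∀ k, h.V (-(al * s)) (∑ ij ∈ Finset.HasAntidiagonal.antidiagonal k, W K (cc al) (j : S K) ij.1 * a ij.2) = Th J N k := by
  induction j with
  | zero =>
    refine ⟨L, hs.2, fun k => ?_⟩
    rw [← ha, Finset.sum_eq_single (0, k)]
    · rw [Nat.cast_zero, W_x0]; simp
    · intro ij hij hne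
      rw [Finset.HasAntidiagonal.mem_antidiagonal] at hij
      rw [Nat.cast_zero, W_x0, if_neg, zero_mul]
      intro h0; exact hne (Prod.ext h0 (by show ij.2 = k; omega))
    · intro h1; exact absurd (by simp) h1
  | succ j ih =>
    obtain ⟨N, hN, hN2⟩ := ih
    refine ⟨cns s N ⟨hs.1, hN⟩, le_refl s, fun k => ?_⟩
    rw [← h.key s N ⟨hs.1, hN⟩ _ hN2 k]
    congr 1
    let A : PowerSeries (S K) := PowerSeries.mk a
    let w : PowerSeries (S K) := PowerSeries.mk (fun i => W K (cc al) (j : S K) i)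
    let G : PowerSeries (S K) := PowerSeries.mk (fun i => Gh al i)
    have e1 : PowerSeries.mk (fun i => W K (cc al) ((j + 1 : ℕ) : S K) i) = G * w := by
      ext1 n
      rw [PowerSeries.coeff_mk, PowerSeries.coeff_mul, Nat.cast_succ, add_comm, W_add]
      simp only [G, w, PowerSeries.coeff_mk]; rfl
    have e2 := congrArg (fun z => PowerSeries.coeff k (z * A)) e1
    simp only [mul_assoc] at e2
    rw [PowerSeries.coeff_mul, PowerSeries.coeff_mul] at e2
    simp only [PowerSeries.coeff_mul, G, w, A, PowerSeries.coeff_mk] at e2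
    exact e2
omit h in
def t (J : Pt → S K) (m : Exp) (L : Pt) : K := MvPolynomial.coeff m (Th J L (wt m))
omit h in
def xx (J : Pt → S K) (al u : K) (m : Exp) (L : Pt) : K := ∑ ij ∈ Finset.HasAntidiagonal.antidiagonal (wt m), bb K ij.1 * MvPolynomial.coeff m (Bn al u ij.1 (Th J L ij.2))
omit h in
def xl (J : Pt → S K) (al : K) (l : ℕ) (m : Exp) (L : Pt) : K := ∑ ij ∈ Finset.HasAntidiagonal.antidiagonal (wt m), bb K ij.1 * MvPolynomial.coeff m (wB al ij.1 l (Th J L ij.2))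
lemma E0 (s : ℕ) (L : Pt) (hs : 0 < s ∧ hd L.1 ≤ s) : ∃ (P : Exp → K[X]) (N : ℕ → Pt), (∀ (m : Exp) (j : ℕ), (P m).eval (j : K) = t J m (N j)) ∧ (∀ m, (P m).coeff 0 = t J m L) ∧ ∀ m, (P m).coeff 1 = xx J al (-(al * s)) m L := by
  obtain ⟨a, ha⟩ := h.V_Th s L hs.2
  choose N hN1 hN2 using h.iter s L hs a ha
  let φ : Exp → ℕ → (S K →ₗ[K] K) := fun m j => MvPolynomial.lcoeff K m ∘ₗ h.V (-(al * s)) ∘ₗ LinearMap.mulRight K (a j)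
  have hφ : ∀ m j f, φ m j f = MvPolynomial.coeff m (h.V (-(al * s)) (f * a j)) := fun _ _ _ => rfl
  refine ⟨fun m => ∑ ij ∈ Finset.HasAntidiagonal.antidiagonal (wt m), lf (φ m ij.2) (QP al ij.1), N, ?_, ?_, ?_⟩
  · intro m j
    rw [Polynomial.eval_finset_sum, t, ← hN2, map_sum, MvPolynomial.coeff_sum]
    refine Finset.sum_congr rfl fun ij _ => ?_
    rw [lf_eval, QP_eval, hφ]
  · intro m
    rw [Polynomial.finset_sum_coeff, Finset.sum_eq_single (0, wt m)]
    · rw [lf_coeff, QP_coeff0, if_pos rfl, hφ, one_mul, ha, t]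
    · intro ij hij hne
      rw [Finset.HasAntidiagonal.mem_antidiagonal] at hij
      rw [lf_coeff, QP_coeff0, if_neg, map_zero]
      intro h0; exact hne (Prod.ext h0 (by show ij.2 = wt m; omega))
    · intro h1; exact absurd (by simp) h1
  · intro m
    rw [Polynomial.finset_sum_coeff, xx]
    refine Finset.sum_congr rfl fun ij hij => ?_
    rw [lf_coeff, QP_coeff1, map_smul, hφ]
    rcases Nat.eq_zero_or_pos ij.1 with h0 | h0
    · rw [h0]; simp [bb]
    · rw [h.V_pn _ _ h0, ha, MvPolynomial.coeff_smul]
      have := h.al0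
      simp only [smul_eq_mul]; field_simp
lemma E1 (T : Finset Exp) (γ : Exp → K) (μ ν : Exp) (hγ : ∀ N : Pt, t J μ N * t J ν N = ∑ π ∈ T, γ π * t J π N)
    (s : ℕ) (L : Pt) (hs : 0 < s ∧ hd L.1 ≤ s) : t J μ L * xx J al (-(al * s)) ν L + xx J al (-(al * s)) μ L * t J ν L = ∑ π ∈ T, γ π * xx J al (-(al * s)) π L := by
  obtain ⟨P, N, h1, h2, h3⟩ := h.E0 s L hs
  have e : P μ * P ν = ∑ π ∈ T, C (γ π) * P π := by
    apply Polynomial.eq_of_infinite_eval_eq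
    apply Set.Infinite.mono (s := Set.range (fun j : ℕ => (j : K)))
    · rintro _ ⟨j, rfl⟩
      simp only [Set.mem_setOf_eq, Polynomial.eval_mul, Polynomial.eval_finset_sum, Polynomial.eval_C, h1, hγ]
    · exact Set.infinite_range_of_injective Nat.cast_injective
  have e1 := congrArg (fun z : K[X] => z.coeff 1) e
  rw [Polynomial.mul_coeff_one, Polynomial.finset_sum_coeff] at e1
  simp only [Polynomial.coeff_C_mul, h2, h3] at e1
  exact e1
lemma E2 (T : Finset Exp) (γ : Exp → K) (μ ν : Exp) (hγ : ∀ N : Pt, t J μ N * t J ν N = ∑ π ∈ T, γ π * t J π N)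
    (l : ℕ) (L : Pt) : t J μ L * xl J al l ν L + xl J al l μ L * t J ν L = ∑ π ∈ T, γ π * xl J al l π L := by
  let Q : Exp → K[X] := fun m => ∑ ij ∈ Finset.HasAntidiagonal.antidiagonal (wt m), ∑ l ∈ Finset.range (ij.1 + 1), Polynomial.monomial l (bb K ij.1 * MvPolynomial.coeff m (wB al ij.1 l (Th J L ij.2)))
  have Qe : ∀ m u, (Q m).eval u = xx J al u m L := by
    intro m u
    rw [Polynomial.eval_finset_sum, xx]
    refine Finset.sum_congr rfl fun ij _ => ?_
    rw [Polynomial.eval_finset_sum, Bn_wB, MvPolynomial.coeff_sum, Finset.mul_sum]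
    refine Finset.sum_congr rfl fun l _ => ?_
    rw [Polynomial.eval_monomial, MvPolynomial.coeff_smul, smul_eq_mul]; ring
  have Qc : ∀ m, (Q m).coeff l = xl J al l m L := by
    intro m
    rw [Polynomial.finset_sum_coeff, xl]
    refine Finset.sum_congr rfl fun ij _ => ?_
    rw [Polynomial.finset_sum_coeff]
    simp only [Polynomial.coeff_monomial]
    rw [Finset.sum_ite_eq' _ l]
    split_ifs with h1
    · rfl
    · have h2 : ij.1 < l := by { rw [Finset.mem_range] at h1; omega }
      rw [wB_gt h2]; simp
  have e : C (t J μ L) * Q ν + Q μ * C (t J ν L) = ∑ π ∈ T, C (γ π) * Q π := by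
    apply Polynomial.eq_of_infinite_eval_eq
    apply Set.Infinite.mono (s := Set.range (fun j : ℕ => (-(al * ((hd L.1 + 1 + j : ℕ) : K)))))
    · rintro _ ⟨j, rfl⟩
      simp only [Set.mem_setOf_eq, Polynomial.eval_add, Polynomial.eval_mul, Polynomial.eval_finset_sum, Polynomial.eval_C, Qe]
      exact h.E1 T γ μ ν hγ _ L ⟨by omega, by omega⟩
    · apply Set.infinite_range_of_injective
      intro i j hij
      have := mul_left_cancel₀ h.al0 (neg_injective hij)
      have h2 : hd L.1 + 1 + i = hd L.1 + 1 + j := Nat.cast_injective this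
      omega
  have e1 := congrArg (fun z : K[X] => z.coeff l) e
  simp only [Polynomial.coeff_add, Polynomial.coeff_mul_C, Polynomial.finset_sum_coeff, Polynomial.coeff_C_mul, Qc] at e1
  exact e1
end JF
end JK
end

noncomputable section
namespace JK
open Polynomial
variable {K : Type} [Field K] [CharZero K] (al : K)

/-- grading operator on `Y` -/
def GY : Y K →ₗ[K] Y K := hat (EE 0) + th
lemma GY_apply (f : Y K) : GY f = hat (EE 0) f + th f := rfl
lemma GY_C (a : S K) : GY (C a) = C (EE 0 a) := by rw [GY_apply, hat_C, th_C, add_zero]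
lemma GY_X (f : Y K) : GY (X * f) = X * GY f + X * f := by
  rw [GY_apply, GY_apply, hat_X, th_X]; ring
lemma Th0_GY (f : Y K) : Th0 (GY f) = EE 0 (Th0 f) := by
  refine Y_mon (Th0 ∘ₗ GY) (EE 0 ∘ₗ Th0) ?_ f
  intro n f
  simp only [LinearMap.comp_apply]
  rw [Th0_XC, EE_mul, GY_apply, hat_Xp, hat_C, th_Xp, th_C, mul_zero, zero_add, EE_pn, map_add,
    Th0_XC, map_smul, Th0_XC, add_zero]
  algebra
lemma GY_Lam (f : Y K) : GY (LamL al f) = LamL al (GY f) := by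
  refine Y_ind (GY ∘ₗ LamL al) (LamL al ∘ₗ GY) ?_ ?_ f
  · intro a
    simp only [LinearMap.comp_apply]
    rw [GY_C, LamL_C, LamL_C, map_smul, Dl0_EE, GY_apply]; simp
  · intro f hf
    simp only [LinearMap.comp_apply] at hf ⊢
    rw [LamL_X, map_add, map_add, GY_X, hf, map_smul, GY_C, ← Th0_GY, GY_X, map_add (LamL al), LamL_X, LamL_X, map_add Th0, C_add, smul_add]
    abel
lemma wY_GY (w : List Bool) (f : Y K) : GY (wY al w f) = wY al w (GY f) + (w.length : K) • wY al w f := by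
  induction w with
  | nil => simp [wY]
  | cons b w ih =>
    cases b
    · simp only [wY, Bool.false_eq_true, if_false, LinearMap.comp_apply, LinearMap.mulLeft_apply, List.length_cons]
      rw [GY_X, GY_Lam, ih, map_add, map_smul]; push_cast
      rw [add_smul, one_smul, mul_add, mul_smul_comm]; abel
    · simp only [wY, if_true, LinearMap.comp_apply, LinearMap.mulLeft_apply, List.length_cons]
      rw [GY_X, ih]; push_cast
      rw [add_smul, one_smul, mul_add, mul_smul_comm]; abel
lemma wB_EE (n l : ℕ) (f : S K) : EE 0 (wB al n l f) = wB al n l (EE 0 f) + (n : K) • wB al n l f := by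
  simp only [wB, LinearMap.smul_apply, LinearMap.comp_apply, LinearMap.sum_apply, map_sum, map_smul, CL_apply, ← Th0_GY, wY_GY, GY_C, List.length_ofFn, map_add]
  rw [Finset.sum_add_distrib, smul_add, ← Finset.smul_sum, smul_comm]
lemma EE0_mon (m : Exp) : EE 0 (MvPolynomial.monomial m 1 : S K) = (wt m : K) • MvPolynomial.monomial m 1 := by
  ext m'
  rw [coeff_EE0, MvPolynomial.coeff_smul, smul_eq_mul, MvPolynomial.coeff_monomial]
  split_ifs with h
  · rw [h]
  · simp
lemma wB_wt (n l : ℕ) (m m' : Exp) (h : wt m ≠ wt m' + n) : MvPolynomial.coeff m (wB al n l (MvPolynomial.monomial m' 1)) = 0 := by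
  apply hom_coeff (c := ((wt m' + n : ℕ) : K))
  · rw [wB_EE, EE0_mon, map_smul]; push_cast; rw [add_smul]
  · exact_mod_cast h

lemma wt_add (m m' : Exp) : wt (m + m') = wt m + wt m' := by
  unfold wt; exact Finsupp.sum_add_index' (by simp) (by intros; ring)
lemma wt_single (i : ℕ+) (k : ℕ) : wt (Finsupp.single i k) = k * i := by
  unfold wt; rw [Finsupp.sum_single_index]; simp
lemma le_wt (m : Exp) (i : ℕ+) : m i * i ≤ wt m := by
  by_cases h : i ∈ m.support
  · exact Finset.single_le_sum (f := fun i => m i * (i : ℕ)) (fun _ _ => Nat.zero_le _) h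
  · rw [Finsupp.notMem_support_iff.mp h]; simp
lemma Wfin (n : ℕ) : {m : Exp | wt m ≤ n}.Finite := by
  apply Set.Finite.subset (Finset.finite_toSet (Finset.finsupp (Finset.Icc (1 : ℕ+) (Nat.succPNat n)) (fun _ => Finset.range (n + 1))))
  intro m hm
  rw [Finset.mem_coe, Finset.mem_finsupp_iff]
  constructor
  · intro i hi
    have h1 := le_wt m i
    have h2 : m i ≠ 0 := Finsupp.mem_support_iff.mp hi
    have h3 : wt m ≤ n := hm
    rw [Finset.mem_Icc]
    refine ⟨i.one_le, ?_⟩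
    rw [← PNat.coe_le_coe]; rw [Nat.succPNat_coe, Nat.succ_eq_add_one]
    have : (i : ℕ) ≤ m i * i := Nat.le_mul_of_pos_left _ (Nat.pos_of_ne_zero h2)
    omega
  · intro i hi
    have h1 := le_wt m i
    have h3 : wt m ≤ n := hm
    rw [Finset.mem_range]
    have : m i ≤ m i * i := Nat.le_mul_of_pos_right _ i.pos
    omega
def Wl (n : ℕ) : Finset Exp := (Wfin n).toFinset
lemma mem_Wl (n : ℕ) (m : Exp) : m ∈ Wl n ↔ wt m ≤ n := by simp [Wl]

def cm (l : ℕ) (m m' : Exp) : K := if wt m' ≤ wt m then bb K (wt m - wt m') * MvPolynomial.coeff m (wB al (wt m - wt m') l (MvPolynomial.monomial m' 1)) else 0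
lemma cm_zero (l : ℕ) (m m' : Exp) (h : wt m < wt m' + l) : cm al l m m' = 0 := by
  rw [cm]
  split_ifs with h1
  · rw [wB_gt (by omega)]; simp
  · rfl

namespace JF
variable {al} {J : Pt → S K} (h : JF al J)
include h
lemma Th_sum (L : Pt) (n j : ℕ) (hj : j ≤ n) : Th J L j = ∑ m ∈ Wl n, if wt m = j then t J m L • MvPolynomial.monomial m (1 : K) else 0 := by
  ext m'
  rw [MvPolynomial.coeff_sum]
  by_cases hm : wt m' = j
  · rw [Finset.sum_eq_single m']
    · rw [if_pos hm, MvPolynomial.coeff_smul, MvPolynomial.coeff_monomial, if_pos rfl, t, hm]; simp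
    · intro m _ hne
      split_ifs
      · rw [MvPolynomial.coeff_smul, MvPolynomial.coeff_monomial, if_neg hne, smul_zero]
      · simp
    · intro h1; exact absurd ((mem_Wl _ _).mpr (by omega)) h1
  · rw [hom_coeff (h.Th_hom L j) m' (by exact_mod_cast hm)]
    symm
    refine Finset.sum_eq_zero fun m _ => ?_
    split_ifs with h1
    · rw [MvPolynomial.coeff_smul, MvPolynomial.coeff_monomial, if_neg (by rintro rfl; exact hm h1), smul_zero]
    · simp
lemma xl_exp (l : ℕ) (m : Exp) (L : Pt) : xl J al l m L = ∑ m' ∈ Wl (wt m), cm al l m m' * t J m' L := by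
  have h1 : ∀ ij ∈ Finset.HasAntidiagonal.antidiagonal (wt m), bb K ij.1 * MvPolynomial.coeff m (wB al ij.1 l (Th J L ij.2)) =
      ∑ m' ∈ Wl (wt m), if wt m' = ij.2 then cm al l m m' * t J m' L else 0 := by
    intro ij hij
    rw [Finset.HasAntidiagonal.mem_antidiagonal] at hij
    rw [h.Th_sum L (wt m) ij.2 (by omega), map_sum, MvPolynomial.coeff_sum, Finset.mul_sum]
    refine Finset.sum_congr rfl fun m' _ => ?_
    split_ifs with h2
    · rw [map_smul, MvPolynomial.coeff_smul, cm, if_pos (by omega), show wt m - wt m' = ij.1 by omega, smul_eq_mul]; ring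
    · simp
  rw [xl, Finset.sum_congr rfl h1, Finset.sum_comm]
  refine Finset.sum_congr rfl fun m' hm' => ?_
  rw [mem_Wl] at hm'
  rw [Finset.sum_eq_single (wt m - wt m', wt m')]
  · rw [if_pos rfl]
  · intro ij hij hne
    rw [Finset.HasAntidiagonal.mem_antidiagonal] at hij
    rw [if_neg]
    intro h2
    exact hne (Prod.ext (by show ij.1 = wt m - wt m'; omega) h2.symm)
  · intro h2; exact absurd (by rw [Finset.HasAntidiagonal.mem_antidiagonal]; show wt m - wt m' + wt m' = wt m; omega) h2
lemma t_li (v : Exp →₀ K) (hv : ∀ L : Pt, (v.sum fun π a => a * t J π L) = 0) : v = 0 := by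
  have main : ∀ n, ∀ π, wt π = n → v π = 0 := by
    intro n
    induction n using Nat.strong_induction_on with
    | _ n ih =>
    let φ : S K →ₗ[K] K := ∑ π ∈ v.support, (if wt π = n then v π else 0) • MvPolynomial.lcoeff K π
    have hφ : ∀ f, φ f = ∑ π ∈ v.support, (if wt π = n then v π else 0) * MvPolynomial.coeff π f := by
      intro f; simp only [φ, LinearMap.sum_apply, LinearMap.smul_apply, smul_eq_mul]; rfl
    have h0 : ∀ f, φ f = 0 := by
      intro f
      refine h.ext_J φ 0 (fun L => ?_) f
      rw [hφ, LinearMap.zero_apply]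
      by_cases hL : L.1.sum = n
      · refine Eq.trans ?_ (hv L)
        rw [Finsupp.sum]
        refine Finset.sum_congr rfl fun π _ => ?_
        split_ifs with h1
        · rw [t, h1, ← hL, Th_top]
        · rcases lt_or_gt_of_ne h1 with h2 | h2
          · rw [ih _ h2 π rfl]; simp
          · rw [t, Th_gt _ _ (by omega)]; simp
      · refine Finset.sum_eq_zero fun π _ => ?_
        split_ifs with h1
        · rw [hom_coeff (h.hom L) π (by rw [h1]; exact_mod_cast (Ne.symm hL)), mul_zero]
        · simp
    intro π hπ
    by_contra hne
    have := h0 (MvPolynomial.monomial π 1)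
    rw [hφ, Finset.sum_eq_single π] at this
    · rw [if_pos hπ, MvPolynomial.coeff_monomial, if_pos rfl, mul_one] at this; exact hne this
    · intro b _ hb; rw [MvPolynomial.coeff_monomial, if_neg (Ne.symm hb), mul_zero]
    · intro h1; exact absurd (Finsupp.mem_support_iff.mpr hne) h1
  ext π; exact main _ π rfl

omit h in
def cF (al : K) (l : ℕ) (m : Exp) : Exp →₀ K := ∑ m' ∈ Wl (wt m), Finsupp.single m' (cm al l m m')
omit h in
lemma cF_apply (l : ℕ) (m m' : Exp) : cF al l m m' = cm al l m m' := by
  rw [cF, Finsupp.finset_sum_apply]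
  by_cases h1 : m' ∈ Wl (wt m)
  · rw [Finset.sum_eq_single m']
    · simp
    · intro b _ hb; simp [hb]
    · intro h2; exact absurd h1 h2
  · rw [cm, if_neg (by rwa [mem_Wl] at h1)]
    refine Finset.sum_eq_zero fun b hb => ?_
    rw [Finsupp.single_apply, if_neg]; rintro rfl; exact h1 hb
omit h in
def tL (J : Pt → S K) (L : Pt) : (Exp →₀ K) →ₗ[K] K := Finsupp.linearCombination K (fun π => t J π L)
omit h in
lemma tL_apply (L : Pt) (v : Exp →₀ K) : tL J L v = v.sum fun π a => a * t J π L := by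
  rw [tL, Finsupp.linearCombination_apply]; rfl
lemma star (γ : Exp → Exp → (Exp →₀ K)) (hγ : ∀ μ ν (N : Pt), t J μ N * t J ν N = tL J N (γ μ ν)) (l : ℕ) (μ ν : Exp) :
    ∑ ν' ∈ Wl (wt ν), cm al l ν ν' • γ μ ν' + ∑ μ' ∈ Wl (wt μ), cm al l μ μ' • γ μ' ν = (γ μ ν).sum fun π a => a • cF al l π := by
  rw [← sub_eq_zero]
  apply h.t_li
  intro L
  rw [← tL_apply, map_sub, map_add, map_sum, map_sum, sub_eq_zero]
  have e := h.E2 (γ μ ν).support (γ μ ν) μ ν (fun N => by rw [hγ, tL_apply]; rfl) l L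
  have hcF : ∀ π, tL J L (cF al l π) = xl J al l π L := by
    intro π
    rw [cF, map_sum, h.xl_exp]
    refine Finset.sum_congr rfl fun m _ => ?_
    rw [tL_apply, Finsupp.sum_single_index]; simp
  rw [Finsupp.sum, map_sum]
  simp only [map_smul, hcF, smul_eq_mul, ← hγ]
  rw [← e, h.xl_exp, h.xl_exp, Finset.mul_sum, Finset.sum_mul]
  congr 1 <;> exact Finset.sum_congr rfl fun _ _ => by ring
lemma star_at (γ : Exp → Exp → (Exp →₀ K)) (hγ : ∀ μ ν (N : Pt), t J μ N * t J ν N = tL J N (γ μ ν)) (l : ℕ) (μ ν π' : Exp) :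
    ∑ ν' ∈ Wl (wt ν), cm al l ν ν' * γ μ ν' π' + ∑ μ' ∈ Wl (wt μ), cm al l μ μ' * γ μ' ν π' = ∑ π ∈ (γ μ ν).support, γ μ ν π * cm al l π π' := by
  have := congrArg (fun v : Exp →₀ K => v π') (h.star γ hγ l μ ν)
  simp only [Finsupp.add_apply, Finsupp.finset_sum_apply, Finsupp.sum, Finsupp.smul_apply, smul_eq_mul, cF_apply] at this
  exact this
lemma bound (γ : Exp → Exp → (Exp →₀ K)) (hγ : ∀ μ ν (N : Pt), t J μ N * t J ν N = tL J N (γ μ ν)) :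
    ∀ (N : ℕ) (μ ν : Exp), wt μ + wt ν = N → ∀ π, N < wt π → γ μ ν π = 0 := by
  intro N
  induction N using Nat.strong_induction_on with
  | _ N ih =>
  intro μ ν hN π hπ
  by_contra hne
  obtain ⟨π0, h1, h2⟩ := Finset.exists_max_image (γ μ ν).support wt ⟨π, Finsupp.mem_support_iff.mpr hne⟩
  have h3 : N < wt π0 := lt_of_lt_of_le hπ (h2 π (Finsupp.mem_support_iff.mpr hne))
  have h4 : π0 ≠ 0 := by rintro rfl; simp [wt] at h3
  obtain ⟨l, hl⟩ := Finsupp.support_nonempty_iff.mpr h4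
  have hl' : Finsupp.single l 1 ≤ π0 := by
    rw [Finsupp.single_le_iff]; exact Nat.one_le_iff_ne_zero.mpr (Finsupp.mem_support_iff.mp hl)
  obtain ⟨π', hπ'⟩ := exists_add_of_le hl'
  have hw : wt π0 = l + wt π' := by rw [hπ', wt_add, wt_single, one_mul]
  have e := h.star_at γ hγ l μ ν π'
  have lp := l.pos
  rw [Finset.sum_eq_zero, Finset.sum_eq_zero, Finset.sum_eq_single π0] at e
  · have hb : bb K (l : ℕ) ≠ 0 := by
      rw [bb]; apply div_ne_zero (pow_ne_zero _ (by simp)); exact_mod_cast lp.ne'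
    rw [cm, if_pos (by omega), show wt π0 - wt π' = l by omega, wB_self, MvPolynomial.coeff_smul, pn_coe, hπ', add_comm (Finsupp.single l 1),
      mul_comm (MvPolynomial.X l), MvPolynomial.coeff_mul_X, MvPolynomial.coeff_monomial, if_pos rfl, ← add_comm (Finsupp.single l 1), ← hπ'] at e
    rw [zero_add, eq_comm] at e
    have := h.al0
    refine mul_ne_zero (Finsupp.mem_support_iff.mp h1) (mul_ne_zero hb ?_) e
    simpa using this
  · intro π1 hπ1 hne1
    have h5 := h2 π1 hπ1
    rcases Nat.lt_or_ge (wt π1) (wt π0) with h6 | h6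
    · rw [cm_zero _ _ _ _ (by omega), mul_zero]
    · rw [cm, if_pos (by omega), show wt π1 - wt π' = l by omega, wB_self, MvPolynomial.coeff_smul, pn_coe, MvPolynomial.X, MvPolynomial.monomial_mul, MvPolynomial.coeff_monomial, ← hπ', if_neg (Ne.symm hne1)]
      simp
  · intro h5; exact absurd h1 h5
  · intro μ' hμ'
    rcases Nat.lt_or_ge (wt μ) (wt μ' + l) with h6 | h6
    · rw [cm_zero _ _ _ _ h6, zero_mul]
    · rw [ih (wt μ' + wt ν) (by omega) μ' ν rfl π' (by omega), mul_zero]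
  · intro ν' hν'
    rcases Nat.lt_or_ge (wt ν) (wt ν' + l) with h6 | h6
    · rw [cm_zero _ _ _ _ h6, zero_mul]
    · rw [ih (wt μ + wt ν') (by omega) μ ν' rfl π' (by omega), mul_zero]
end JF
end JK
end

noncomputable section
namespace JK
open Polynomial
variable {K : Type} [Field K] [CharZero K] (al : K)

lemma conv (k l : ℕ) (m m' : Exp) (A : ℕ → Prop) [DecidablePred A] (P : Prop) [Decidable P] (x : K) (H1 : ∀ n j, n + j = k → wt m = wt m' + n → (A j ↔ P)) (H2 : P → wt m' + k < wt m → x = 0) :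
    ∑ nj ∈ Finset.HasAntidiagonal.antidiagonal k, bb K nj.1 * (MvPolynomial.coeff m (wB al nj.1 l (MvPolynomial.monomial m' 1)) * (if A nj.2 then x else 0)) =
      if P then cm al l m m' * x else 0 := by
  by_cases hd : wt m' ≤ wt m ∧ wt m ≤ wt m' + k
  · rw [Finset.sum_eq_single (wt m - wt m', k - (wt m - wt m'))]
    · have := H1 (wt m - wt m') (k - (wt m - wt m')) (by omega) (by omega)
      simp only [this]
      rw [cm, if_pos hd.1]
      split_ifs
      · ring
      · simp
    · intro nj hnj hne
      rw [Finset.HasAntidiagonal.mem_antidiagonal] at hnj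
      rw [wB_wt]
      · simp
      · intro h; exact hne (Prod.ext (by show nj.1 = wt m - wt m'; omega) (by show nj.2 = k - (wt m - wt m'); omega))
    · intro h; exact absurd (by rw [Finset.HasAntidiagonal.mem_antidiagonal]; show wt m - wt m' + (k - (wt m - wt m')) = k; omega) h
  · rw [Finset.sum_eq_zero]
    · split_ifs with hP
      · by_cases h1 : wt m' ≤ wt m
        · rw [H2 hP (by omega), mul_zero]
        · rw [cm, if_neg h1, zero_mul]
      · rfl
    · intro nj hnj
      rw [Finset.HasAntidiagonal.mem_antidiagonal] at hnj
      rw [wB_wt]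
      · simp
      · omega

def gop (γ : Exp → Exp → (Exp →₀ K)) (μ ν : Exp) (k : ℕ) : S K →ₗ[K] K :=
  ∑ π ∈ (γ μ ν).support, (if wt π + k = wt μ + wt ν then γ μ ν π else 0) • MvPolynomial.lcoeff K π
lemma gop_apply (γ : Exp → Exp → (Exp →₀ K)) (μ ν : Exp) (k : ℕ) (f : S K) : gop γ μ ν k f =
    ∑ π ∈ (γ μ ν).support, (if wt π + k = wt μ + wt ν then γ μ ν π else 0) * MvPolynomial.coeff π f := by
  simp only [gop, LinearMap.sum_apply, LinearMap.smul_apply, smul_eq_mul]; rfl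
lemma gop_mon (γ : Exp → Exp → (Exp →₀ K)) (μ ν : Exp) (k : ℕ) (π : Exp) : gop γ μ ν k (MvPolynomial.monomial π 1) =
    if wt π + k = wt μ + wt ν then γ μ ν π else 0 := by
  rw [gop_apply, Finset.sum_eq_single π]
  · rw [MvPolynomial.coeff_monomial, if_pos rfl, mul_one]
  · intro b _ hb; rw [MvPolynomial.coeff_monomial, if_neg (Ne.symm hb), mul_zero]
  · intro h; rw [Finsupp.notMem_support_iff.mp h]; simp
def stp (l n : ℕ) (H : Exp → Exp → K) (μ ν : Exp) : K :=
  ∑ m' ∈ Wl (wt μ), MvPolynomial.coeff μ (wB al n l (MvPolynomial.monomial m' 1)) * H m' ν +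
  ∑ m' ∈ Wl (wt ν), MvPolynomial.coeff ν (wB al n l (MvPolynomial.monomial m' 1)) * H μ m'

lemma mon_ext (T T' : S K →ₗ[K] K) (h : ∀ m, T (MvPolynomial.monomial m 1) = T' (MvPolynomial.monomial m 1)) : T = T' := by
  apply (MvPolynomial.basisMonomials ℕ+ K).ext
  intro m
  rw [MvPolynomial.coe_basisMonomials]; exact h m

lemma single_op (γ : Exp → Exp → (Exp →₀ K)) 
    (star : ∀ l μ ν π', ∑ ν' ∈ Wl (wt ν), cm al l ν ν' * γ μ ν' π' + ∑ μ' ∈ Wl (wt μ), cm al l μ μ' * γ μ' ν π' = ∑ π ∈ (γ μ ν).support, γ μ ν π * cm al l π π')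
    (bound : ∀ μ ν π, wt μ + wt ν < wt π → γ μ ν π = 0) (l k : ℕ) (μ ν : Exp) (f : S K) :
    ∑ nj ∈ Finset.HasAntidiagonal.antidiagonal k, bb K nj.1 * stp al l nj.1 (fun a b => gop γ a b nj.2 f) μ ν =
    ∑ nj ∈ Finset.HasAntidiagonal.antidiagonal k, bb K nj.1 * gop γ μ ν nj.2 (wB al nj.1 l f) := by
  let T : S K →ₗ[K] K := ∑ nj ∈ Finset.HasAntidiagonal.antidiagonal k, bb K nj.1 • 
    (∑ m' ∈ Wl (wt μ), MvPolynomial.coeff μ (wB al nj.1 l (MvPolynomial.monomial m' 1)) • gop γ m' ν nj.2 +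
     ∑ m' ∈ Wl (wt ν), MvPolynomial.coeff ν (wB al nj.1 l (MvPolynomial.monomial m' 1)) • gop γ μ m' nj.2)
  let T' : S K →ₗ[K] K := ∑ nj ∈ Finset.HasAntidiagonal.antidiagonal k, bb K nj.1 • (gop γ μ ν nj.2 ∘ₗ wB al nj.1 l)
  have hT : ∀ f, T f = ∑ nj ∈ Finset.HasAntidiagonal.antidiagonal k, bb K nj.1 * stp al l nj.1 (fun a b => gop γ a b nj.2 f) μ ν := by
    intro f
    simp only [T, stp, LinearMap.sum_apply, LinearMap.smul_apply, LinearMap.add_apply, smul_eq_mul]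
  have hT' : ∀ f, T' f = ∑ nj ∈ Finset.HasAntidiagonal.antidiagonal k, bb K nj.1 * gop γ μ ν nj.2 (wB al nj.1 l f) := by
    intro f
    simp only [T', LinearMap.sum_apply, LinearMap.smul_apply, LinearMap.comp_apply, smul_eq_mul]
  rw [← hT, ← hT']
  refine LinearMap.congr_fun (mon_ext T T' fun π' => ?_) f
  rw [hT, hT']
  simp only [stp, gop_mon, mul_add, Finset.sum_add_distrib, Finset.mul_sum]
  rw [Finset.sum_comm, Finset.sum_comm (t := Wl (wt ν))]
  simp only [gop_apply, Finset.mul_sum]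
  rw [Finset.sum_comm (t := (γ μ ν).support)]
  have e1 : ∀ m' ∈ Wl (wt μ), _ := fun m' (_ : m' ∈ Wl (wt μ)) => conv al k l μ m' (fun j => wt π' + j = wt m' + wt ν) (wt π' + k = wt μ + wt ν) (γ m' ν π') (by intros; omega)
    (fun h1 h2 => bound _ _ _ (by omega))
  have e2 : ∀ m' ∈ Wl (wt ν), _ := fun m' (_ : m' ∈ Wl (wt ν)) => conv al k l ν m' (fun j => wt π' + j = wt μ + wt m') (wt π' + k = wt μ + wt ν) (γ μ m' π') (by intros; omega)
    (fun h1 h2 => bound _ _ _ (by omega))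
  have e3 : ∀ π ∈ (γ μ ν).support, _ := fun π (_ : π ∈ (γ μ ν).support) => conv al k l π π' (fun j => wt π + j = wt μ + wt ν) (wt π' + k = wt μ + wt ν) (γ μ ν π) (by intros; omega)
    (fun h1 h2 => bound _ _ _ (by omega))
  rw [Finset.sum_congr rfl e1, Finset.sum_congr rfl e2]
  have e4 : ∀ π ∈ (γ μ ν).support, ∑ nj ∈ Finset.HasAntidiagonal.antidiagonal k, bb K nj.1 * ((if wt π + nj.2 = wt μ + wt ν then γ μ ν π else 0) * MvPolynomial.coeff π (wB al nj.1 l (MvPolynomial.monomial π' 1))) = if wt π' + k = wt μ + wt ν then γ μ ν π * cm al l π π' else 0 := by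
    intro π hπ
    rw [mul_comm (γ μ ν π), ← e3 π hπ]
    exact Finset.sum_congr rfl fun nj _ => by rw [mul_comm (ite _ _ _)]
  rw [Finset.sum_congr rfl e4]
  split_ifs with hP
  · rw [← star l μ ν π', add_comm]
  · simp

/-- triple antidiagonal sums -/
lemma anti3 (k : ℕ) (a : ℕ → ℕ → ℕ → K) :
    ∑ x ∈ Finset.HasAntidiagonal.antidiagonal k, ∑ y ∈ Finset.HasAntidiagonal.antidiagonal x.2, a x.1 y.1 y.2 =
    ∑ x ∈ Finset.HasAntidiagonal.antidiagonal k, ∑ y ∈ Finset.HasAntidiagonal.antidiagonal x.2, a y.1 x.1 y.2 := by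
  rw [Finset.sum_sigma', Finset.sum_sigma']
  refine Finset.sum_nbij' (fun x => ⟨(x.2.1, x.1.1 + x.2.2), (x.1.1, x.2.2)⟩) (fun x => ⟨(x.2.1, x.1.1 + x.2.2), (x.1.1, x.2.2)⟩) ?_ ?_ ?_ ?_ ?_
  all_goals
    rintro ⟨⟨a1, b1⟩, ⟨c1, d1⟩⟩ h
    simp only [Finset.mem_sigma, Finset.HasAntidiagonal.mem_antidiagonal] at h
    first
    | exact Finset.mem_sigma.mpr ⟨Finset.HasAntidiagonal.mem_antidiagonal.mpr (by dsimp only; omega), Finset.HasAntidiagonal.mem_antidiagonal.mpr (by dsimp only)⟩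
    | (obtain ⟨h1, h2⟩ := h; subst h2; rfl)
    | (obtain ⟨h1, h2⟩ := h; subst h2; subst h1; rfl)
    | rfl
lemma anti3' (k : ℕ) (a : ℕ → ℕ → ℕ → K) :
    ∑ x ∈ Finset.HasAntidiagonal.antidiagonal k, ∑ y ∈ Finset.HasAntidiagonal.antidiagonal x.2, a x.1 y.1 y.2 =
    ∑ x ∈ Finset.HasAntidiagonal.antidiagonal k, ∑ y ∈ Finset.HasAntidiagonal.antidiagonal x.1, a y.1 y.2 x.2 := by
  rw [Finset.sum_sigma', Finset.sum_sigma']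
  refine Finset.sum_nbij' (fun x => ⟨(x.1.1 + x.2.1, x.2.2), (x.1.1, x.2.1)⟩) (fun x => ⟨(x.2.1, x.2.2 + x.1.2), (x.2.2, x.1.2)⟩) ?_ ?_ ?_ ?_ ?_
  all_goals
    rintro ⟨⟨a1, b1⟩, ⟨c1, d1⟩⟩ h
    simp only [Finset.mem_sigma, Finset.HasAntidiagonal.mem_antidiagonal] at h
    first
    | exact Finset.mem_sigma.mpr ⟨Finset.HasAntidiagonal.mem_antidiagonal.mpr (by dsimp only; omega), Finset.HasAntidiagonal.mem_antidiagonal.mpr (by dsimp only)⟩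
    | (obtain ⟨h1, h2⟩ := h; subst h2; rfl)
    | (obtain ⟨h1, h2⟩ := h; subst h2; subst h1; rfl)
    | rfl
end JK
end

noncomputable section
namespace JK
open Polynomial

lemma toExp_apply (l : JPartition) (i : ℕ+) : toExp l i = Multiset.count i l := by
  rw [toExp, Finsupp.finset_sum_apply]
  by_cases h : i ∈ l.toFinset
  · rw [Finset.sum_eq_single i]
    · simp
    · intro b _ hb; simp [hb]
    · intro h1; exact absurd h h1
  · rw [Multiset.count_eq_zero.mpr (by simpa using h)]
    refine Finset.sum_eq_zero fun b hb => ?_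
    rw [Finsupp.single_apply, if_neg]; rintro rfl; exact h hb
def eP : JPartition ≃ Exp := Multiset.toFinsupp.toEquiv
lemma eP_apply (l : JPartition) : eP l = toExp l := by
  ext i; rw [toExp_apply]; exact Multiset.toFinsupp_apply l i
lemma toExp_symm (m : Exp) : toExp (eP.symm m) = m := by rw [← eP_apply, Equiv.apply_symm_apply]
lemma symm_toExp (l : JPartition) : eP.symm (toExp l) = l := by rw [← eP_apply, Equiv.symm_apply_apply]
lemma toExp_add (l l' : JPartition) : toExp (l + l') = toExp l + toExp l' := by
  ext i; rw [Finsupp.add_apply, toExp_apply, toExp_apply, toExp_apply, Multiset.count_add]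
lemma toExp_rep (k : ℕ) (i : ℕ+) : toExp (Multiset.replicate k i) = Finsupp.single i k := by
  ext j; rw [toExp_apply, Multiset.count_replicate, Finsupp.single_apply]
lemma wt_toExp (l : JPartition) : wt (toExp l) = psize l := by
  induction l using Multiset.induction with
  | empty => rw [show (0 : JPartition) = Multiset.replicate 0 1 from rfl, toExp_rep]; simp [wt, psize]
  | cons a s ih =>
    rw [← Multiset.singleton_add, toExp_add, wt_add, ih, ← Multiset.replicate_one, toExp_rep, wt_single]
    simp [psize]
lemma finsum_eP (φ : Exp → F) (s : Finset Exp) (hs : ∀ m, φ m ≠ 0 → m ∈ s) : ∑ᶠ l : JPartition, φ (toExp l) = ∑ m ∈ s, φ m := by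
  have : ∑ᶠ l : JPartition, φ (toExp l) = ∑ᶠ m : Exp, φ m := by
    rw [← finsum_comp_equiv eP]; exact finsum_congr fun l => by rw [eP_apply]
  rw [this, finsum_eq_sum_of_support_subset]
  intro m hm; exact hs m hm
section
variable (g : JPartition → JPartition → JPartition → F) (γ : Exp → Exp → (Exp →₀ F)) (hγ : ∀ μ ν π, γ (toExp μ) (toExp ν) (toExp π) = g π μ ν)
include hγ
lemma Gop_eq (f : SymA) (μ ν : JPartition) (k : ℕ) : GopCoef g f μ ν k = gop γ (toExp μ) (toExp ν) k f := by
  rw [GopCoef, gop_apply, ← finsum_eP]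
  · refine finsum_congr fun π => ?_
    rw [wt_toExp, wt_toExp, wt_toExp, hγ]
    split_ifs <;> simp
  · intro m hm
    rw [Finsupp.mem_support_iff]; intro h0; rw [h0] at hm; simp at hm
end
lemma Cqr_eq (l n : ℕ) (h : QRc) (H : Exp → Exp → F) (hH : ∀ μ ν, h μ ν = H (toExp μ) (toExp ν)) (μ ν : JPartition) :
    CqrStep l n h μ ν = stp alpha l n H (toExp μ) (toExp ν) := by
  rw [CqrStep, stp]
  congr 1
  · rw [← finsum_eP (fun m' => MvPolynomial.coeff (toExp μ) (wB alpha n l (MvPolynomial.monomial m' 1)) * H m' (toExp ν))]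
    · exact finsum_congr fun m' => by rw [Bmat, Bc_eq, hH]
    · intro m' hm'
      rw [mem_Wl]; by_contra hc
      exact hm' (by rw [wB_wt _ _ _ _ _ (by omega), zero_mul])
  · rw [← finsum_eP (fun m' => MvPolynomial.coeff (toExp ν) (wB alpha n l (MvPolynomial.monomial m' 1)) * H (toExp μ) m')]
    · exact finsum_congr fun m' => by rw [Bmat, Bc_eq, hH]
    · intro m' hm'
      rw [mem_Wl]; by_contra hc
      exact hm' (by rw [wB_wt _ _ _ _ _ (by omega), zero_mul])
lemma Icc_anti {M : Type} [AddCommMonoid M] (k : ℕ) (a : ℕ → ℕ → M) (h0 : a 0 k = 0) : ∑ n ∈ Finset.Icc 1 k, a n (k - n) = ∑ nj ∈ Finset.HasAntidiagonal.antidiagonal k, a nj.1 nj.2 := by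
  rw [Finset.Nat.sum_antidiagonal_eq_sum_range_succ a k, Finset.sum_range_succ', Nat.sub_zero, h0, add_zero,
    Finset.range_eq_Ico, Finset.sum_Ico_add' (fun i => a i (k - i)) 0 k 1]
  rfl
section
variable (g : JPartition → JPartition → JPartition → F) (γ : Exp → Exp → (Exp →₀ F)) (hγ : ∀ μ ν π, γ (toExp μ) (toExp ν) (toExp π) = g π μ ν)
include hγ
lemma list_op 
    (star : ∀ l μ ν π', ∑ ν' ∈ Wl (wt ν), cm alpha l ν ν' * γ μ ν' π' + ∑ μ' ∈ Wl (wt μ), cm alpha l μ μ' * γ μ' ν π' = ∑ π ∈ (γ μ ν).support, γ μ ν π * cm alpha l π π')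
    (bound : ∀ μ ν π, wt μ + wt ν < wt π → γ μ ν π = 0) (f : SymA) (Ls : List ℕ+) : ∀ (k : ℕ) (μ ν : JPartition),
    applyCqrList Ls (fun j => fun mu' nu' => GopCoef g f mu' nu' j) k μ ν =
      ∑ ij ∈ Finset.HasAntidiagonal.antidiagonal k, gop γ (toExp μ) (toExp ν) ij.2 (applyCpList Ls (fun j => if j = 0 then f else 0) ij.1) := by
  induction Ls with
  | nil =>
    intro k μ ν
    simp only [applyCqrList, applyCpList]
    rw [Gop_eq g γ hγ, Finset.sum_eq_single (0, k)]
    · simp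
    · intro ij hij hne
      rw [Finset.HasAntidiagonal.mem_antidiagonal] at hij
      rw [if_neg, map_zero]
      intro h0; exact hne (Prod.ext h0 (by show ij.2 = k; omega))
    · intro h1; exact absurd (by simp) h1
  | cons x Ls ih =>
    intro k μ ν
    set Fs := applyCpList Ls (fun j => if j = 0 then f else 0) with hFs
    have e1 : applyCqrList (x :: Ls) (fun j => fun mu' nu' => GopCoef g f mu' nu' j) k μ ν =
        ∑ nj ∈ Finset.HasAntidiagonal.antidiagonal k, bb F nj.1 * CqrStep x nj.1 (applyCqrList Ls (fun j => fun mu' nu' => GopCoef g f mu' nu' j) nj.2) μ ν := by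
      exact Icc_anti k (fun n j => bb F n * CqrStep x n (applyCqrList Ls (fun j => fun mu' nu' => GopCoef g f mu' nu' j) j) μ ν) (by simp [bb])
    have e2 : ∀ k, applyCpList (x :: Ls) (fun j => if j = 0 then f else 0) k = 
        ∑ nj ∈ Finset.HasAntidiagonal.antidiagonal k, bb F nj.1 • wB alpha nj.1 x (Fs nj.2) := by
      intro k
      rw [← Icc_anti k (fun n j => bb F n • wB alpha n x (Fs j)) (by simp [bb])]
      show ∑ n ∈ Finset.Icc 1 k, ((-1 : F) ^ n / (n : F)) • Bc n x (Fs (k - n)) = _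
      exact Finset.sum_congr rfl fun n _ => by rw [Bc_eq, bb]
    rw [e1]
    have e3 : ∀ nj ∈ Finset.HasAntidiagonal.antidiagonal k, bb F nj.1 * CqrStep x nj.1 (applyCqrList Ls (fun j => fun mu' nu' => GopCoef g f mu' nu' j) nj.2) μ ν =
       ∑ ij ∈ Finset.HasAntidiagonal.antidiagonal nj.2, bb F nj.1 * stp alpha x nj.1 (fun a b => gop γ a b ij.2 (Fs ij.1)) (toExp μ) (toExp ν) := by
      intro nj _
      rw [Cqr_eq x nj.1 _ (fun a b => ∑ ij ∈ Finset.HasAntidiagonal.antidiagonal nj.2, gop γ a b ij.2 (Fs ij.1)) (fun μ ν => ih nj.2 μ ν), ← Finset.mul_sum]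
      simp only [stp, Finset.mul_sum, Finset.sum_add_distrib]
      rw [Finset.sum_comm, Finset.sum_comm (s := Wl (wt (toExp ν)))]
    rw [Finset.sum_congr rfl e3, anti3 k (fun n i j => bb F n * stp alpha x n (fun a b => gop γ a b j (Fs i)) (toExp μ) (toExp ν))]
    have e4 : ∀ y ∈ Finset.HasAntidiagonal.antidiagonal k, _ := fun (y : ℕ × ℕ) (_ : y ∈ Finset.HasAntidiagonal.antidiagonal k) => single_op alpha γ star bound x y.2 (toExp μ) (toExp ν) (Fs y.1)
    rw [Finset.sum_congr rfl e4, anti3 k (fun i n j => bb F n * gop γ (toExp μ) (toExp ν) j (wB alpha n x (Fs i))),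
      anti3' k (fun n i j => bb F n * gop γ (toExp μ) (toExp ν) j (wB alpha n x (Fs i)))]
    refine Finset.sum_congr rfl fun y _ => ?_
    rw [e2, map_sum]
    exact Finset.sum_congr rfl fun z _ => by rw [map_smul, smul_eq_mul]
end
end JK
end

noncomputable section
namespace JK
open Polynomial

lemma map_do (l : JPartition) : (l.map fun i => (i : ℕ) : Multiset ℕ) = Multiset.map (fun i : ℕ+ => (i : ℕ)) l := by
  simp
lemma sp_coe (l : JPartition) : ((sortedParts l : List ℕ) : Multiset ℕ) = l.map (fun i : ℕ+ => (i : ℕ)) := by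
  rw [sortedParts, Multiset.coe_reverse, Multiset.sort_eq]
  exact map_do l
lemma sp_isP (l : JPartition) : IsP (sortedParts l) := by
  constructor
  · rw [sortedParts, List.pairwise_reverse]
    exact (Multiset.pairwise_sort _ _).imp fun h => h
  · intro x hx
    have : x ∈ ((sortedParts l : List ℕ) : Multiset ℕ) := hx
    rw [sp_coe, Multiset.mem_map] at this
    obtain ⟨i, _, rfl⟩ := this
    exact i.pos
lemma sp_sum (l : JPartition) : (sortedParts l).sum = psize l := by
  rw [psize, map_do, ← sp_coe, Multiset.sum_coe]
lemma sp_len (l : JPartition) : (sortedParts l).length = plen l := by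
  rw [plen, ← Multiset.card_map (fun i : ℕ+ => (i : ℕ)) l, ← sp_coe, Multiset.coe_card]
def pt (l : JPartition) : Pt := ⟨sortedParts l, sp_isP l⟩
lemma pt_bij : Function.Bijective pt := by
  constructor
  · intro l l' h
    have h1 : sortedParts l = sortedParts l' := congrArg Subtype.val h
    apply Multiset.map_injective PNat.coe_injective
    show Multiset.map (fun i : ℕ+ => (i : ℕ)) l = Multiset.map (fun i : ℕ+ => (i : ℕ)) l'
    rw [← sp_coe, ← sp_coe, h1]
  · rintro ⟨L, hL⟩
    refine ⟨((L.map Nat.toPNat' : List ℕ+) : Multiset ℕ+), ?_⟩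
    apply Subtype.ext
    show sortedParts _ = L
    apply List.Perm.eq_of_pairwise' (sp_isP _).1 hL.1
    rw [← Multiset.coe_eq_coe, sp_coe, Multiset.map_coe, List.map_map]
    congr 1
    conv_rhs => rw [← List.map_id L]
    refine List.map_congr_left fun x hx => ?_
    show ((Nat.toPNat' x : ℕ+) : ℕ) = x
    exact PNat.toPNat'_coe (hL.2 x hx)
def ept : JPartition ≃ Pt := Equiv.ofBijective pt pt_bij
lemma ept_apply (l : JPartition) : ept l = pt l := rfl

lemma zalpha_eq (m : Exp) : zalpha m = zz alpha m := by
  rw [zalpha, zz]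
  congr 1
  rw [Finsupp.prod, Finsupp.prod, map_prod]
  exact Finset.prod_congr rfl fun i _ => by simp
lemma hall_eq (f g : SymA) : hall f g = HB alpha f g := by
  rw [hall, HB_sum alpha f g f.support (Finset.Subset.refl _)]
  exact Finset.sum_congr rfl fun m _ => by rw [zalpha_eq]
lemma gen_al (a b : ℤ) (h : (a : F) * alpha = b) : a = 0 ∧ b = 0 := by
  have h1 : algebraMap ℚ[X] F (C (a : ℚ) * X - C (b : ℚ)) = 0 := by
    rw [map_sub, map_mul, RatFunc.algebraMap_X, RatFunc.algebraMap_C, RatFunc.algebraMap_C]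
    rw [sub_eq_zero]
    simpa [alpha] using h
  have h2 : C (a : ℚ) * X - C (b : ℚ) = 0 := by
    apply RatFunc.algebraMap_injective ℚ; rw [h1, map_zero]
  have h3 := congrArg (fun p => p.coeff 1) h2
  have h4 := congrArg (fun p => p.coeff 0) h2
  simp only [coeff_sub, coeff_C_mul, coeff_X_one, coeff_C, coeff_zero, coeff_X_zero, mul_one, mul_zero, one_ne_zero, if_true, if_false, sub_zero, zero_sub, neg_eq_zero] at h3 h4
  exact ⟨by exact_mod_cast h3, by exact_mod_cast h4⟩
lemma aniso_al (f : SymA) (h : HB alpha f f = 0) : f = 0 := by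
  rw [HB_sum alpha f f f.support (Finset.Subset.refl _)] at h
  obtain ⟨d, hd⟩ := IsLocalization.exist_integer_multiples_of_finset (nonZeroDivisors ℚ[X]) (f.support.image fun m => MvPolynomial.coeff m f)
  have hd0 : algebraMap ℚ[X] F d ≠ 0 := by
    intro h0; rw [← map_zero (algebraMap ℚ[X] F)] at h0
    exact nonZeroDivisors.coe_ne_zero d (RatFunc.algebraMap_injective ℚ h0)
  have hP : ∀ m, ∃ p : ℚ[X], algebraMap ℚ[X] F p = algebraMap ℚ[X] F d * MvPolynomial.coeff m f := by
    intro m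
    by_cases hm : m ∈ f.support
    · obtain ⟨p, hp⟩ := hd _ (Finset.mem_image_of_mem _ hm)
      exact ⟨p, by rw [hp, Algebra.smul_def]⟩
    · exact ⟨0, by rw [MvPolynomial.notMem_support_iff.mp hm, map_zero, mul_zero]⟩
  choose P hP using hP
  set z : Exp → ℚ := fun m => m.prod fun i k => (Nat.factorial k : ℚ) * ((i : ℕ) : ℚ) ^ k with hz
  have hzp : ∀ m, 0 < z m := by
    intro m
    exact Finset.prod_pos fun i _ => by positivity
  have hsum : ∑ m ∈ f.support, P m * P m * (C (z m) * X ^ (m.sum fun _ k => k)) = 0 := by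
    apply RatFunc.algebraMap_injective ℚ
    rw [map_zero, map_sum]
    have : ∀ m ∈ f.support, algebraMap ℚ[X] F (P m * P m * (C (z m) * X ^ (m.sum fun _ k => k))) =
       algebraMap ℚ[X] F d * algebraMap ℚ[X] F d * (MvPolynomial.coeff m f * MvPolynomial.coeff m f * zz alpha m) := by
      intro m _
      rw [← zalpha_eq, zalpha, map_mul, map_mul, map_mul, map_pow, hP, RatFunc.algebraMap_X, RatFunc.algebraMap_C, alpha]
      rw [show algebraMap ℚ F (m.prod fun i k => (Nat.factorial k : ℚ) * ((i : ℕ) : ℚ) ^ k) = RatFunc.C (z m) from by rw [eq_ratCast, eq_ratCast]]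
      ring
    rw [Finset.sum_congr rfl this, ← Finset.mul_sum, h, mul_zero]
  ext m
  rw [MvPolynomial.coeff_zero]
  by_cases hm : m ∈ f.support
  swap
  · exact MvPolynomial.notMem_support_iff.mp hm
  have hPm : P m = 0 := by
    apply Polynomial.eq_zero_of_infinite_isRoot
    refine Set.Infinite.mono ?_ (Set.infinite_range_of_injective (f := fun n : ℕ => ((n : ℚ) + 1)) (fun a b hab => by simpa using hab))
    rintro _ ⟨n, rfl⟩
    have h1 := congrArg (Polynomial.eval ((n : ℚ) + 1)) hsum
    rw [Polynomial.eval_finset_sum, Polynomial.eval_zero] at h1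
    rw [Finset.sum_eq_zero_iff_of_nonneg] at h1
    · have h2 := h1 m hm
      simp only [eval_mul, eval_C, eval_pow, eval_X] at h2
      have h3 : (z m * ((n:ℚ) + 1) ^ (m.sum fun _ k => k)) ≠ 0 := by
        have := hzp m; positivity
      have h4 := (mul_eq_zero.mp h2).resolve_right h3
      exact mul_self_eq_zero.mp h4
    · intro m' _
      simp only [eval_mul, eval_C, eval_pow, eval_X]
      have := hzp m'
      exact mul_nonneg (mul_self_nonneg _) (by positivity)
  have h5 := hP m
  rw [hPm, map_zero] at h5
  exact (mul_eq_zero.mp h5.symm).resolve_left hd0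

lemma mkJF (J : JPartition → SymA) (hJ : IsJackFamily J) : JF alpha (fun L => J (ept.symm L)) where
  orth L M hLM := by
    rw [← hall_eq]; exact hJ.orthogonal _ _ fun h => hLM (ept.symm.injective h)
  aniso := aniso_al
  gen := gen_al
  tri L M hM := by
    obtain ⟨l, rfl⟩ := ept.surjective L
    obtain ⟨m, rfl⟩ := ept.surjective M
    rw [Equiv.symm_apply_apply] at hM
    have hdom : dominates m l := by
      by_contra hc
      apply hM
      have h1 := hJ.triangular l m hc
      set N := psize l + psize m + plen m with hN
      have h2 := MM_ev N (fun j : Fin N => (sortedParts m).getD (j : ℕ) 0) (J l)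
      rw [ofFn_getD _ _ (by rw [sp_len]; omega), MM_zeros] at h2
      exact h2.symm.trans h1
    show (sortedParts m).sum = (sortedParts l).sum ∧ hd (sortedParts m) ≤ hd (sortedParts l) ∧ (ept m = ept l ∨ _)
    refine ⟨by rw [sp_sum, sp_sum]; exact hdom.1, ?_, ?_⟩
    · have h1 := hdom.2 1
      rw [topSum, topSum] at h1
      rw [hd, hd]
      revert h1
      cases sortedParts m <;> cases sortedParts l <;> simp
    · rcases dom_nn (sp_isP l) (sp_isP m) (by rw [sp_sum, sp_sum]; exact hdom.1.symm) hdom.2 with h | h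
      · exact Or.inl (Subtype.ext h)
      · exact Or.inr h
  norm L := by
    obtain ⟨l, rfl⟩ := ept.surjective L
    rw [Equiv.symm_apply_apply]
    show MvPolynomial.coeff (Finsupp.single 1 (sortedParts l).sum) (J l) = 1
    rw [sp_sum]; exact hJ.normalized l

lemma theta_eq (J : JPartition → SymA) (mu lam : JPartition) : theta J mu lam = JF.t (fun L => J (ept.symm L)) (toExp mu) (ept lam) := by
  have hs : (ept lam).1.sum = psize lam := sp_sum lam
  rw [theta, JF.t, wt_toExp]
  split_ifs with h
  · rw [JF.Th_gt _ _ (by rw [hs]; exact h), MvPolynomial.coeff_zero]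
  · rw [JF.Th_coeff _ _ _ (by rw [hs]; omega), hs, Equiv.symm_apply_apply, addOnes, toExp_add, toExp_rep, toExp_apply mu 1, pmult]

theorem main (J : JPartition → SymA) (hJ : IsJackFamily J)
    (g : JPartition → JPartition → JPartition → F) (hg : IsStructCoeffs J g)
    (Ls : List ℕ+) (f : SymA) (k : ℕ) (mu nu : JPartition) :
    applyCqrList Ls (fun j => fun mu' nu' => GopCoef g f mu' nu' j) k mu nu
      = ∑ i ∈ Finset.range (k + 1),
          GopCoef g (applyCpList Ls
            (fun j => if j = 0 then f else 0) i) mu nu (k - i) := by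
  have h := mkJF J hJ
  have hfin : ∀ μ ν : Exp, (Function.support fun π : Exp => g (eP.symm π) (eP.symm μ) (eP.symm ν)).Finite := by
    intro μ ν
    exact (hg.1 (eP.symm μ) (eP.symm ν)).preimage (f := eP.symm) eP.symm.injective.injOn
  let γ : Exp → Exp → (Exp →₀ F) := fun μ ν => Finsupp.ofSupportFinite _ (hfin μ ν)
  have γa : ∀ μ ν π, γ μ ν π = g (eP.symm π) (eP.symm μ) (eP.symm ν) := fun μ ν π => rfl
  have hγ : ∀ μ ν π, γ (toExp μ) (toExp ν) (toExp π) = g π μ ν := by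
    intro μ ν π; rw [γa, symm_toExp, symm_toExp, symm_toExp]
  have hprod : ∀ μ ν (N : Pt), JF.t (fun L => J (ept.symm L)) μ N * JF.t (fun L => J (ept.symm L)) ν N = JF.tL (fun L => J (ept.symm L)) N (γ μ ν) := by
    intro μ ν N
    have h1 := hg.2 (eP.symm μ) (eP.symm ν) (ept.symm N)
    rw [theta_eq, theta_eq, toExp_symm, toExp_symm, Equiv.apply_symm_apply] at h1
    rw [h1, JF.tL_apply, Finsupp.sum, ← finsum_eP (fun π => γ μ ν π * JF.t (fun L => J (ept.symm L)) π N)]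
    · refine finsum_congr fun π => ?_
      rw [theta_eq, Equiv.apply_symm_apply, γa, symm_toExp]
    · intro m hm
      rw [Finsupp.mem_support_iff]; exact left_ne_zero_of_mul hm
  rw [list_op g γ hγ (h.star_at γ hprod) (fun μ ν π hw => h.bound γ hprod _ μ ν rfl π hw) f Ls k mu nu,
    Finset.Nat.sum_antidiagonal_eq_sum_range_succ (fun i j => gop γ (toExp mu) (toExp nu) j (applyCpList Ls (fun j => if j = 0 then f else 0) i)) k]
  exact Finset.sum_congr rfl fun i _ => by rw [Gop_eq g γ hγ]
end JK
end

/-- **Corollary 4.7.** For any partition `λ = [λ₁, …, λ_s]`: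
`∏_{1≤i≤s} (C_{λᵢ}^{(α)}(-t,q) + C_{λᵢ}^{(α)}(-t,r)) ⬝ 𝒢^{(α)}(t,p,q,r)
   = 𝒢^{(α)}(t,p,q,r) ⬝ ∏_{1≤i≤s} C_{λᵢ}^{(α)}(-t,p)`
as operators `ℚ(α)[p] → ℚ(α)[q,r]⟦t⟧`, stated coefficientwise: for every argument
`f ∈ ℚ(α)[p]`, every `t`-exponent `k` and every `q,r`-monomial `(μ, ν)`. -/
theorem statement12
    (J : JPartition → SymA) (hJ : IsJackFamily J)
    (g : JPartition → JPartition → JPartition → F) (hg : IsStructCoeffs J g)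
    (lam : JPartition) (f : SymA) (k : ℕ) (mu nu : JPartition) :
    applyCqrList (lam.sort (· ≤ ·)) (fun j => fun mu' nu' => GopCoef g f mu' nu' j) k mu nu
      = ∑ i ∈ Finset.range (k + 1),
          GopCoef g (applyCpList (lam.sort (· ≤ ·))
            (fun j => if j = 0 then f else 0) i) mu nu (k - i) := by
  exact JK.main J hJ g hg _ f k mu nu

end
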